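/- Let d ≥ 1, r ∈ ℕ, 1 ≤ p ≤ ∞, and μ = (m−1)/2 with an integer m ≥ 1. There exists a constant c > 0, independent of f and n, such that for every f ∈ C^r(B^d) and every integer n > r, E_{2n}(f)_{p,μ} ≤ c n^{−r} max_{1≤i<j≤d} E_n(D_{i,j}^r f)_{p,μ} + c n^{−r} max_{1≤i≤d} [ max_{1≤j<(r+1)/2} E_{n−r}(∂_i^j f)_{p,μ} + max_{(r+1)/2≤j≤r} E_{n−r}(∂_i^j f)_{p, μ+(j−r/2)p} ], where the inner maxima are over integers j in the indicated ranges and E_{n−r}(∂_i^j f)_{p,ν} is the best approximation with respect to the weight W_ν. -/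

import Mathlib

open MeasureTheory Finset Metric
open scoped ENNReal NNReal Real

noncomputable section

/-- The differential operator `D_{i,j} = x_j ∂_i − x_i ∂_j` acting on functions on `ℝ^d`. -/
def Dij {d : ℕ} (i j : Fin d) (f : EuclideanSpace ℝ (Fin d) → ℝ) :
    EuclideanSpace ℝ (Fin d) → ℝ :=
  fun x => x j * fderiv ℝ f x (EuclideanSpace.single i 1)
    - x i * fderiv ℝ f x (EuclideanSpace.single j 1)
/-- `φ(x) = √(1−‖x‖²)`. -/
def phiB {d : ℕ} (x : EuclideanSpace ℝ (Fin d)) : ℝ := Real.sqrt (1 - ‖x‖ ^ 2)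

/-- The partial derivative `∂_i`. -/
def pder {d : ℕ} (i : Fin d) (f : EuclideanSpace ℝ (Fin d) → ℝ) :
    EuclideanSpace ℝ (Fin d) → ℝ :=
  fun x => fderiv ℝ f x (EuclideanSpace.single i 1)

/-- The measure `W_ν(x) dx = (1−‖x‖²)^{ν−1/2} dx` on the unit ball `B^d`. -/
def ballMeasure (d : ℕ) (ν : ℝ) : Measure (EuclideanSpace ℝ (Fin d)) :=
  (volume.restrict (Metric.closedBall (0 : EuclideanSpace ℝ (Fin d)) 1)).withDensity
    fun x => ENNReal.ofReal ((1 - ‖x‖ ^ 2) ^ (ν - 1 / 2))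
/-- Best approximation `E_n(f)_{p,ν}` on the ball: the distance in `L^p(B^d, W_ν)`
from `f` to the polynomials of total degree at most `n`. -/
def ballEn (d : ℕ) (ν : ℝ) (p : ℝ≥0∞) (n : ℕ) (f : EuclideanSpace ℝ (Fin d) → ℝ) : ℝ≥0∞ :=
  ⨅ g : {g : MvPolynomial (Fin d) ℝ // g.totalDegree ≤ n},
    eLpNorm (fun x => f x - MvPolynomial.eval (fun i => x i) g.1) p (ballMeasure d ν)

namespace BallApprox

abbrev Eu (ι : Type) [Fintype ι] := EuclideanSpace ℝ ι
abbrev Sp (ι : Type) [Fintype ι] := sphere (0 : Eu ι) 1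

section P1
variable {ι : Type} [Fintype ι]

lemma Sp.norm_eq (x : Sp ι) : ‖x.1‖ = 1 := by
  simpa using x.2

/-- action of a linear isometry on the sphere -/
def act (h : Eu ι ≃ₗᵢ[ℝ] Eu ι) : C(Sp ι, Sp ι) where
  toFun x := ⟨h x.1, by simp [Sp.norm_eq x]⟩
  continuous_toFun := by
    apply Continuous.subtype_mk
    exact h.continuous.comp continuous_subtype_val

@[simp] lemma act_coe (h : Eu ι ≃ₗᵢ[ℝ] Eu ι) (x : Sp ι) : (act h x).1 = h x.1 := rfl

lemma act_symm_act (h : Eu ι ≃ₗᵢ[ℝ] Eu ι) (x : Sp ι) : act h.symm (act h x) = x := by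
  apply Subtype.ext; simp

lemma act_act_symm (h : Eu ι ≃ₗᵢ[ℝ] Eu ι) (x : Sp ι) : act h (act h.symm x) = x := by
  apply Subtype.ext; simp

/-- transitivity -/
lemma exists_act (x y : Sp ι) : ∃ h : Eu ι ≃ₗᵢ[ℝ] Eu ι, act h x = y := by
  refine ⟨Submodule.reflection (ℝ ∙ (x.1 - y.1))ᗮ, ?_⟩
  apply Subtype.ext
  simp only [act_coe]
  exact Submodule.reflection_sub (by rw [Sp.norm_eq, Sp.norm_eq])

/-- coordinates -/
def coord (i : ι) : C(Sp ι, ℝ) where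
  toFun x := x.1 i
  continuous_toFun := by fun_prop

@[simp] lemma coord_apply (i : ι) (x : Sp ι) : coord i x = x.1 i := rfl

def toC : MvPolynomial ι ℝ →ₐ[ℝ] C(Sp ι, ℝ) := MvPolynomial.aeval coord

lemma toC_apply (P : MvPolynomial ι ℝ) (x : Sp ι) :
    toC P x = MvPolynomial.eval (fun i => x.1 i) P := by
  induction P using MvPolynomial.induction_on with
  | C a => simp [toC]
  | add p q hp hq => simp [hp, hq]
  | mul_X p i hp => simp only [map_mul, ContinuousMap.mul_apply, hp]; simp [toC]

def Pol (ι : Type) [Fintype ι] (n : ℕ) : Submodule ℝ C(Sp ι, ℝ) :=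
  (MvPolynomial.restrictTotalDegree ι ℝ n).map (toC (ι := ι)).toLinearMap

lemma mem_Pol {n : ℕ} {g : C(Sp ι, ℝ)} :
    g ∈ Pol ι n ↔ ∃ P : MvPolynomial ι ℝ, P.totalDegree ≤ n ∧ toC P = g := by
  simp [Pol, MvPolynomial.mem_restrictTotalDegree]

lemma toC_mem {n : ℕ} {P : MvPolynomial ι ℝ} (h : P.totalDegree ≤ n) : toC P ∈ Pol ι n :=
  mem_Pol.2 ⟨P, h, rfl⟩

lemma Pol_mono {n k : ℕ} (h : n ≤ k) : Pol ι n ≤ Pol ι k := by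
  intro g hg
  obtain ⟨P, hP, rfl⟩ := mem_Pol.1 hg
  exact toC_mem (hP.trans h)

lemma Pol_mul {n k : ℕ} {f g : C(Sp ι, ℝ)} (hf : f ∈ Pol ι n) (hg : g ∈ Pol ι k) :
    f * g ∈ Pol ι (n + k) := by
  obtain ⟨P, hP, rfl⟩ := mem_Pol.1 hf
  obtain ⟨Q, hQ, rfl⟩ := mem_Pol.1 hg
  rw [← map_mul]
  exact toC_mem ((MvPolynomial.totalDegree_mul _ _).trans (by omega))

lemma one_mem_Pol (n : ℕ) : (1 : C(Sp ι, ℝ)) ∈ Pol ι n := by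
  rw [← map_one toC]; exact toC_mem (by simp)

lemma coord_mem (i : ι) : coord i ∈ Pol ι 1 := by
  have : coord i = toC (MvPolynomial.X i) := by simp [toC]
  rw [this]; exact toC_mem (by simp)

lemma Pol_pow {n : ℕ} {f : C(Sp ι, ℝ)} (hf : f ∈ Pol ι n) (k : ℕ) : f ^ k ∈ Pol ι (k * n) := by
  induction k with
  | zero => simpa using one_mem_Pol _
  | succ k ih => rw [pow_succ, add_mul, one_mul]; exact Pol_mul ih hf

lemma Pol_prod {α : Type*} (s : Finset α) (f : α → C(Sp ι, ℝ)) (n : α → ℕ)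
    (h : ∀ a ∈ s, f a ∈ Pol ι (n a)) : ∏ a ∈ s, f a ∈ Pol ι (∑ a ∈ s, n a) := by
  classical
  induction s using Finset.induction_on with
  | empty => simpa using one_mem_Pol _
  | insert a s ha ih =>
    rw [Finset.prod_insert ha, Finset.sum_insert ha]
    exact Pol_mul (h a (by simp)) (ih fun b hb => h b (by simp [hb]))

lemma coord_comp_act (h : Eu ι ≃ₗᵢ[ℝ] Eu ι) (i : ι) : (coord i).comp (act h) ∈ Pol ι 1 := by
  classical
  have : (coord i).comp (act h) = ∑ j, (h (EuclideanSpace.single j 1) i) • coord j := by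
    ext x
    simp only [ContinuousMap.comp_apply, coord_apply, act_coe, ContinuousMap.coe_sum,
      Finset.sum_apply, ContinuousMap.smul_apply, smul_eq_mul]
    have hx : x.1 = ∑ j, (x.1 j) • EuclideanSpace.single j (1:ℝ) := by
      ext k; simp [Finset.sum_apply, Pi.single_apply]
    conv_lhs => rw [hx]
    simp [mul_comm]
  rw [this]
  exact Submodule.sum_mem _ fun j _ => Submodule.smul_mem _ _ (coord_mem j)

lemma Pol_comp_act {n : ℕ} {f : C(Sp ι, ℝ)} (hf : f ∈ Pol ι n) (h : Eu ι ≃ₗᵢ[ℝ] Eu ι) :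
    f.comp (act h) ∈ Pol ι n := by
  obtain ⟨P, hP, rfl⟩ := mem_Pol.1 hf
  have key : (toC P).comp (act h) =
      ∑ s ∈ P.support, (P.coeff s) • ∏ i, ((coord i).comp (act h)) ^ (s i) := by
    ext x
    simp [toC_apply, MvPolynomial.eval_eq']
  rw [key]
  refine Submodule.sum_mem _ fun s hs => Submodule.smul_mem _ _ ?_
  have h1 : ∏ i, ((coord i).comp (act h)) ^ (s i) ∈ Pol ι (∑ i, s i * 1) :=
    Pol_prod _ _ _ fun i _ => Pol_pow (coord_comp_act h i) _
  refine Pol_mono ?_ h1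
  refine le_trans ?_ hP
  have := MvPolynomial.le_totalDegree hs
  simpa [Finsupp.sum_fintype] using this

instance (n : ℕ) : FiniteDimensional ℝ (Pol ι n) := by
  have : Module.Finite ℝ (MvPolynomial.restrictTotalDegree ι ℝ n) := by
    infer_instance
  unfold Pol
  infer_instance

/-- inner product of points as polynomial kernel -/
def ip (x : Sp ι) : C(Sp ι, ℝ) := ∑ i, (x.1 i) • coord i

lemma ip_apply (x y : Sp ι) : ip x y = inner ℝ x.1 y.1 := by
  simp [ip, PiLp.inner_apply, mul_comm]

lemma ip_mem (x : Sp ι) : ip x ∈ Pol ι 1 :=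
  Submodule.sum_mem _ fun i _ => Submodule.smul_mem _ _ (coord_mem i)

lemma ip_self (x : Sp ι) : ip x x = 1 := by
  rw [ip_apply, real_inner_self_eq_norm_sq, Sp.norm_eq]; norm_num

lemma ip_le (x y : Sp ι) : ip x y ≤ 1 := by
  rw [ip_apply]
  have := real_inner_le_norm x.1 y.1
  simpa [Sp.norm_eq] using this

lemma le_ip (x y : Sp ι) : -1 ≤ ip x y := by
  rw [ip_apply]
  have := neg_le_of_abs_le (abs_real_inner_le_norm x.1 y.1)
  simpa [Sp.norm_eq] using this

lemma ip_act (h : Eu ι ≃ₗᵢ[ℝ] Eu ι) (x y : Sp ι) : ip (act h x) (act h y) = ip x y := by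
  simp [ip_apply]

lemma dense_poly (f : C(Sp ι, ℝ)) (ε : ℝ) (hε : 0 < ε) :
    ∃ P : MvPolynomial ι ℝ, ∀ x, |f x - toC P x| < ε := by
  have hsep : (toC (ι := ι)).range.SeparatesPoints := by
    intro x y hxy
    by_contra hcon
    push Not at hcon
    apply hxy
    apply Subtype.ext
    ext i
    have := hcon (coord i) ⟨coord i, ⟨MvPolynomial.X i, by simp [toC]⟩, rfl⟩
    simpa using this
  obtain ⟨g, hg⟩ := ContinuousMap.exists_mem_subalgebra_near_continuousMap_of_separatesPoints
    (toC (ι := ι)).range hsep f ε hε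
  obtain ⟨P, hP⟩ := g.2
  refine ⟨P, fun x => ?_⟩
  have h1 : ‖((g : C(Sp ι, ℝ)) - f) x‖ < ε := lt_of_le_of_lt (ContinuousMap.norm_coe_le_norm _ x) hg
  have h2 : toC P = (g : C(Sp ι, ℝ)) := hP
  rw [h2, abs_sub_comm]
  simpa using h1

end P1
end BallApprox
namespace BallApprox
set_option linter.unusedSectionVars false

class RotInv {ι : Type} [Fintype ι] (σ : Measure (Sp ι)) : Prop where
  inv : ∀ h : Eu ι ≃ₗᵢ[ℝ] Eu ι, MeasurePreserving (act h) σ σ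

section P2
variable {ι : Type} [Fintype ι]

lemma integrable_C (σ : Measure (Sp ι)) [IsFiniteMeasure σ] (f : C(Sp ι, ℝ)) :
    Integrable (fun x => f x) σ :=
  f.continuous.integrable_of_hasCompactSupport (HasCompactSupport.of_compactSpace _)

lemma integrable_cont (σ : Measure (Sp ι)) [IsFiniteMeasure σ] {f : Sp ι → ℝ} (hf : Continuous f) :
    Integrable f σ :=
  hf.integrable_of_hasCompactSupport (HasCompactSupport.of_compactSpace _)

def dimP (ι : Type) [Fintype ι] (n : ℕ) : ℕ := Module.finrank ℝ (Pol ι n)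

variable (σ : Measure (Sp ι)) [IsProbabilityMeasure σ] [σ.IsOpenPosMeasure]

lemma exists_onb (n : ℕ) : ∃ P : Fin (dimP ι n) → C(Sp ι, ℝ), (∀ k, P k ∈ Pol ι n) ∧
    (∀ k, ∫ y, P k y * P k y ∂σ = 1) ∧
    ∀ g ∈ Pol ι n, ∀ x, g x = ∑ k, (∫ y, P k y * g y ∂σ) * P k x := by
  set T : C(Sp ι, ℝ) →ₗ[ℝ] Lp ℝ 2 σ := (ContinuousMap.toLp (E := ℝ) 2 σ ℝ).toLinearMap with hT
  have hTinj : Function.Injective T := ContinuousMap.toLp_injective (E := ℝ) (p := 2) (𝕜 := ℝ) σ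
  set W : Submodule ℝ (Lp ℝ 2 σ) := (Pol ι n).map T with hW
  have hinner : ∀ f g : C(Sp ι, ℝ), inner ℝ (T f) (T g) = ∫ y, f y * g y ∂σ := by
    intro f g
    have := ContinuousMap.inner_toLp (𝕜 := ℝ) σ f g
    rw [hT]
    refine this.trans ?_
    simp [mul_comm]
  have hfd : FiniteDimensional ℝ W := by rw [hW]; infer_instance
  have hdim : Module.finrank ℝ W = dimP ι n :=
    ((Submodule.equivMapOfInjective T hTinj (Pol ι n)).finrank_eq).symm
  let b := (stdOrthonormalBasis ℝ W).reindex (finCongr hdim)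
  have hex : ∀ k, ∃ P ∈ Pol ι n, T P = (b k : Lp ℝ 2 σ) := fun k => (b k).2
  choose P hP hTP using hex
  refine ⟨P, hP, fun k => ?_, fun g hg x => ?_⟩
  · rw [← hinner, hTP]
    have := b.orthonormal.1 k
    rw [← Submodule.coe_inner, real_inner_self_eq_norm_sq, this]; norm_num
  · have h1 : (⟨T g, ⟨g, hg, rfl⟩⟩ : W) = ∑ k, inner ℝ (b k) (⟨T g, ⟨g, hg, rfl⟩⟩ : W) • b k :=
      (b.sum_repr' _).symm
    have h2 : T g = T (∑ k, (∫ y, P k y * g y ∂σ) • P k) := by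
      have := congrArg (Subtype.val) h1
      simp only at this
      rw [this]
      simp only [Submodule.coe_sum, Submodule.coe_smul, Submodule.coe_inner, map_sum, map_smul]
      refine Finset.sum_congr rfl fun k _ => ?_
      rw [← hTP, hinner]
    have h3 := congrArg (fun f : C(Sp ι, ℝ) => f x) (hTinj h2)
    simpa using h3

def onb (n : ℕ) : Fin (dimP ι n) → C(Sp ι, ℝ) := (exists_onb σ n).choose

def Z (n : ℕ) (x : Sp ι) : C(Sp ι, ℝ) := ∑ k, (onb σ n k x) • onb σ n k

lemma Z_apply (n : ℕ) (x y : Sp ι) : Z σ n x y = ∑ k, onb σ n k x * onb σ n k y := by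
  simp [Z]

lemma onb_mem (n : ℕ) (k) : onb σ n k ∈ Pol ι n := (exists_onb σ n).choose_spec.1 k

lemma Z_mem (n : ℕ) (x : Sp ι) : Z σ n x ∈ Pol ι n :=
  Submodule.sum_mem _ fun k _ => Submodule.smul_mem _ _ (onb_mem σ n k)

lemma Z_symm (n : ℕ) (x y : Sp ι) : Z σ n x y = Z σ n y x := by
  simp [Z_apply, mul_comm]

lemma Z_cont (n : ℕ) : Continuous fun q : Sp ι × Sp ι => Z σ n q.1 q.2 := by
  simp only [Z_apply]; fun_prop

lemma Z_rep {n : ℕ} {g : C(Sp ι, ℝ)} (hg : g ∈ Pol ι n) (x : Sp ι) :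
    ∫ y, Z σ n x y * g y ∂σ = g x := by
  rw [(exists_onb σ n).choose_spec.2.2 g hg x]
  simp only [Z_apply, Finset.sum_mul]
  rw [integral_finsetSum]
  · refine Finset.sum_congr rfl fun k _ => ?_
    simp only [mul_assoc]
    rw [integral_const_mul, mul_comm]; rfl
  · intro k _
    exact integrable_cont σ (by fun_prop)

lemma int_Z_diag (n : ℕ) : ∫ x, Z σ n x x ∂σ = dimP ι n := by
  simp only [Z_apply]
  rw [integral_finsetSum]
  · have h : ∀ k, ∫ y, onb σ n k y * onb σ n k y ∂σ = 1 := fun k => (exists_onb σ n).choose_spec.2.1 k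
    simp [h]
  · intro k _
    exact integrable_cont σ (by fun_prop)

variable [RotInv σ]

lemma int_act (h : Eu ι ≃ₗᵢ[ℝ] Eu ι) (f : C(Sp ι, ℝ)) :
    ∫ y, f (act h y) ∂σ = ∫ y, f y ∂σ := by
  have hm := RotInv.inv (σ := σ) h
  conv_rhs => rw [← hm.map_eq]
  rw [integral_map (by fun_prop) (f.continuous.aestronglyMeasurable)]

lemma Z_act (n : ℕ) (h : Eu ι ≃ₗᵢ[ℝ] Eu ι) (x y : Sp ι) :
    Z σ n (act h x) (act h y) = Z σ n x y := by
  -- both sides reproduce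
  have key : ∀ g ∈ Pol ι n, ∫ y, Z σ n (act h x) (act h y) * g y ∂σ = g x := by
    intro g hg
    have h1 := Z_rep σ (Pol_comp_act hg h.symm) (act h x)
    have h2 := int_act σ h ((Z σ n (act h x)) * (g.comp (act h.symm)))
    simp only [ContinuousMap.mul_apply] at h2
    rw [h1] at h2
    simpa [act_symm_act] using h2
  have h2 := key _ (Z_mem σ n y)
  have h3 := Z_rep σ (Pol_comp_act (Z_mem σ n (act h x)) h) y
  simp only [ContinuousMap.comp_apply] at h3
  rw [Z_symm σ n x y, ← h2, ← h3]
  refine integral_congr_ae (Filter.Eventually.of_forall fun z => ?_)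
  simp only; ring

lemma Z_diag (n : ℕ) (x : Sp ι) : Z σ n x x = dimP ι n := by
  rw [← int_Z_diag σ n]
  have : ∀ y, Z σ n y y = Z σ n x x := by
    intro y
    obtain ⟨h, rfl⟩ := exists_act x y
    exact Z_act σ n h x x
  simp [this]

lemma Z_sq (n : ℕ) (x : Sp ι) : ∫ y, Z σ n x y * Z σ n x y ∂σ = dimP ι n := by
  rw [Z_rep σ (Z_mem σ n x), Z_diag]

lemma Z_cross {n k : ℕ} (hnk : n ≤ k) (x : Sp ι) :
    ∫ y, Z σ k x y * Z σ n x y ∂σ = dimP ι n := by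
  rw [Z_rep σ (Pol_mono hnk (Z_mem σ n x)), Z_diag]

/-- first moment of the square of the kernel -/
lemma Z_moment (l : ℕ) (x : Sp ι) : ∫ y, (1 - ip x y) * (Z σ (l+1) x y) ^ 2 ∂σ ≤
    2 * ((dimP ι (l+1) : ℝ) - dimP ι l) := by
  set X := ∫ y, (1 - ip x y) * (Z σ (l+1) x y) ^ 2 ∂σ with hX
  have h0 : ∫ y, Z σ (l+1) x y * ((1 - ip x y) * Z σ l x y) ∂σ = 0 := by
    have hm : (1 - ip x) * Z σ l x ∈ Pol ι (l+1) := by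
      rw [add_comm]
      exact Pol_mul (Submodule.sub_mem _ (one_mem_Pol 1) (ip_mem x)) (Z_mem σ l x)
    have := Z_rep σ hm x
    simpa [ip_self] using this
  have h1 : X = ∫ y, (1 - ip x y) * Z σ (l+1) x y * (Z σ (l+1) x y - Z σ l x y) ∂σ := by
    rw [hX, ← sub_zero (∫ y, (1 - ip x y) * (Z σ (l+1) x y) ^ 2 ∂σ), ← h0, ← integral_sub]
    · refine integral_congr_ae (Filter.Eventually.of_forall fun z => ?_)
      simp only; ring
    · exact integrable_cont σ (by fun_prop)
    · exact integrable_cont σ (by fun_prop)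
  have h2 : X ≤ ∫ y, ((1/2) * ((1 - ip x y) * (Z σ (l+1) x y)^2) +
      (Z σ (l+1) x y * Z σ (l+1) x y - 2 * (Z σ (l+1) x y * Z σ l x y) + Z σ l x y * Z σ l x y)) ∂σ := by
    rw [h1]
    refine integral_mono (integrable_cont σ (by fun_prop)) (integrable_cont σ (by fun_prop)) ?_
    intro y
    have a1 := ip_le x y
    have a2 := le_ip x y
    simp only
    set t := ip x y
    set a := Z σ (l+1) x y
    set b := Z σ l x y
    nlinarith [sq_nonneg ((1/2) * (1-t) * a - (a - b)), mul_nonneg (sub_nonneg.2 a1) (sq_nonneg a),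
      mul_nonneg (mul_nonneg (sub_nonneg.2 a1) (by linarith : (0:ℝ) ≤ 1 + t)) (sq_nonneg a)]
  have h3 : ∫ y, ((1/2) * ((1 - ip x y) * (Z σ (l+1) x y)^2) +
      (Z σ (l+1) x y * Z σ (l+1) x y - 2 * (Z σ (l+1) x y * Z σ l x y) + Z σ l x y * Z σ l x y)) ∂σ
      = (1/2) * X + (dimP ι (l+1) - 2 * dimP ι l + dimP ι l) := by
    rw [integral_add, integral_add, integral_sub, integral_const_mul, integral_const_mul, Z_sq, Z_sq,
      Z_cross σ (Nat.le_succ l)]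
    all_goals exact integrable_cont σ (by fun_prop)
  rw [h3] at h2
  linarith

/-- Z_l times (1 - t) is orthogonal to lower degree -/
lemma Z_moment_cross {l k : ℕ} (h : l < k) (x : Sp ι) :
    ∫ y, (1 - ip x y) * (Z σ l x y * Z σ k x y) ∂σ = 0 := by
  have hm : (1 - ip x) * Z σ l x ∈ Pol ι k := by
    refine Pol_mono (by omega : 1 + l ≤ k) ?_
    exact Pol_mul (Submodule.sub_mem _ (one_mem_Pol 1) (ip_mem x)) (Z_mem σ l x)
  have := Z_rep σ hm x
  simp only [ContinuousMap.mul_apply, ContinuousMap.sub_apply, ContinuousMap.one_apply, ip_self,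
    sub_self, zero_mul] at this
  rw [← this]
  refine integral_congr_ae (Filter.Eventually.of_forall fun z => ?_)
  simp only; ring

lemma Z_moment' (l : ℕ) (x : Sp ι) : ∫ y, (1 - ip x y) * (Z σ l x y) ^ 2 ∂σ ≤
    2 * ((dimP ι l : ℝ) - if l = 0 then 0 else (dimP ι (l-1) : ℝ)) := by
  rcases l with _ | l
  · calc _ ≤ ∫ y, 2 * (Z σ 0 x y * Z σ 0 x y) ∂σ := by
          refine integral_mono (integrable_cont σ (by fun_prop)) (integrable_cont σ (by fun_prop)) ?_
          intro y
          have a2 := le_ip x y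
          simp only
          nlinarith [sq_nonneg (Z σ 0 x y)]
      _ = _ := by rw [integral_const_mul, Z_sq]; simp
  · simpa using Z_moment σ l x

/-- averaged kernel -/
def Qk (L : ℕ) (x : Sp ι) : C(Sp ι, ℝ) := ∑ l ∈ Finset.range (L+1), Z σ (L + l) x

lemma Qk_apply (L : ℕ) (x y : Sp ι) : Qk σ L x y = ∑ l ∈ Finset.range (L+1), Z σ (L + l) x y := by
  simp [Qk]

lemma Qk_mem (L : ℕ) (x : Sp ι) : Qk σ L x ∈ Pol ι (2 * L) :=
  Submodule.sum_mem _ fun l hl => Pol_mono (by simp at hl; omega) (Z_mem σ (L+l) x)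

lemma Qk_symm (L : ℕ) (x y : Sp ι) : Qk σ L x y = Qk σ L y x := by
  simp only [Qk_apply]; exact Finset.sum_congr rfl fun l _ => Z_symm σ _ x y

lemma Qk_cont (L : ℕ) : Continuous fun q : Sp ι × Sp ι => Qk σ L q.1 q.2 := by
  simp only [Qk_apply]; exact continuous_finsetSum _ fun l _ => Z_cont σ _

lemma Qk_act (L : ℕ) (h : Eu ι ≃ₗᵢ[ℝ] Eu ι) (x y : Sp ι) :
    Qk σ L (act h x) (act h y) = Qk σ L x y := by
  simp only [Qk_apply, Z_act]

lemma dimP_mono {n k : ℕ} (h : n ≤ k) : dimP ι n ≤ dimP ι k :=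
  Submodule.finrank_mono (Pol_mono h)

lemma Qk_diag (L : ℕ) (x : Sp ι) : ((L:ℝ) + 1) * dimP ι L ≤ Qk σ L x x := by
  simp only [Qk_apply, Z_diag]
  have : ((L:ℝ) + 1) * dimP ι L = ∑ l ∈ Finset.range (L+1), (dimP ι L : ℝ) := by simp
  rw [this]
  refine Finset.sum_le_sum fun l _ => ?_
  exact_mod_cast dimP_mono (by omega)

lemma Qk_diag_const (L : ℕ) (x y : Sp ι) : Qk σ L x x = Qk σ L y y := by
  simp only [Qk_apply, Z_diag]

lemma Qk_sq (L : ℕ) (x : Sp ι) :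
    ∫ y, (Qk σ L x y)^2 ∂σ ≤ ((L:ℝ)+1)^2 * dimP ι (2*L) := by
  calc ∫ y, (Qk σ L x y)^2 ∂σ ≤ ∫ y, ∑ l ∈ Finset.range (L+1), ((L:ℝ)+1) * (Z σ (L+l) x y * Z σ (L+l) x y) ∂σ := by
        refine integral_mono (integrable_cont σ (by fun_prop)) (integrable_cont σ (by fun_prop)) ?_
        intro y
        simp only [Qk_apply]
        have := sq_sum_le_card_mul_sum_sq (s := Finset.range (L+1)) (f := fun l => Z σ (L+l) x y)
        rw [← Finset.mul_sum]
        simpa [sq] using this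
    _ = ∑ l ∈ Finset.range (L+1), ((L:ℝ)+1) * dimP ι (L+l) := by
        rw [integral_finsetSum]
        · refine Finset.sum_congr rfl fun l _ => ?_
          rw [integral_const_mul, Z_sq]
        · intro l _; exact integrable_cont σ (by fun_prop)
    _ ≤ ∑ l ∈ Finset.range (L+1), ((L:ℝ)+1) * dimP ι (2*L) := by
        refine Finset.sum_le_sum fun l hl => ?_
        have : dimP ι (L+l) ≤ dimP ι (2*L) := dimP_mono (by simp at hl; omega)
        gcongr
    _ = _ := by simp; ring

lemma Qk_moment (L : ℕ) (x : Sp ι) :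
    ∫ y, (1 - ip x y) * (Qk σ L x y)^2 ∂σ ≤ (2:ℝ) * (dimP ι (2*L) : ℝ) := by
  have h1 : ∀ y, (1 - ip x y) * (Qk σ L x y)^2 =
      ∑ l ∈ Finset.range (L+1), ∑ k ∈ Finset.range (L+1), (1 - ip x y) * (Z σ (L+l) x y * Z σ (L+k) x y) := by
    intro y
    rw [sq, Qk_apply, Finset.sum_mul_sum, Finset.mul_sum]
    simp only [Finset.mul_sum]
  have h2 : ∀ l k, l ≠ k → ∫ y, (1 - ip x y) * (Z σ (L+l) x y * Z σ (L+k) x y) ∂σ = 0 := by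
    intro l k hlk
    rcases lt_or_gt_of_ne hlk with h | h
    · exact Z_moment_cross σ (by omega) x
    · rw [← Z_moment_cross σ (by omega : L + k < L + l) x]
      refine integral_congr_ae (Filter.Eventually.of_forall fun z => ?_)
      simp only; ring
  simp only [h1]
  rw [integral_finsetSum]
  swap
  · intro l _; exact integrable_cont σ (by fun_prop)
  have h3 : ∀ l ∈ Finset.range (L+1), ∫ y, ∑ k ∈ Finset.range (L+1), (1 - ip x y) * (Z σ (L+l) x y * Z σ (L+k) x y) ∂σ
      ≤ 2 * ((dimP ι (L+l) : ℝ) - if L + l = 0 then 0 else (dimP ι (L+l-1) : ℝ)) := by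
    intro l hl
    rw [integral_finsetSum]
    swap
    · intro l _; exact integrable_cont σ (by fun_prop)
    rw [Finset.sum_eq_single_of_mem l hl (fun k _ hk => h2 l k hk.symm)]
    simpa [sq] using Z_moment' σ (L+l) x
  refine (Finset.sum_le_sum h3).trans ?_
  rw [← Finset.mul_sum]
  have h4 : ∀ M : ℕ, ∑ l ∈ Finset.range (M+1), ((dimP ι (L+l) : ℝ) - if L + l = 0 then 0 else (dimP ι (L+l-1) : ℝ))
      ≤ dimP ι (L+M) := by
    intro M
    induction M with
    | zero => simp; split_ifs <;> simp
    | succ M ih =>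
      rw [Finset.sum_range_succ]
      have : L + (M+1) - 1 = L + M := by omega
      rw [this, if_neg (by omega : ¬ (L + (M+1) = 0))]
      linarith
  have := h4 L
  rw [two_mul L]
  linarith

end P2
end BallApprox
namespace BallApprox
set_option linter.unusedSectionVars false
section P3a
variable {ι : Type} [Fintype ι] [DecidableEq ι]

def mon (α : ι → ℕ) : C(Sp ι, ℝ) := ∏ i, coord i ^ α i

lemma coord_sq_sum : ∑ i : ι, (coord i)^2 = (1 : C(Sp ι, ℝ)) := by
  ext x
  have := Sp.norm_eq x
  have h2 : ‖x.1‖^2 = 1 := by rw [this]; norm_num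
  rw [EuclideanSpace.norm_sq_eq] at h2
  simpa using h2

lemma mon_add (α β : ι → ℕ) : mon (α + β) = mon α * mon β := by
  simp [mon, pow_add, Finset.prod_mul_distrib]

lemma mon_single (i : ι) (k : ℕ) : mon (Pi.single i k) = coord i ^ k := by
  rw [mon, Finset.prod_eq_single i]
  · simp
  · intro b _ hb; simp [hb]
  · simp

def redFam (a : ι) (n : ℕ) (q : Fin 2 × ({i // i ≠ a} → Fin (n+1))) : C(Sp ι, ℝ) :=
  mon (fun i => if h : i = a then (q.1 : ℕ) else (q.2 ⟨i, h⟩ : ℕ))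

lemma mon_mem_span (a : ι) (n : ℕ) : ∀ k : ℕ, ∀ α : ι → ℕ, α a = k → ∑ i, α i ≤ n →
    mon α ∈ Submodule.span ℝ (Set.range (redFam a n)) := by
  intro k
  induction k using Nat.strong_induction_on with
  | _ k ih =>
    intro α hα hs
    by_cases hk : k < 2
    · refine Submodule.subset_span ⟨(⟨α a, by omega⟩, fun i => ⟨α i.1, ?_⟩), ?_⟩
      · have := Finset.single_le_sum (f := α) (fun i _ => Nat.zero_le _) (Finset.mem_univ i.1)
        omega
      · simp only [redFam]
        congr 1
        funext i
        split_ifs with h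
        · rw [h]
        · rfl
    · push Not at hk
      obtain ⟨γ, hγ⟩ : ∃ γ : ι → ℕ, α = γ + Pi.single a 2 := by
        refine ⟨fun i => α i - (Pi.single a 2 : ι → ℕ) i, ?_⟩
        funext i
        by_cases h : i = a
        · subst h; simp; omega
        · simp [h]
      have hsum : ∑ i, γ i + 2 ≤ n := by
        rw [hγ] at hs
        simpa [Finset.sum_add_distrib] using hs
      have e : mon α = mon γ - ∑ i ∈ Finset.univ.erase a, mon (γ + Pi.single i 2) := by
        have h1 : (coord a)^2 = (1 : C(Sp ι, ℝ)) - ∑ i ∈ Finset.univ.erase a, (coord i)^2 := by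
          rw [← coord_sq_sum, ← Finset.add_sum_erase _ _ (Finset.mem_univ a)]; ring
        rw [hγ, mon_add, mon_single, h1, mul_sub, mul_one, Finset.mul_sum]
        simp only [mon_add, mon_single]
      rw [e]
      have hγa : γ a + 2 = k := by rw [← hα, hγ]; simp
      refine Submodule.sub_mem _ (ih (γ a) (by omega) γ rfl (by omega)) ?_
      refine Submodule.sum_mem _ fun i hi => ih (γ a) (by omega) _ ?_ ?_
      · have : a ≠ i := fun h => by simp [h] at hi
        simp [this]
      · simpa [Finset.sum_add_distrib] using hsum

lemma dimP_le (a : ι) (n : ℕ) : dimP ι n ≤ 2 * (n+1)^(Fintype.card {i // i ≠ a}) := by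
  have h1 : Pol ι n ≤ Submodule.span ℝ (Set.range (redFam a n)) := by
    intro g hg
    obtain ⟨P, hP, rfl⟩ := mem_Pol.1 hg
    have key : toC P = ∑ s ∈ P.support, (P.coeff s) • mon (s : ι → ℕ) := by
      ext x
      simp [toC_apply, MvPolynomial.eval_eq', mon]
    rw [key]
    refine Submodule.sum_mem _ fun s hs => Submodule.smul_mem _ _ (mon_mem_span a n _ _ rfl ?_)
    have := MvPolynomial.le_totalDegree hs
    rw [Finsupp.sum_fintype _ _ (by simp)] at this
    exact this.trans hP
  have : FiniteDimensional ℝ (Submodule.span ℝ (Set.range (redFam (ι := ι) a n))) :=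
    FiniteDimensional.span_of_finite ℝ (Set.finite_range _)
  calc dimP ι n ≤ Module.finrank ℝ (Submodule.span ℝ (Set.range (redFam (ι := ι) a n))) :=
        Submodule.finrank_mono h1
    _ ≤ Fintype.card (Fin 2 × ({i // i ≠ a} → Fin (n+1))) := finrank_range_le_card _
    _ = _ := by simp

lemma exists_sphere_lift (a : ι) (w : {i // i ≠ a} → ℝ) (hw : ∑ i, w i ^ 2 ≤ 1) :
    ∃ x : Sp ι, ∀ i : {i // i ≠ a}, x.1 i = w i := by
  let v : ι → ℝ := fun i => if h : i = a then Real.sqrt (1 - ∑ i, w i ^ 2) else w ⟨i, h⟩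
  refine ⟨⟨WithLp.toLp 2 v, ?_⟩, ?_⟩
  · rw [mem_sphere_zero_iff_norm]
    have : ‖(WithLp.toLp 2 v : Eu ι)‖ ^ 2 = 1 := by
      rw [EuclideanSpace.norm_sq_eq]
      rw [← Finset.add_sum_erase _ _ (Finset.mem_univ a)]
      have h2 : ∑ i ∈ Finset.univ.erase a, ‖v i‖^2 = ∑ i : {i // i ≠ a}, w i ^ 2 := by
        rw [Finset.sum_subtype (p := fun i => i ≠ a) (Finset.univ.erase a) (by simp) (fun i => ‖v i‖^2)]
        refine Finset.sum_congr rfl fun i _ => ?_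
        simp [v, i.2]
      simp only [h2]
      simp only [v, dif_pos, Real.norm_eq_abs, sq_abs]
      rw [Real.sq_sqrt (by linarith)]; ring
    nlinarith [norm_nonneg (WithLp.toLp 2 v : Eu ι)]
  · intro i; simp [v, i.2]

lemma rename_inj (a : ι) : Function.Injective
    ((toC (ι := ι)).comp (MvPolynomial.rename (Subtype.val : {i // i ≠ a} → ι))) := by
  rw [injective_iff_map_eq_zero]
  intro P hP
  set k : ℕ := Fintype.card {i // i ≠ a}
  refine MvPolynomial.funext_set (fun _ => Set.Icc (0:ℝ) (1/(k+1))) (fun _ => Set.Icc_infinite (by positivity)) ?_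
  intro w hw
  obtain ⟨x, hx⟩ := exists_sphere_lift a w (by
    have : ∀ i ∈ Finset.univ, w i ^ 2 ≤ 1/((k:ℝ)+1) := by
      intro i _
      have h1 := hw i (Set.mem_univ i)
      simp only [Set.mem_Icc] at h1
      have h2 : 1/((k:ℝ)+1) ≤ 1 := by rw [div_le_one (by positivity)]; linarith [(Nat.cast_nonneg k : (0:ℝ) ≤ k)]
      nlinarith
    refine (Finset.sum_le_sum this).trans ?_
    simp only [Finset.sum_const, Finset.card_univ, nsmul_eq_mul]
    rw [mul_one_div, div_le_one (by positivity)]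
    change (k:ℝ) ≤ k + 1
    linarith)
  have h := congrArg (fun f : C(Sp ι, ℝ) => f x) hP
  simp only [AlgHom.comp_apply, toC_apply, ContinuousMap.zero_apply, MvPolynomial.eval_rename] at h
  have e : (fun i => x.1 i) ∘ (Subtype.val : {i // i ≠ a} → ι) = w := by
    funext i; exact hx i
  rw [e] at h
  simpa using h

lemma le_dimP (a : ι) (q L : ℕ) (hq : Fintype.card {i // i ≠ a} * q ≤ L) :
    (q+1)^(Fintype.card {i // i ≠ a}) ≤ dimP ι L := by
  set J := {i // i ≠ a}
  let e : (J → Fin (q+1)) → (J →₀ ℕ) := fun α => Finsupp.equivFunOnFinite.symm (fun j => (α j : ℕ))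
  have he : Function.Injective e := by
    intro α β h
    have := Finsupp.equivFunOnFinite.symm.injective h
    funext j
    exact Fin.ext (congrFun this j)
  have h1 : LinearIndependent ℝ (fun α => MvPolynomial.monomial (e α) (1:ℝ)) := by
    have := (MvPolynomial.basisMonomials J ℝ).linearIndependent.comp e he
    simpa [Function.comp_def] using this
  let T : MvPolynomial J ℝ →ₗ[ℝ] C(Sp ι, ℝ) :=
    ((toC (ι := ι)).comp (MvPolynomial.rename (Subtype.val : J → ι))).toLinearMap
  have h2 : LinearIndependent ℝ (fun α => T (MvPolynomial.monomial (e α) (1:ℝ))) :=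
    h1.map' T (LinearMap.ker_eq_bot.2 (rename_inj a))
  have hmem : ∀ α, T (MvPolynomial.monomial (e α) (1:ℝ)) ∈ Pol ι L := by
    intro α
    refine toC_mem ((MvPolynomial.totalDegree_rename_le _ _).trans ?_)
    refine (MvPolynomial.totalDegree_monomial_le _ _).trans ?_
    rw [Finsupp.sum_fintype _ _ (by simp)]
    refine le_trans (Finset.sum_le_card_nsmul _ _ q fun i _ => ?_) (by simpa using hq)
    simp only [e, Finsupp.equivFunOnFinite_symm_apply_apply]
    exact Nat.lt_succ_iff.1 (α i).2
  have h3 : LinearIndependent ℝ (fun α => (⟨T (MvPolynomial.monomial (e α) (1:ℝ)), hmem α⟩ : Pol ι L)) := by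
    apply LinearIndependent.of_comp (Pol ι L).subtype
    exact h2
  have := h3.fintype_card_le_finrank
  rw [Fintype.card_fun, Fintype.card_fin] at this
  exact this

lemma dim_doubling [Nontrivial ι] : ∃ C : ℝ, 1 ≤ C ∧ ∀ L : ℕ,
    (dimP ι (6 * (L+1)) : ℝ) ≤ C * dimP ι L := by
  obtain ⟨a, b, hab⟩ := exists_pair_ne ι
  set k := Fintype.card {i // i ≠ a}
  have hk : 1 ≤ k := Fintype.card_pos_iff.2 ⟨⟨b, hab.symm⟩⟩
  refine ⟨2 * 7^k * k^k, ?_, fun L => ?_⟩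
  · have : (1:ℝ) ≤ 7^k := one_le_pow₀ (by norm_num)
    have : (1:ℝ) ≤ (k:ℝ)^k := one_le_pow₀ (by exact_mod_cast hk)
    nlinarith
  · have h1 := dimP_le a (6*(L+1))
    have h2 := le_dimP a (L/k) L (Nat.mul_div_le L k)
    have h3 : L + 1 ≤ k * (L/k + 1) := by
      have := Nat.lt_mul_div_succ L (by omega : 0 < k)
      exact this
    have h4 : dimP ι (6*(L+1)) ≤ 2 * 7^k * k^k * dimP ι L := by
      calc _ ≤ 2 * (6*(L+1)+1)^k := h1
        _ ≤ 2 * (7 * (k * (L/k+1)))^k := by gcongr; omega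
        _ = 2 * 7^k * k^k * (L/k+1)^k := by rw [mul_pow, mul_pow]; ring
        _ ≤ _ := by gcongr
    exact_mod_cast h4

end P3a
end BallApprox
namespace BallApprox
set_option linter.unusedSectionVars false
section P3b
variable {ι : Type} [Fintype ι]
variable (σ : Measure (Sp ι)) [IsProbabilityMeasure σ] [σ.IsOpenPosMeasure] [RotInv σ]

lemma int_act_of {τ : Measure (Sp ι)} (h : Eu ι ≃ₗᵢ[ℝ] Eu ι) (hτ : τ.map (act h) = τ) (f : C(Sp ι, ℝ)) :
    ∫ y, f (act h y) ∂τ = ∫ y, f y ∂τ := by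
  conv_rhs => rw [← hτ]
  rw [integral_map (by fun_prop) (f.continuous.aestronglyMeasurable)]

lemma uniq_poly [Nonempty (Sp ι)] (τ : Measure (Sp ι)) [IsFiniteMeasure τ] (hτ : ∀ h : Eu ι ≃ₗᵢ[ℝ] Eu ι, τ.map (act h) = τ)
    {n : ℕ} {g : C(Sp ι, ℝ)} (hg : g ∈ Pol ι n) :
    ∫ x, g x ∂τ = τ.real Set.univ * ∫ x, g x ∂σ := by
  obtain ⟨z0⟩ := ‹Nonempty (Sp ι)›
  set c : ℝ := ∫ w, Z σ n z0 w ∂τ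
  have hc : ∀ z, ∫ w, Z σ n z w ∂τ = c := by
    intro z
    obtain ⟨h, rfl⟩ := exists_act z0 z
    rw [← int_act_of h (hτ h)]
    simp only [Z_act]; rfl
  have key : ∀ g ∈ Pol ι n, ∫ x, g x ∂τ = c * ∫ x, g x ∂σ := by
    intro g hg
    have e1 : ∀ x, g x = ∑ k, (∫ y, onb σ n k y * g y ∂σ) * onb σ n k x :=
      (exists_onb σ n).choose_spec.2.2 g hg
    have e2 : ∫ x, g x ∂τ = ∑ k, (∫ y, onb σ n k y * g y ∂σ) * ∫ x, onb σ n k x ∂τ := by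
      rw [integral_congr_ae (Filter.Eventually.of_forall e1), integral_finsetSum]
      · simp only [integral_const_mul]
      · intro k _; exact integrable_cont τ (by fun_prop)
    have e3 : ∀ y, ∑ k, onb σ n k y * ∫ x, onb σ n k x ∂τ = c := by
      intro y
      rw [← hc y]
      simp only [Z_apply]
      rw [integral_finsetSum]
      · simp only [integral_const_mul]
      · intro k _; exact integrable_cont τ (by fun_prop)
    have e4 : ∫ y, c * g y ∂σ = ∑ k, (∫ y, onb σ n k y * g y ∂σ) * ∫ x, onb σ n k x ∂τ := by
      simp only [← integral_mul_const]
      rw [← integral_finsetSum]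
      · refine integral_congr_ae (Filter.Eventually.of_forall fun y => ?_)
        simp only
        rw [← e3 y, Finset.sum_mul]
        refine Finset.sum_congr rfl fun k _ => by ring
      · intro k _; exact integrable_cont σ (by fun_prop)
    rw [e2, ← e4, integral_const_mul]
  have h1 := key 1 (one_mem_Pol n)
  simp at h1
  rw [key g hg, ← h1]

lemma uniq_cont [Nonempty (Sp ι)] (τ : Measure (Sp ι)) [IsFiniteMeasure τ] (hτ : ∀ h : Eu ι ≃ₗᵢ[ℝ] Eu ι, τ.map (act h) = τ)
    (f : C(Sp ι, ℝ)) :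
    ∫ x, f x ∂τ = τ.real Set.univ * ∫ x, f x ∂σ := by
  set T := τ.real Set.univ
  have hT : 0 ≤ T := measureReal_nonneg
  have bd : ∀ ε > 0, |∫ x, f x ∂τ - T * ∫ x, f x ∂σ| ≤ ε * T + T * ε := by
    intro ε hε
    obtain ⟨P, hP⟩ := dense_poly f ε hε
    have h1 := uniq_poly σ τ hτ (toC_mem (le_refl P.totalDegree))
    have h2 : |∫ x, f x ∂τ - ∫ x, toC P x ∂τ| ≤ ε * T := by
      rw [← integral_sub (integrable_C τ f) (integrable_C τ _), ← Real.norm_eq_abs]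
      refine norm_integral_le_of_norm_le_const (Filter.Eventually.of_forall fun x => ?_)
      exact (hP x).le
    have h3 : |∫ x, f x ∂σ - ∫ x, toC P x ∂σ| ≤ ε := by
      rw [← integral_sub (integrable_C σ f) (integrable_C σ _), ← Real.norm_eq_abs]
      refine (norm_integral_le_of_norm_le_const (C := ε) (Filter.Eventually.of_forall fun x => ?_)).trans ?_
      · exact (hP x).le
      · simp
    have e : ∫ x, f x ∂τ - T * ∫ x, f x ∂σ = (∫ x, f x ∂τ - ∫ x, toC P x ∂τ) -
      T * (∫ x, f x ∂σ - ∫ x, toC P x ∂σ) := by rw [h1]; ring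
    rw [e]
    refine (abs_sub _ _).trans (add_le_add h2 ?_)
    rw [abs_mul, abs_of_nonneg hT]
    exact mul_le_mul_of_nonneg_left h3 hT
  by_contra hne
  have hpos : 0 < |∫ x, f x ∂τ - T * ∫ x, f x ∂σ| := abs_pos.2 (sub_ne_zero.2 hne)
  set D := |∫ x, f x ∂τ - T * ∫ x, f x ∂σ|
  have := bd (D / (2 * T + 1) / 2) (by positivity)
  have h4 : D / (2 * T + 1) / 2 * T + T * (D / (2 * T + 1) / 2) = D * (T / (2*T+1)) := by ring
  rw [h4] at this
  have h5 : T / (2*T+1) < 1 := by rw [div_lt_one (by positivity)]; linarith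
  nlinarith

lemma uniq_meas [Nonempty (Sp ι)] (τ : Measure (Sp ι)) [IsFiniteMeasure τ] (hτ : ∀ h : Eu ι ≃ₗᵢ[ℝ] Eu ι, τ.map (act h) = τ) :
    τ = (τ Set.univ) • σ := by
  have : IsFiniteMeasure ((τ Set.univ) • σ) := by
    constructor
    simp [lt_top_iff_ne_top]
  apply ext_of_forall_integral_eq_of_IsFiniteMeasure
  intro f
  have := uniq_cont σ τ hτ f.toContinuousMap
  rw [integral_smul_measure]
  exact this

variable {Y : Type*} [MeasurableSpace Y]

/-- generalized Schur test -/
lemma schur (ν : Measure Y) [SFinite ν] (w : Sp ι × Y → ℝ≥0∞) (hw : Measurable w)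
    (γ : Sp ι × Y → Sp ι) (hγ : Measurable γ) (C : ℝ≥0∞)
    (h1 : ∀ x, ∫⁻ y, w (x,y) ∂ν ≤ C)
    (h2 : ∀ H : Sp ι → ℝ≥0∞, Measurable H →
      ∫⁻ x, ∫⁻ y, w (x,y) * H (γ (x,y)) ∂ν ∂σ ≤ C * ∫⁻ x, H x ∂σ)
    (p : ℝ≥0∞) (hp : 1 ≤ p) (H : Sp ι → ℝ≥0∞) (hH : Measurable H) :
    eLpNorm (fun x => ∫⁻ y, w (x,y) * H (γ (x,y)) ∂ν) p σ ≤ C * eLpNorm H p σ := by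
  by_cases hpt : p = ∞
  · subst hpt
    rw [eLpNorm_exponent_top, eLpNorm_exponent_top]
    set B := eLpNormEssSup H σ with hB
    have hae : ∀ᵐ x ∂σ, H x ≤ B := by
      have := enorm_ae_le_eLpNormEssSup H σ
      simpa using this
    let A : Set (Sp ι) := {x | B < H x}
    have hA : MeasurableSet A := measurableSet_lt measurable_const hH
    have hA0 : σ A = 0 := by
      have : ∀ᵐ x ∂σ, x ∉ A := by filter_upwards [hae] with x hx; simpa [A] using hx
      simpa [ae_iff] using this
    have h3 := h2 (A.indicator 1) (measurable_one.indicator hA)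
    rw [lintegral_indicator_one hA, hA0, mul_zero, nonpos_iff_eq_zero] at h3
    have hmeas : Measurable fun q : Sp ι × Y => w q * (A.indicator 1 : Sp ι → ℝ≥0∞) (γ q) :=
      hw.mul ((measurable_one.indicator hA).comp hγ)
    rw [lintegral_eq_zero_iff hmeas.lintegral_prod_right'] at h3
    refine essSup_le_of_ae_le _ ?_
    filter_upwards [h3] with x hx
    simp only [Pi.zero_apply] at hx
    have hm2 : Measurable fun y => w (x,y) * (A.indicator 1 : Sp ι → ℝ≥0∞) (γ (x,y)) :=
      hmeas.comp measurable_prodMk_left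
    rw [lintegral_eq_zero_iff hm2] at hx
    simp only [enorm_eq_self]
    calc ∫⁻ y, w (x,y) * H (γ (x,y)) ∂ν ≤ ∫⁻ y, w (x,y) * B ∂ν := by
          refine lintegral_mono_ae ?_
          filter_upwards [hx] with y hy
          simp only [Pi.zero_apply, mul_eq_zero] at hy
          rcases hy with hy | hy
          · simp [hy]
          · gcongr
            by_contra hcon
            push Not at hcon
            have : γ (x,y) ∈ A := hcon
            simp [this] at hy
      _ = (∫⁻ y, w (x,y) ∂ν) * B := by
          rw [lintegral_mul_const _ (by fun_prop)]
      _ ≤ C * B := by gcongr; exact h1 x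
  · have hp0 : p ≠ 0 := (zero_lt_one.trans_le hp).ne'
    set r := p.toReal with hr
    have hr1 : 1 ≤ r := by
      rw [hr, ← ENNReal.toReal_one]; exact ENNReal.toReal_mono hpt hp
    have hr0 : 0 < r := by linarith
    have step : ∀ x, (∫⁻ y, w (x,y) * H (γ (x,y)) ∂ν) ^ r ≤
        C ^ (r - 1) * ∫⁻ y, w (x,y) * (H (γ (x,y)))^r ∂ν := by
      intro x
      have hwx : Measurable fun y => w (x,y) := hw.comp measurable_prodMk_left
      have hHx : Measurable fun y => H (γ (x,y)) := hH.comp (hγ.comp measurable_prodMk_left)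
      have e1 : ∫⁻ y, w (x,y) * H (γ (x,y)) ∂ν = eLpNorm (fun y => H (γ (x,y))) 1 (ν.withDensity fun y => w (x,y)) := by
        rw [eLpNorm_one_eq_lintegral_enorm, lintegral_withDensity_eq_lintegral_mul _ hwx (by fun_prop)]
        rfl
      have e2 := eLpNorm_le_eLpNorm_mul_rpow_measure_univ (μ := ν.withDensity fun y => w (x,y)) hp
        (hHx.aestronglyMeasurable)
      rw [← e1, eLpNorm_eq_lintegral_rpow_enorm_toReal hp0 hpt,
        lintegral_withDensity_eq_lintegral_mul _ hwx (by fun_prop),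
        withDensity_apply _ MeasurableSet.univ, Measure.restrict_univ] at e2
      simp only [enorm_eq_self, Pi.mul_apply, ENNReal.toReal_one] at e2
      rw [← hr] at e2
      refine (ENNReal.rpow_le_rpow e2 hr0.le).trans ?_
      rw [ENNReal.mul_rpow_of_nonneg _ _ hr0.le, ← ENNReal.rpow_mul, ← ENNReal.rpow_mul, mul_comm]
      have a1 : 1 / r * r = 1 := by field_simp
      have a2 : (1/1 - 1 / r) * r = r - 1 := by field_simp
      rw [a1, a2, ENNReal.rpow_one]
      gcongr
      exact h1 x
    rw [eLpNorm_eq_lintegral_rpow_enorm_toReal hp0 hpt, eLpNorm_eq_lintegral_rpow_enorm_toReal hp0 hpt]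
    simp only [enorm_eq_self]
    rw [← hr]
    have hfin : ∫⁻ x, (∫⁻ y, w (x,y) * H (γ (x,y)) ∂ν) ^ r ∂σ ≤ C ^ r * ∫⁻ x, (H x)^r ∂σ := by
      calc _ ≤ ∫⁻ x, C ^ (r - 1) * ∫⁻ y, w (x,y) * (H (γ (x,y)))^r ∂ν ∂σ := lintegral_mono step
        _ = C ^ (r - 1) * ∫⁻ x, ∫⁻ y, w (x,y) * (H (γ (x,y)))^r ∂ν ∂σ := by
            rw [lintegral_const_mul]
            exact (hw.mul ((hH.comp hγ).pow_const r)).lintegral_prod_right'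
        _ ≤ C ^ (r - 1) * (C * ∫⁻ x, (H x)^r ∂σ) := by
            gcongr
            exact h2 _ (hH.pow_const r)
        _ = _ := by
            rw [← mul_assoc]
            congr 1
            conv_lhs => rw [← ENNReal.rpow_one C, ← ENNReal.rpow_mul, mul_comm 1 (r-1), mul_one]
            rw [← ENNReal.rpow_add_of_nonneg _ _ (by linarith) zero_le_one]
            congr 1; ring
    refine (ENNReal.rpow_le_rpow hfin (by positivity)).trans ?_
    rw [ENNReal.mul_rpow_of_nonneg _ _ (by positivity), ← ENNReal.rpow_mul]
    have a1 : r * (1 / r) = 1 := by field_simp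
    rw [a1, ENNReal.rpow_one]

lemma schur_inv [Nonempty (Sp ι)] {T : Type*} [MeasurableSpace T] (κ : Measure T) [IsProbabilityMeasure κ]
    (w : Sp ι × (Sp ι × T) → ℝ≥0∞) (hw : Measurable w)
    (γ : Sp ι × (Sp ι × T) → Sp ι) (hγ : Measurable γ) (C : ℝ≥0∞) (hC : C ≠ ∞)
    (h1 : ∀ x, ∫⁻ y, w (x,y) ∂(σ.prod κ) ≤ C)
    (hwi : ∀ (h : Eu ι ≃ₗᵢ[ℝ] Eu ι) x y s, w (act h x, (act h y, s)) = w (x, (y, s)))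
    (hγi : ∀ (h : Eu ι ≃ₗᵢ[ℝ] Eu ι) x y s, γ (act h x, (act h y, s)) = act h (γ (x, (y, s))))
    (H : Sp ι → ℝ≥0∞) (hH : Measurable H) :
      ∫⁻ x, ∫⁻ y, w (x,y) * H (γ (x,y)) ∂(σ.prod κ) ∂σ ≤ C * ∫⁻ x, H x ∂σ := by
  set PP := σ.prod (σ.prod κ) with hPP
  set τ := (PP.withDensity w).map γ with hτ
  have htot : τ Set.univ ≤ C := by
    rw [hτ, Measure.map_apply hγ MeasurableSet.univ, Set.preimage_univ,
      withDensity_apply _ MeasurableSet.univ, Measure.restrict_univ, hPP, lintegral_prod _ hw.aemeasurable]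
    calc _ ≤ ∫⁻ x, C ∂σ := lintegral_mono h1
      _ = C := by simp
  have : IsFiniteMeasure τ := ⟨htot.trans_lt (lt_top_iff_ne_top.2 hC)⟩
  have hl : ∀ H : Sp ι → ℝ≥0∞, Measurable H → ∫⁻ x, H x ∂τ = ∫⁻ q, w q * H (γ q) ∂PP := by
    intro H hH
    rw [hτ, lintegral_map hH hγ, lintegral_withDensity_eq_lintegral_mul _ hw (by fun_prop)]
    rfl
  have hinv : ∀ h : Eu ι ≃ₗᵢ[ℝ] Eu ι, τ.map (act h) = τ := by
    intro h
    have hm : Measurable (act h : Sp ι → Sp ι) := (act h).continuous.measurable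
    have mp := (RotInv.inv (σ := σ) h).prod ((RotInv.inv (σ := σ) h).prod (MeasurePreserving.id κ))
    ext A hA
    rw [Measure.map_apply hm hA, ← lintegral_indicator_one (hm hA), ← lintegral_indicator_one hA,
      hl _ (measurable_one.indicator (hm hA)), hl _ (measurable_one.indicator hA)]
    refine Eq.trans ?_ (mp.lintegral_comp (hw.mul ((measurable_one.indicator hA).comp hγ)))
    refine lintegral_congr fun q => ?_
    obtain ⟨x, y, s⟩ := q
    simp only [Prod.map, id, Pi.mul_apply, Function.comp_apply, hwi, hγi]
    rfl
  have hu := uniq_meas σ τ hinv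
  calc _ = ∫⁻ q, w q * H (γ q) ∂PP := by
        exact (lintegral_prod _ (hw.mul (hH.comp hγ)).aemeasurable).symm
    _ = ∫⁻ x, H x ∂τ := (hl H hH).symm
    _ = τ Set.univ * ∫⁻ x, H x ∂σ := by conv_lhs => rw [hu]
                                        rw [lintegral_smul_measure, smul_eq_mul]
    _ ≤ _ := by gcongr

end P3b
end BallApprox
namespace BallApprox
set_option linter.unusedSectionVars false
section P3c
variable {ι : Type} [Fintype ι]
variable (σ : Measure (Sp ι)) [IsProbabilityMeasure σ] [σ.IsOpenPosMeasure] [RotInv σ]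

lemma ip_symm (x y : Sp ι) : ip x y = ip y x := by
  rw [ip_apply, ip_apply, real_inner_comm]

lemma ip_cont : Continuous fun q : Sp ι × Sp ι => ip q.1 q.2 := by
  simp only [ip_apply]; fun_prop

lemma dimP_pos [Nonempty (Sp ι)] (n : ℕ) : 0 < dimP ι n := by
  obtain ⟨x⟩ := ‹Nonempty (Sp ι)›
  have : Nontrivial (Pol ι n) := by
    refine ⟨⟨1, one_mem_Pol n⟩, 0, fun h => ?_⟩
    have h1 : (1 : C(Sp ι, ℝ)) = 0 := congrArg Subtype.val h
    have := congrArg (fun f : C(Sp ι, ℝ) => f x) h1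
    simp at this
  exact Module.finrank_pos

def LL (n : ℕ) : ℕ := (n - 2) / 4
def RR (n : ℕ) : ℕ := n + 2 * LL n + 1

def K0 (n : ℕ) (x : Sp ι) : C(Sp ι, ℝ) := (Qk σ (LL n) x x)⁻¹ • (Z σ (RR n) x * Qk σ (LL n) x)
def KK (n : ℕ) (x : Sp ι) : C(Sp ι, ℝ) := K0 σ n x * ((1/2 : ℝ) • (1 + ip x))

lemma K0_apply (n : ℕ) (x y : Sp ι) : K0 σ n x y = (Qk σ (LL n) x x)⁻¹ * (Z σ (RR n) x y * Qk σ (LL n) x y) := by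
  simp [K0]
lemma KK_apply (n : ℕ) (x y : Sp ι) : KK σ n x y = K0 σ n x y * (1/2 * (1 + ip x y)) := by
  simp only [KK, ContinuousMap.mul_apply, ContinuousMap.smul_apply, ContinuousMap.add_apply,
    ContinuousMap.one_apply, smul_eq_mul]

lemma K0_symm (n : ℕ) (x y : Sp ι) : K0 σ n x y = K0 σ n y x := by
  rw [K0_apply, K0_apply, Z_symm, Qk_symm σ _ x y, Qk_diag_const σ _ x y]
lemma KK_symm (n : ℕ) (x y : Sp ι) : KK σ n x y = KK σ n y x := by
  rw [KK_apply, KK_apply, K0_symm, ip_symm]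

lemma K0_act (n : ℕ) (h : Eu ι ≃ₗᵢ[ℝ] Eu ι) (x y : Sp ι) : K0 σ n (act h x) (act h y) = K0 σ n x y := by
  simp only [K0_apply, Z_act, Qk_act]
lemma KK_act (n : ℕ) (h : Eu ι ≃ₗᵢ[ℝ] Eu ι) (x y : Sp ι) : KK σ n (act h x) (act h y) = KK σ n x y := by
  simp only [KK_apply, K0_act, ip_act]

lemma K0_cont (n : ℕ) : Continuous fun q : Sp ι × Sp ι => K0 σ n q.1 q.2 := by
  simp only [K0_apply]
  have h1 : ∀ q : Sp ι × Sp ι, Qk σ (LL n) q.1 q.1 = ∑ l ∈ Finset.range (LL n+1), (dimP ι (LL n + l) : ℝ) := by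
    intro q; simp [Qk_apply, Z_diag]
  simp only [h1]
  exact continuous_const.mul ((Z_cont σ _).mul (Qk_cont σ _))
lemma KK_cont (n : ℕ) : Continuous fun q : Sp ι × Sp ι => KK σ n q.1 q.2 := by
  simp only [KK_apply]
  exact (K0_cont σ n).mul (continuous_const.mul (continuous_const.add ip_cont))

lemma KK_mem (n : ℕ) (x : Sp ι) : KK σ n x ∈ Pol ι (RR n + 2 * LL n + 1) := by
  refine Pol_mul (Submodule.smul_mem _ _ (Pol_mul (Z_mem σ _ x) (Qk_mem σ _ x))) ?_
  exact Submodule.smul_mem _ _ (Submodule.add_mem _ (one_mem_Pol 1) (ip_mem x))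

lemma abs_KK_le (n : ℕ) (x y : Sp ι) : |KK σ n x y| ≤ |K0 σ n x y| := by
  rw [KK_apply, abs_mul]
  have a1 := ip_le x y
  have a2 := le_ip x y
  have : |1/2 * (1 + ip x y)| ≤ 1 := by rw [abs_le]; constructor <;> linarith
  exact mul_le_of_le_one_right (abs_nonneg _) this

lemma Qk_pos [Nonempty (Sp ι)] (L : ℕ) (x : Sp ι) : 0 < Qk σ L x x := by
  refine lt_of_lt_of_le ?_ (Qk_diag σ L x)
  have := dimP_pos (ι := ι) L
  positivity

lemma KK_rep [Nonempty (Sp ι)] {n : ℕ} {g : C(Sp ι, ℝ)} (hg : g ∈ Pol ι n) (x : Sp ι) :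
    ∫ y, KK σ n x y * g y ∂σ = g x := by
  have hm : (Qk σ (LL n) x x)⁻¹ • (Qk σ (LL n) x * ((1/2 : ℝ) • (1 + ip x)) * g) ∈ Pol ι (RR n) := by
    refine Submodule.smul_mem _ _ (Pol_mono (by unfold RR; omega : 2 * LL n + 1 + n ≤ RR n) ?_)
    refine Pol_mul (Pol_mul (Qk_mem σ _ x) ?_) hg
    exact Submodule.smul_mem _ _ (Submodule.add_mem _ (one_mem_Pol 1) (ip_mem x))
  have h := Z_rep σ hm x
  have hq := (Qk_pos σ (LL n) x).ne'
  have e : ((Qk σ (LL n) x x)⁻¹ • (Qk σ (LL n) x * ((1/2 : ℝ) • (1 + ip x)) * g)) x = g x := by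
    simp [ip_self]
    field_simp; ring
  rw [e] at h
  rw [← h]
  refine integral_congr_ae (Filter.Eventually.of_forall fun y => ?_)
  simp [KK_apply, K0_apply]
  ring

/-- kernel estimates -/
lemma kernel_bounds [Nonempty (Sp ι)] [Nontrivial ι] : ∃ C : ℝ, 1 ≤ C ∧ ∀ n x, (∫ y, |K0 σ n x y| ∂σ ≤ C) ∧
    (∫ y, ‖x.1 - y.1‖ * |K0 σ n x y| ∂σ ≤ C / (LL n + 1)) := by
  classical
  obtain ⟨C, hC, hd⟩ := dim_doubling (ι := ι)
  refine ⟨5/2 * C, by linarith, fun n x => ?_⟩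
  set L := LL n with hL
  set D : ℝ := (dimP ι L : ℝ) with hD
  have hD0 : 0 < D := by have := dimP_pos (ι := ι) L; rw [hD]; exact_mod_cast this
  have hR : (dimP ι (RR n) : ℝ) ≤ C * D := by
    refine le_trans ?_ (hd L)
    have : RR n ≤ 6 * (L + 1) := by unfold RR; rw [hL]; unfold LL; omega
    exact_mod_cast dimP_mono this
  have h2L : (dimP ι (2 * L) : ℝ) ≤ C * D := by
    refine le_trans ?_ (hd L)
    exact_mod_cast dimP_mono (by omega : 2 * L ≤ 6 * (L+1))
  set q := Qk σ L x x with hq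
  have hq0 : 0 < q := Qk_pos σ L x
  have hqD : ((L:ℝ)+1) * D ≤ q := Qk_diag σ L x
  have zsq : ∫ y, (Z σ (RR n) x y)^2 ∂σ ≤ C * D := by
    have := Z_sq σ (RR n) x
    simp only [sq]; rw [this]; exact hR
  have qsq : ∫ y, (Qk σ L x y)^2 ∂σ ≤ ((L:ℝ)+1)^2 * (C * D) :=
    (Qk_sq σ L x).trans (by gcongr)
  have qm : ∫ y, (1 - ip x y) * (Qk σ L x y)^2 ∂σ ≤ 2 * (C * D) :=
    (Qk_moment σ L x).trans (by gcongr)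
  have hL1 : (0:ℝ) < L + 1 := by positivity
  have habs : ∀ y, |K0 σ n x y| = q⁻¹ * (|Z σ (RR n) x y| * |Qk σ L x y|) := by
    intro y
    rw [K0_apply, abs_mul, abs_mul, abs_of_pos (inv_pos.2 hq0)]
  constructor
  · calc ∫ y, |K0 σ n x y| ∂σ ≤ ∫ y, q⁻¹ * ((1/2) * ((L+1) * (Z σ (RR n) x y)^2 + (L+1 : ℝ)⁻¹ * (Qk σ L x y)^2)) ∂σ := by
          refine integral_mono (integrable_cont σ (by fun_prop)) (integrable_cont σ (by fun_prop)) ?_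
          intro y
          simp only
          rw [habs y]
          refine mul_le_mul_of_nonneg_left ?_ (inv_pos.2 hq0).le
          rw [← sq_abs (Z σ (RR n) x y), ← sq_abs (Qk σ L x y)]
          set a := |Z σ (RR n) x y|
          set b := |Qk σ L x y|
          have : (1/2) * ((L+1) * a^2 + (L+1 : ℝ)⁻¹ * b^2) - a * b = (1/2) * (L+1 : ℝ)⁻¹ * ((L+1) * a - b)^2 := by
            field_simp; ring
          have h2 : 0 ≤ (1/2) * (L+1 : ℝ)⁻¹ * ((L+1) * a - b)^2 := by positivity
          linarith
      _ = q⁻¹ * ((1/2) * ((L+1) * ∫ y, (Z σ (RR n) x y)^2 ∂σ + (L+1 : ℝ)⁻¹ * ∫ y, (Qk σ L x y)^2 ∂σ)) := by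
          rw [integral_const_mul, integral_const_mul, integral_add, integral_const_mul, integral_const_mul]
          all_goals exact integrable_cont σ (by fun_prop)
      _ ≤ (((L:ℝ)+1) * D)⁻¹ * ((1/2) * ((L+1) * (C * D) + (L+1 : ℝ)⁻¹ * (((L:ℝ)+1)^2 * (C * D)))) := by
          gcongr
      _ = C := by field_simp; ring
      _ ≤ _ := by linarith
  · have hn : ∀ y : Sp ι, ‖x.1 - y.1‖^2 = 2 * (1 - ip x y) := by
      intro y
      rw [@norm_sub_sq ℝ, Sp.norm_eq, Sp.norm_eq, ip_apply]
      simp; ring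
    calc ∫ y, ‖x.1 - y.1‖ * |K0 σ n x y| ∂σ ≤ ∫ y, q⁻¹ * ((1/2) * ((Z σ (RR n) x y)^2 + 2 * ((1 - ip x y) * (Qk σ L x y)^2))) ∂σ := by
          refine integral_mono (integrable_cont σ (by fun_prop)) (integrable_cont σ (by fun_prop)) ?_
          intro y
          simp only
          rw [habs y, mul_left_comm]
          refine mul_le_mul_of_nonneg_left ?_ (inv_pos.2 hq0).le
          rw [← mul_assoc 2, ← hn, ← sq_abs (Z σ (RR n) x y), ← sq_abs (Qk σ L x y)]
          nlinarith [sq_nonneg (|Z σ (RR n) x y| - ‖x.1 - y.1‖ * |Qk σ L x y|)]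
      _ = q⁻¹ * ((1/2) * (∫ y, (Z σ (RR n) x y)^2 ∂σ + 2 * ∫ y, (1 - ip x y) * (Qk σ L x y)^2 ∂σ)) := by
          rw [integral_const_mul, integral_const_mul, integral_add, integral_const_mul]
          all_goals exact integrable_cont σ (by fun_prop)
      _ ≤ (((L:ℝ)+1) * D)⁻¹ * ((1/2) * ((C * D) + 2 * (2 * (C * D)))) := by
          gcongr
          have i1 : 0 ≤ ∫ y, (Z σ (RR n) x y)^2 ∂σ := integral_nonneg fun y => sq_nonneg _
          have i2 : 0 ≤ ∫ y, (1 - ip x y) * (Qk σ L x y)^2 ∂σ :=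
            integral_nonneg fun y => mul_nonneg (sub_nonneg.2 (ip_le x y)) (sq_nonneg _)
          positivity
      _ = _ := by field_simp; ring

lemma param_cont {X : Type*} [TopologicalSpace X] [FirstCountableTopology X] [LocallyCompactSpace X] {f : X → Sp ι → ℝ}
    (hf : Continuous (Function.uncurry f)) : Continuous fun x => ∫ y, f x y ∂σ := by
  have := continuous_parametric_integral_of_continuous (μ := σ) hf isCompact_univ
  simpa using this

/-- the near-best approximation operator -/
def V (n : ℕ) : C(Sp ι, ℝ) →ₗ[ℝ] C(Sp ι, ℝ) where
  toFun F := ⟨fun x => ∫ y, KK σ n x y * F y ∂σ, param_cont σ (by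
    exact (KK_cont σ n).mul (F.continuous.comp continuous_snd))⟩
  map_add' F G := by
    ext x
    simp only [ContinuousMap.coe_mk, ContinuousMap.add_apply, mul_add]
    rw [integral_add] <;> exact integrable_cont σ (by fun_prop)
  map_smul' c F := by
    ext x
    simp only [ContinuousMap.coe_mk, ContinuousMap.smul_apply, smul_eq_mul, RingHom.id_apply]
    rw [← integral_const_mul]
    congr 1; funext y; ring

lemma V_apply (n : ℕ) (F : C(Sp ι, ℝ)) (x : Sp ι) : V σ n F x = ∫ y, KK σ n x y * F y ∂σ := rfl

lemma V_rep [Nonempty (Sp ι)] {n : ℕ} {g : C(Sp ι, ℝ)} (hg : g ∈ Pol ι n) : V σ n g = g := by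
  ext x; exact KK_rep σ hg x

lemma V_act (n : ℕ) (h : Eu ι ≃ₗᵢ[ℝ] Eu ι) (F : C(Sp ι, ℝ)) :
    V σ n (F.comp (act h)) = (V σ n F).comp (act h) := by
  ext x
  rw [ContinuousMap.comp_apply, V_apply, V_apply]
  have := int_act σ h (KK σ n (act h x) * F)
  simp only [ContinuousMap.mul_apply, KK_act] at this
  exact this

lemma V_mem (n : ℕ) (F : C(Sp ι, ℝ)) : V σ n F ∈ Pol ι (RR n + 2 * LL n + 1) := by
  set M := RR n + 2 * LL n + 1
  let c : Fin (dimP ι M) → Sp ι → ℝ := fun k y => ∫ z, onb σ M k z * KK σ n y z ∂σ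
  have hc : ∀ k, Continuous (c k) := fun k => param_cont σ (by
    exact ((onb σ M k).continuous.comp continuous_snd).mul (KK_cont σ n))
  have e : V σ n F = ∑ k, (∫ y, c k y * F y ∂σ) • onb σ M k := by
    ext x
    rw [V_apply]
    have h1 : ∀ y, KK σ n x y * F y = ∑ k, (c k y * F y) * onb σ M k x := by
      intro y
      have h2 : KK σ n y x = ∑ k, c k y * onb σ M k x := (exists_onb σ M).choose_spec.2.2 _ (KK_mem σ n y) x
      rw [KK_symm, h2, Finset.sum_mul]
      exact Finset.sum_congr rfl fun k _ => by ring
    simp only [h1]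
    rw [integral_finsetSum]
    · simp [integral_mul_const]
    · intro k _
      have := hc k
      exact integrable_cont σ (by fun_prop)
  rw [e]
  exact Submodule.sum_mem _ fun k _ => Submodule.smul_mem _ _ (onb_mem σ M k)

lemma V_mem' {n : ℕ} (F : C(Sp ι, ℝ)) : V σ n F ∈ Pol ι (2 * n + 2) :=
  Pol_mono (by unfold RR LL; omega) (V_mem σ n F)

lemma V_mem'' {n : ℕ} (hn : 2 ≤ n) (F : C(Sp ι, ℝ)) : V σ n F ∈ Pol ι (2 * n) :=
  Pol_mono (by unfold RR LL; omega) (V_mem σ n F)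

lemma V_comp [Nonempty (Sp ι)] {k K : ℕ} (h : 2 * k + 2 ≤ K) (F : C(Sp ι, ℝ)) : V σ k (V σ K F) = V σ k F := by
  ext x
  rw [V_apply, V_apply]
  have h1 : ∀ y, KK σ k x y * V σ K F y = ∫ z, KK σ k x y * (KK σ K y z * F z) ∂σ := by
    intro y; rw [V_apply, integral_const_mul]
  simp only [h1]
  rw [integral_integral_swap]
  · refine integral_congr_ae (Filter.Eventually.of_forall fun z => ?_)
    simp only
    have hm : KK σ k x ∈ Pol ι K := Pol_mono (by unfold RR LL; omega) (KK_mem σ k x)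
    have := KK_rep σ hm z
    rw [← this, ← integral_mul_const]
    refine integral_congr_ae (Filter.Eventually.of_forall fun y => ?_)
    simp only
    rw [KK_symm σ K y z]; ring
  · refine Continuous.integrable_of_hasCompactSupport ?_ (HasCompactSupport.of_compactSpace _)
    exact ((KK σ k x).continuous.comp continuous_fst).mul
      ((KK_cont σ K).mul (F.continuous.comp continuous_snd))

end P3c
end BallApprox
namespace BallApprox
set_option linter.unusedSectionVars false
section P4a
variable {ι : Type} [Fintype ι]

instance instNonemptySp [Nontrivial ι] : Nonempty (Sp ι) := by
  classical
  obtain ⟨a, _, _⟩ := exists_pair_ne ι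
  exact ⟨⟨EuclideanSpace.single a 1, by simp⟩⟩

variable (σ : Measure (Sp ι)) [IsProbabilityMeasure σ] [σ.IsOpenPosMeasure] [RotInv σ]
variable (p : ℝ≥0∞)

def nrm (F : C(Sp ι, ℝ)) : ℝ := (eLpNorm F p σ).toReal

lemma nrm_nonneg (F : C(Sp ι, ℝ)) : 0 ≤ nrm σ p F := ENNReal.toReal_nonneg

lemma asm_C (F : C(Sp ι, ℝ)) : AEStronglyMeasurable F σ := F.continuous.aestronglyMeasurable

lemma eLp_ne_top (F : C(Sp ι, ℝ)) : eLpNorm F p σ ≠ ∞ := by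
  have : MemLp F p σ := MemLp.of_bound (asm_C σ F) ‖F‖ (Filter.Eventually.of_forall fun x => F.norm_coe_le_norm x)
  exact this.2.ne

lemma ofReal_nrm (F : C(Sp ι, ℝ)) : ENNReal.ofReal (nrm σ p F) = eLpNorm F p σ :=
  ENNReal.ofReal_toReal (eLp_ne_top σ p F)

lemma nrm_le_of {F : C(Sp ι, ℝ)} {c : ℝ} (hc : 0 ≤ c) (h : eLpNorm F p σ ≤ ENNReal.ofReal c) : nrm σ p F ≤ c :=
  ENNReal.toReal_le_of_le_ofReal hc h

lemma nrm_zero : nrm σ p (0 : C(Sp ι, ℝ)) = 0 := by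
  simp [nrm]

lemma nrm_smul (c : ℝ) (F : C(Sp ι, ℝ)) : nrm σ p (c • F) = |c| * nrm σ p F := by
  unfold nrm
  have : ((c • F : C(Sp ι, ℝ)) : Sp ι → ℝ) = c • (F : Sp ι → ℝ) := rfl
  rw [this, eLpNorm_const_smul, ENNReal.toReal_mul]
  simp

lemma nrm_neg (F : C(Sp ι, ℝ)) : nrm σ p (-F) = nrm σ p F := by
  have := nrm_smul σ p (-1) F
  simpa using this

lemma nrm_mono {F G : C(Sp ι, ℝ)} (h : ∀ x, |F x| ≤ |G x|) : nrm σ p F ≤ nrm σ p G :=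
  ENNReal.toReal_mono (eLp_ne_top σ p G) (eLpNorm_mono fun x => by simpa using h x)

lemma nrm_abs (F : C(Sp ι, ℝ)) : nrm σ p |F| = nrm σ p F :=
  le_antisymm (nrm_mono σ p fun x => by simp) (nrm_mono σ p fun x => by simp)

lemma nrm_act (h : Eu ι ≃ₗᵢ[ℝ] Eu ι) (F : C(Sp ι, ℝ)) : nrm σ p (F.comp (act h)) = nrm σ p F := by
  unfold nrm
  congr 1
  have := eLpNorm_comp_measurePreserving (p := p) (asm_C σ F) (RotInv.inv (σ := σ) h)
  exact this

lemma nrm_le_sup {F : C(Sp ι, ℝ)} {c : ℝ} (hc : 0 ≤ c) (h : ∀ x, |F x| ≤ c) : nrm σ p F ≤ c := by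
  refine nrm_le_of σ p hc ?_
  refine (eLpNorm_le_of_ae_bound (Filter.Eventually.of_forall h)).trans ?_
  simp

variable [hp : Fact (1 ≤ p)]

lemma nrm_add (F G : C(Sp ι, ℝ)) : nrm σ p (F + G) ≤ nrm σ p F + nrm σ p G := by
  unfold nrm
  rw [← ENNReal.toReal_add (eLp_ne_top σ p F) (eLp_ne_top σ p G)]
  refine ENNReal.toReal_mono (ENNReal.add_ne_top.2 ⟨eLp_ne_top σ p F, eLp_ne_top σ p G⟩) ?_
  exact eLpNorm_add_le (asm_C σ F) (asm_C σ G) hp.1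

lemma nrm_sub (F G : C(Sp ι, ℝ)) : nrm σ p (F - G) ≤ nrm σ p F + nrm σ p G := by
  rw [sub_eq_add_neg, ← nrm_neg σ p G]; exact nrm_add σ p F (-G)

lemma nrm_sum {α : Type*} (s : Finset α) (F : α → C(Sp ι, ℝ)) :
    nrm σ p (∑ a ∈ s, F a) ≤ ∑ a ∈ s, nrm σ p (F a) := by
  classical
  induction s using Finset.induction_on with
  | empty => simp [nrm_zero]
  | insert a s ha ih =>
    rw [Finset.sum_insert ha, Finset.sum_insert ha]
    exact (nrm_add σ p _ _).trans (by linarith)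

lemma nrm_schur {Y : Type*} [MeasurableSpace Y] (ν : Measure Y) [SFinite ν] (w : Sp ι × Y → ℝ≥0∞) (hw : Measurable w)
    (γ : Sp ι × Y → Sp ι) (hγ : Measurable γ) (C : ℝ) (hC : 0 ≤ C)
    (h1 : ∀ x, ∫⁻ y, w (x,y) ∂ν ≤ ENNReal.ofReal C)
    (h2 : ∀ H : Sp ι → ℝ≥0∞, Measurable H →
      ∫⁻ x, ∫⁻ y, w (x,y) * H (γ (x,y)) ∂ν ∂σ ≤ ENNReal.ofReal C * ∫⁻ x, H x ∂σ)
    (F G : C(Sp ι, ℝ)) (hFG : ∀ x, ‖F x‖ₑ ≤ ∫⁻ y, w (x,y) * ‖G (γ (x,y))‖ₑ ∂ν) :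
    nrm σ p F ≤ C * nrm σ p G := by
  refine nrm_le_of σ p (mul_nonneg hC (nrm_nonneg σ p G)) ?_
  rw [ENNReal.ofReal_mul hC, ofReal_nrm]
  have h := schur σ ν w hw γ hγ _ h1 h2 p hp.1 (fun x => ‖G x‖ₑ) (by
    have := G.continuous.measurable; fun_prop)
  rw [eLpNorm_enorm] at h
  refine le_trans ?_ h
  exact eLpNorm_mono_enorm fun x => by simpa using hFG x

/-- a bounded kernel -/
lemma V_bound [Nontrivial ι] : ∃ C : ℝ, 1 ≤ C ∧ ∀ n F, nrm σ p (V σ n F) ≤ C * nrm σ p F := by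
  obtain ⟨C, hC, hb⟩ := kernel_bounds σ
  refine ⟨C, hC, fun n F => ?_⟩
  have hm : Measurable fun q : Sp ι × Sp ι => ‖KK σ n q.1 q.2‖ₑ := (KK_cont σ n).enorm.measurable
  have h1 : ∀ x, ∫⁻ y, ‖KK σ n x y‖ₑ ∂σ ≤ ENNReal.ofReal C := by
    intro x
    calc ∫⁻ y, ‖KK σ n x y‖ₑ ∂σ ≤ ∫⁻ y, ‖K0 σ n x y‖ₑ ∂σ := by
          refine lintegral_mono fun y => ?_
          rw [Real.enorm_eq_ofReal_abs, Real.enorm_eq_ofReal_abs]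
          exact ENNReal.ofReal_le_ofReal (abs_KK_le σ n x y)
      _ = ENNReal.ofReal (∫ y, ‖K0 σ n x y‖ ∂σ) :=
          (ofReal_integral_norm_eq_lintegral_enorm (integrable_C σ (K0 σ n x))).symm
      _ ≤ _ := ENNReal.ofReal_le_ofReal (hb n x).1
  refine nrm_schur σ p σ (fun q => ‖KK σ n q.1 q.2‖ₑ) hm (fun q => q.2) measurable_snd C (by linarith) h1 ?_ _ F ?_
  · intro H hH
    rw [lintegral_lintegral_swap (hm.mul (hH.comp measurable_snd)).aemeasurable]
    rw [← lintegral_const_mul _ hH]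
    refine lintegral_mono fun y => ?_
    have e : ∀ x, KK σ n x y = KK σ n y x := fun x => KK_symm σ n x y
    have hcy : Measurable fun x : Sp ι => ‖KK σ n y x‖ₑ := (KK σ n y).continuous.enorm.measurable
    calc ∫⁻ x, ‖KK σ n x y‖ₑ * H y ∂σ = ∫⁻ x, ‖KK σ n y x‖ₑ * H y ∂σ := by simp only [e]
      _ = (∫⁻ x, ‖KK σ n y x‖ₑ ∂σ) * H y := lintegral_mul_const _ hcy
      _ ≤ _ := by gcongr; exact h1 y
  · intro x
    rw [V_apply]
    refine (enorm_integral_le_lintegral_enorm _).trans (le_of_eq ?_)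
    simp only [enorm_mul]

end P4a
end BallApprox
namespace BallApprox
set_option linter.unusedSectionVars false
section P4b
variable {ι : Type} [Fintype ι] [DecidableEq ι]

/-- ordered pairs of distinct indices -/
abbrev Pr (ι : Type) := {a : ι × ι // a.1 ≠ a.2}

def rotFun (a : Pr ι) (t : ℝ) (x : Eu ι) : Eu ι := WithLp.toLp 2 fun k =>
  if k = a.1.1 then Real.cos t * x a.1.1 + Real.sin t * x a.1.2
  else if k = a.1.2 then Real.cos t * x a.1.2 - Real.sin t * x a.1.1 else x k

lemma rotFun_fst (a : Pr ι) (t : ℝ) (x : Eu ι) :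
    rotFun a t x a.1.1 = Real.cos t * x a.1.1 + Real.sin t * x a.1.2 := by simp [rotFun]
lemma rotFun_snd (a : Pr ι) (t : ℝ) (x : Eu ι) :
    rotFun a t x a.1.2 = Real.cos t * x a.1.2 - Real.sin t * x a.1.1 := by
  simp [rotFun, a.2.symm]
lemma rotFun_other (a : Pr ι) (t : ℝ) (x : Eu ι) {k : ι} (h1 : k ≠ a.1.1) (h2 : k ≠ a.1.2) :
    rotFun a t x k = x k := by
  simp [rotFun, h1, h2]

lemma rotFun_add (a : Pr ι) (s t : ℝ) (x : Eu ι) : rotFun a s (rotFun a t x) = rotFun a (s + t) x := by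
  ext k
  by_cases h1 : k = a.1.1
  · rw [h1, rotFun_fst, rotFun_fst, rotFun_fst, rotFun_snd, Real.cos_add, Real.sin_add]; ring
  · by_cases h2 : k = a.1.2
    · rw [h2, rotFun_snd, rotFun_snd, rotFun_fst, rotFun_snd, Real.cos_add, Real.sin_add]; ring
    · rw [rotFun_other a s _ h1 h2, rotFun_other a t _ h1 h2, rotFun_other a _ _ h1 h2]

lemma rotFun_zero (a : Pr ι) (x : Eu ι) : rotFun a 0 x = x := by
  ext k
  by_cases h1 : k = a.1.1
  · rw [h1, rotFun_fst]; simp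
  · by_cases h2 : k = a.1.2
    · rw [h2, rotFun_snd]; simp
    · rw [rotFun_other a _ _ h1 h2]

lemma rotFun_norm (a : Pr ι) (t : ℝ) (x : Eu ι) : ‖rotFun a t x‖ = ‖x‖ := by
  have key : ‖rotFun a t x‖^2 = ‖x‖^2 := by
    rw [EuclideanSpace.norm_sq_eq, EuclideanSpace.norm_sq_eq]
    rw [← Finset.add_sum_erase _ _ (Finset.mem_univ a.1.1), ← Finset.add_sum_erase _ _ (Finset.mem_univ a.1.1)]
    have hm : a.1.2 ∈ Finset.univ.erase a.1.1 := by simp [a.2.symm]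
    rw [← Finset.add_sum_erase _ _ hm, ← Finset.add_sum_erase _ _ hm]
    have : ∑ k ∈ (Finset.univ.erase a.1.1).erase a.1.2, ‖rotFun a t x k‖^2 =
        ∑ k ∈ (Finset.univ.erase a.1.1).erase a.1.2, ‖x k‖^2 := by
      refine Finset.sum_congr rfl fun k hk => ?_
      simp only [Finset.mem_erase, Finset.mem_univ, and_true] at hk
      rw [rotFun_other a t x hk.2 hk.1]
    rw [this, rotFun_fst, rotFun_snd]
    simp only [Real.norm_eq_abs, sq_abs]
    linear_combination (x a.1.1 ^2 + x a.1.2^2) * Real.sin_sq_add_cos_sq t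
  exact (sq_eq_sq₀ (norm_nonneg _) (norm_nonneg _)).1 key

def rot (a : Pr ι) (t : ℝ) : Eu ι ≃ₗᵢ[ℝ] Eu ι where
  toFun := rotFun a t
  invFun := rotFun a (-t)
  left_inv x := by rw [rotFun_add]; simp [rotFun_zero]
  right_inv x := by rw [rotFun_add]; simp [rotFun_zero]
  map_add' x y := by
    ext k
    by_cases h1 : k = a.1.1
    · rw [h1, PiLp.add_apply, rotFun_fst, rotFun_fst, rotFun_fst]; simp; ring
    · by_cases h2 : k = a.1.2
      · rw [h2, PiLp.add_apply, rotFun_snd, rotFun_snd, rotFun_snd]; simp; ring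
      · rw [PiLp.add_apply, rotFun_other a _ _ h1 h2, rotFun_other a _ _ h1 h2, rotFun_other a _ _ h1 h2]; rfl
  map_smul' c x := by
    ext k
    by_cases h1 : k = a.1.1
    · rw [h1, PiLp.smul_apply, rotFun_fst, rotFun_fst]; simp; ring
    · by_cases h2 : k = a.1.2
      · rw [h2, PiLp.smul_apply, rotFun_snd, rotFun_snd]; simp; ring
      · rw [PiLp.smul_apply, rotFun_other a _ _ h1 h2, rotFun_other a _ _ h1 h2]; rfl
  norm_map' x := rotFun_norm a t x

lemma rot_apply (a : Pr ι) (t : ℝ) (x : Eu ι) : rot a t x = rotFun a t x := rfl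

/-- rotation flow on the sphere -/
def fl (a : Pr ι) (t : ℝ) : C(Sp ι, Sp ι) := act (rot a t)

lemma fl_coe (a : Pr ι) (t : ℝ) (x : Sp ι) : (fl a t x).1 = rotFun a t x.1 := rfl
lemma fl_zero (a : Pr ι) (x : Sp ι) : fl a 0 x = x := Subtype.ext (rotFun_zero a x.1)
lemma fl_add (a : Pr ι) (s t : ℝ) (x : Sp ι) : fl a s (fl a t x) = fl a (s + t) x :=
  Subtype.ext (rotFun_add a s t x.1)
lemma fl_two_pi (a : Pr ι) (t : ℝ) (x : Sp ι) : fl a (t + 2 * π) x = fl a t x := by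
  apply Subtype.ext
  rw [fl_coe, fl_coe]
  ext k; simp [rotFun]

lemma rotFun_cont (a : Pr ι) : Continuous fun q : ℝ × Eu ι => rotFun a q.1 q.2 := by
  refine (PiLp.continuous_toLp 2 _).comp (continuous_pi fun k => ?_)
  by_cases h1 : k = a.1.1
  · simp only [h1, if_true]; fun_prop
  · by_cases h2 : k = a.1.2
    · simp only [h1, h2, if_true, a.2.symm, if_false]; fun_prop
    · simp only [h1, h2, if_false]; fun_prop

lemma fl_cont (a : Pr ι) : Continuous fun q : ℝ × Sp ι => fl a q.1 q.2 := by
  have h0 : Continuous fun q : ℝ × Sp ι => ((q.1, q.2.1) : ℝ × Eu ι) := by fun_prop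
  have h := (rotFun_cont a).comp h0
  rw [continuous_induced_rng]
  exact h

def FlowD (a : Pr ι) (F F' : C(Sp ι, ℝ)) : Prop :=
  ∀ x t, HasDerivAt (fun t => F (fl a t x)) (F' (fl a t x)) t

lemma FlowD.unique {a : Pr ι} {F F' F'' : C(Sp ι, ℝ)} (h : FlowD a F F') (h' : FlowD a F F'') : F' = F'' := by
  ext x
  have := (h x 0).unique (h' x 0)
  simpa [fl_zero] using this

lemma FlowD.add {a : Pr ι} {F F' G G' : C(Sp ι, ℝ)} (h : FlowD a F F') (h' : FlowD a G G') :
    FlowD a (F + G) (F' + G') := fun x t => (h x t).add (h' x t)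
lemma FlowD.sub {a : Pr ι} {F F' G G' : C(Sp ι, ℝ)} (h : FlowD a F F') (h' : FlowD a G G') :
    FlowD a (F - G) (F' - G') := fun x t => (h x t).sub (h' x t)
lemma FlowD.mul {a : Pr ι} {F F' G G' : C(Sp ι, ℝ)} (h : FlowD a F F') (h' : FlowD a G G') :
    FlowD a (F * G) (F' * G + F * G') := fun x t => (h x t).mul (h' x t)
lemma FlowD.sum {α : Type*} {a : Pr ι} (s : Finset α) {F F' : α → C(Sp ι, ℝ)} (h : ∀ k ∈ s, FlowD a (F k) (F' k)) :
    FlowD a (∑ k ∈ s, F k) (∑ k ∈ s, F' k) := by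
  intro x t
  simp only [ContinuousMap.coe_sum, Finset.sum_apply]
  exact HasDerivAt.fun_sum fun k hk => h k hk x t

open MvPolynomial in
def Dp (a : Pr ι) : Derivation ℝ (MvPolynomial ι ℝ) (MvPolynomial ι ℝ) :=
  (X a.1.2 : MvPolynomial ι ℝ) • pderiv a.1.1 - (X a.1.1 : MvPolynomial ι ℝ) • pderiv a.1.2

open MvPolynomial in
lemma Dp_apply (a : Pr ι) (P : MvPolynomial ι ℝ) :
    Dp a P = X a.1.2 * pderiv a.1.1 P - X a.1.1 * pderiv a.1.2 P := rfl

open MvPolynomial in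
lemma flow_coord (a : Pr ι) (k : ι) : FlowD a (toC (X k)) (toC (Dp a (X k))) := by
  intro x t
  simp only [toC_apply, eval_X, Dp_apply, pderiv_X, fl_coe]
  simp only [map_sub, map_mul, eval_X]
  by_cases h1 : k = a.1.1
  · subst h1
    simp only [rotFun_fst, rotFun_snd, Pi.single_eq_same, map_one, Pi.single_eq_of_ne a.2.symm,
      Pi.single_eq_of_ne a.2, map_zero]
    have := ((Real.hasDerivAt_cos t).mul_const (x.1 a.1.1)).add ((Real.hasDerivAt_sin t).mul_const (x.1 a.1.2))
    exact this.congr_deriv (by ring)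
  · by_cases h2 : k = a.1.2
    · subst h2
      simp only [rotFun_fst, rotFun_snd, Pi.single_eq_same, map_one, Pi.single_eq_of_ne a.2.symm,
        Pi.single_eq_of_ne a.2, map_zero]
      have := ((Real.hasDerivAt_cos t).mul_const (x.1 a.1.2)).sub ((Real.hasDerivAt_sin t).mul_const (x.1 a.1.1))
      exact this.congr_deriv (by ring)
    · simp only [rotFun_other a _ _ h1 h2]
      rw [Pi.single_eq_of_ne' (Ne.symm h1), Pi.single_eq_of_ne' (Ne.symm h2)]
      simpa using hasDerivAt_const t (x.1 k)

open MvPolynomial in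
lemma flow_toC (a : Pr ι) (P : MvPolynomial ι ℝ) : FlowD a (toC P) (toC (Dp a P)) := by
  induction P using MvPolynomial.induction_on with
  | C c =>
    intro x t
    simpa [toC_apply, Dp_apply] using hasDerivAt_const t c
  | add P Q hP hQ => simp only [map_add]; exact hP.add hQ
  | mul_X P k hP =>
    have := hP.mul (flow_coord a k)
    rw [Derivation.leibniz, map_mul, map_add]
    simp only [smul_eq_mul, map_mul]
    convert this using 1
    ring

open MvPolynomial in
lemma pderiv_deg (i : ι) (P : MvPolynomial ι ℝ) {s : ι →₀ ℕ} (hs : s ∈ (pderiv i P).support) :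
    (s.sum fun _ e => e) + 1 ≤ P.totalDegree := by
  have h2 : coeff s (pderiv i P) = coeff (s + Finsupp.single i 1) P * (s i + 1) := by
    exact coeff_pderiv ..
  have : s + Finsupp.single i 1 ∈ P.support := by
    rw [mem_support_iff] at hs ⊢
    intro h0; rw [h2, h0, zero_mul] at hs; exact hs rfl
  have h3 := le_totalDegree this
  rw [Finsupp.sum_add_index' (by simp) (by simp)] at h3
  simpa using h3

open MvPolynomial in
lemma Dp_deg (a : Pr ι) (P : MvPolynomial ι ℝ) : (Dp a P).totalDegree ≤ P.totalDegree := by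
  have key : ∀ i j : ι, (X j * pderiv i P : MvPolynomial ι ℝ).totalDegree ≤ P.totalDegree := by
    intro i j
    by_cases h0 : pderiv i P = 0
    · simp [h0]
    · refine (totalDegree_mul _ _).trans ?_
      rw [totalDegree_X]
      obtain ⟨s, hs⟩ := support_nonempty.2 h0
      have h1 := pderiv_deg i P hs
      have : (pderiv i P).totalDegree ≤ P.totalDegree - 1 := by
        refine Finset.sup_le fun s hs => ?_
        have := pderiv_deg i P hs
        omega
      omega
  rw [Dp_apply]
  exact (totalDegree_sub _ _).trans (max_le (key _ _) (key _ _))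

variable (σ : Measure (Sp ι)) [IsProbabilityMeasure σ] [σ.IsOpenPosMeasure] [RotInv σ]

lemma FlowD.V {a : Pr ι} {F F' : C(Sp ι, ℝ)} (h : FlowD a F F') (n : ℕ) : FlowD a (V σ n F) (V σ n F') := by
  intro x t
  have e : ∀ (G : C(Sp ι, ℝ)) t, BallApprox.V σ n G (fl a t x) = ∫ y, KK σ n x y * G (fl a t y) ∂σ := by
    intro G t
    have := V_act σ n (rot a t) G
    have := congrArg (fun f : C(Sp ι, ℝ) => f x) this
    simp only [ContinuousMap.comp_apply] at this
    exact this.symm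
  simp only [e]
  refine (hasDerivAt_integral_of_dominated_loc_of_deriv_le (bound := fun y => |KK σ n x y| * ‖F'‖)
    (F := fun t y => KK σ n x y * F (fl a t y)) (F' := fun t y => KK σ n x y * F' (fl a t y)) (μ := σ) (x₀ := t)
    (s := Set.univ) Filter.univ_mem ?_ ?_ ?_ ?_ ?_ ?_).2
  · exact Filter.Eventually.of_forall fun s => (by fun_prop : Continuous fun y => KK σ n x y * F (fl a s y)).aestronglyMeasurable
  · exact integrable_cont σ (by fun_prop)
  · exact (by fun_prop : Continuous fun y => KK σ n x y * F' (fl a t y)).aestronglyMeasurable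
  · refine Filter.Eventually.of_forall fun y s _ => ?_
    rw [norm_mul]
    exact mul_le_mul_of_nonneg_left (F'.norm_coe_le_norm _) (norm_nonneg _)
  · exact integrable_cont σ (by fun_prop)
  · refine Filter.Eventually.of_forall fun y s _ => ?_
    exact (h y s).const_mul _

lemma nrm_fl (p : ℝ≥0∞) (a : Pr ι) (t : ℝ) (F : C(Sp ι, ℝ)) : nrm σ p (F.comp (fl a t)) = nrm σ p F :=
  nrm_act σ p (rot a t) F

lemma fl_mp (a : Pr ι) (t : ℝ) : MeasurePreserving (fl a t) σ σ := RotInv.inv (rot a t)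

attribute [irreducible] fl

end P4b
end BallApprox
namespace BallApprox
set_option linter.unusedSectionVars false
section P4c
variable {ι : Type} [Fintype ι] [DecidableEq ι]

def chord (x y : Sp ι) (s : ℝ) : Eu ι := x.1 + s • (y.1 - x.1)

lemma chord_apply (x y : Sp ι) (s : ℝ) (i : ι) : chord x y s i = x.1 i + s * (y.1 i - x.1 i) := by
  simp [chord]

lemma chord_norm (x y : Sp ι) (s : ℝ) : ‖chord x y s‖^2 = 1 - 2*s*(1-s)*(1 - ip x y) := by
  rw [chord, ip_apply, ← real_inner_self_eq_norm_sq]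
  simp only [inner_add_left, inner_add_right, inner_sub_left, inner_sub_right, inner_smul_left, inner_smul_right,
    real_inner_self_eq_norm_sq, Sp.norm_eq, real_inner_comm x.1 y.1]
  simp only [conj_trivial]
  ring

def gam (q : Sp ι × (Sp ι × ℝ)) : Sp ι :=
  ⟨if chord q.1 q.2.1 q.2.2 = 0 then q.1.1 else ‖chord q.1 q.2.1 q.2.2‖⁻¹ • chord q.1 q.2.1 q.2.2, by
    split_ifs with h
    · exact q.1.2
    · rw [mem_sphere_zero_iff_norm, norm_smul, norm_inv, norm_norm, inv_mul_cancel₀ (norm_ne_zero_iff.2 h)]⟩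

lemma gam_meas : Measurable (gam (ι := ι)) := by
  have hc : Continuous fun q : Sp ι × (Sp ι × ℝ) => chord q.1 q.2.1 q.2.2 := by
    unfold chord; fun_prop
  have hm := hc.measurable
  refine Measurable.subtype_mk (Measurable.ite (measurableSet_eq_fun hm measurable_const) ?_ ?_)
  · fun_prop
  · exact hm.norm.inv.smul hm

lemma chord_act (h : Eu ι ≃ₗᵢ[ℝ] Eu ι) (x y : Sp ι) (s : ℝ) : chord (act h x) (act h y) s = h (chord x y s) := by
  simp [chord]

lemma gam_act (h : Eu ι ≃ₗᵢ[ℝ] Eu ι) (x y : Sp ι) (s : ℝ) :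
    gam (act h x, (act h y, s)) = act h (gam (x, (y, s))) := by
  apply Subtype.ext
  rw [act_coe]
  simp only [gam, chord_act, act_coe, LinearIsometryEquiv.norm_map, EmbeddingLike.map_eq_zero_iff]
  split_ifs <;> simp

open MvPolynomial in
lemma eval_deriv (P : MvPolynomial ι ℝ) (u : ℝ → ι → ℝ) (A : ι → ℝ) (s : ℝ)
    (hu : ∀ i, HasDerivAt (fun s => u s i) (A i) s) :
    HasDerivAt (fun s => eval (u s) P) (∑ i, A i * eval (u s) (pderiv i P)) s := by
  induction P using MvPolynomial.induction_on with
  | C c => simpa using hasDerivAt_const s c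
  | add P Q hP hQ =>
    simp only [map_add]
    exact (hP.add hQ).congr_deriv (by simp [mul_add, Finset.sum_add_distrib])
  | mul_X P k hP =>
    simp only [map_mul, eval_X]
    refine (hP.mul (hu k)).congr_deriv ?_
    simp only [Derivation.leibniz, smul_eq_mul, map_add, map_mul, eval_X, pderiv_X, mul_add, Finset.sum_add_distrib]
    rw [add_comm]
    congr 1
    · rw [Finset.sum_eq_single k]
      · simp; ring
      · intro b _ hb; simp [Pi.single_apply, Ne.symm hb]
      · simp
    · rw [Finset.sum_mul]
      exact Finset.sum_congr rfl fun i _ => by ring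

/-- algebraic identity -/
lemma tang_id (u A w : ι → ℝ) (h1 : ∑ i, u i ^2 = 1) (h2 : ∑ i, u i * A i = 0) :
    ∑ i, A i * w i = 1/2 * ∑ i, ∑ j, (A i * u j - u i * A j) * (u j * w i - u i * w j) := by
  have e : ∀ i j, (A i * u j - u i * A j) * (u j * w i - u i * w j) =
      A i * w i * u j^2 - (u i * A i) * (u j * w j) - (u i * w i) * (u j * A j) + (u i^2) * (A j * w j) := by
    intro i j; ring
  simp only [e, Finset.sum_add_distrib, Finset.sum_sub_distrib, ← Finset.mul_sum, h1, h2, ← Finset.sum_mul]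
  ring

def Hsum (P : MvPolynomial ι ℝ) : C(Sp ι, ℝ) := ∑ a : Pr ι, |toC (Dp a P)|

lemma Hsum_apply (P : MvPolynomial ι ℝ) (x : Sp ι) : Hsum P x = ∑ a : Pr ι, |toC (Dp a P) x| := by
  simp [Hsum, ContinuousMap.sum_apply]

lemma sum_pr (G : ι → ι → ℝ) (hG : ∀ i, G i i = 0) : ∑ i, ∑ j, G i j = ∑ a : Pr ι, G a.1.1 a.1.2 := by
  rw [← Fintype.sum_prod_type' (f := G)]
  symm
  have : ∑ a ∈ (Finset.univ.filter fun a : ι × ι => a.1 ≠ a.2), G a.1 a.2 = ∑ a : Pr ι, G a.1.1 a.1.2 :=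
    Finset.sum_subtype (p := fun a : ι × ι => a.1 ≠ a.2) (Finset.univ.filter fun a : ι × ι => a.1 ≠ a.2)
    (by simp) (fun a => G a.1 a.2)
  rw [← this, Finset.sum_filter]
  refine Finset.sum_congr rfl fun a _ => ?_
  split_ifs with h
  · rfl
  · push Not at h; rw [h, hG]

lemma Sp.abs_coord_le (x : Sp ι) (i : ι) : |x.1 i| ≤ 1 := by
  have := PiLp.norm_apply_le x.1 i
  rwa [Sp.norm_eq, Real.norm_eq_abs] at this

open MvPolynomial in
lemma diff_bound (P : MvPolynomial ι ℝ) (x y : Sp ι) :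
    ENNReal.ofReal (1/2 * (1 + ip x y)) * ‖toC P x - toC P y‖ₑ ≤
      ENNReal.ofReal ‖x.1 - y.1‖ * ∫⁻ s in Set.Icc (0:ℝ) 1, ‖Hsum P (gam (x, (y, s)))‖ₑ := by
  rcases eq_or_lt_of_le (le_ip x y) with h0 | h0
  · rw [← h0]; simp
  set q : ℝ → ℝ := fun s => 1 - 2*s*(1-s)*(1 - ip x y) with hq
  have hqlow : ∀ s, 1/2 * (1 + ip x y) ≤ q s := by
    intro s
    have := ip_le x y
    have : 0 ≤ (2 * s - 1)^2 * (1 - ip x y) := mul_nonneg (sq_nonneg _) (by linarith)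
    simp only [hq]; nlinarith
  have hqpos : ∀ s, 0 < q s := fun s => lt_of_lt_of_le (by linarith) (hqlow s)
  set β : ℝ → ℝ := fun s => (Real.sqrt (q s))⁻¹ with hβ
  have hβ2 : ∀ s, β s ^ 2 = (q s)⁻¹ := by
    intro s; simp only [hβ, inv_pow, Real.sq_sqrt (hqpos s).le]
  have hqd : ContDiff ℝ 1 q := by simp only [hq]; fun_prop
  have hβd : ContDiff ℝ 1 β := by
    refine ContDiff.inv (ContDiff.sqrt hqd fun s => (hqpos s).ne') fun s => ?_
    exact (Real.sqrt_pos.2 (hqpos s)).ne'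
  set u : ℝ → ι → ℝ := fun s i => β s * (x.1 i + s * (y.1 i - x.1 i)) with hu
  have hud : ∀ i, ContDiff ℝ 1 fun s => u s i := by intro i; simp only [hu]; fun_prop
  have hus : ∀ s, ∑ i, u s i ^ 2 = 1 := by
    intro s
    simp only [hu, mul_pow, ← Finset.mul_sum]
    have := chord_norm x y s
    rw [EuclideanSpace.norm_sq_eq] at this
    simp only [chord_apply, Real.norm_eq_abs, sq_abs] at this
    rw [this, hβ2]
    exact inv_mul_cancel₀ (hqpos s).ne'
  have hgam : ∀ s, (fun i => (gam (x, (y, s))).1 i) = u s := by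
    intro s
    have hn : ‖chord x y s‖ = Real.sqrt (q s) := by
      rw [← Real.sqrt_sq (norm_nonneg (chord x y s)), chord_norm]
    have h0 : chord x y s ≠ 0 := by
      rw [← norm_ne_zero_iff, hn]; exact (Real.sqrt_pos.2 (hqpos s)).ne'
    funext i
    simp only [gam, if_neg h0, PiLp.smul_apply, hn, chord_apply, smul_eq_mul, hu, hβ]
  set A : ℝ → ι → ℝ := fun s i => deriv β s * (x.1 i + s * (y.1 i - x.1 i)) + β s * (y.1 i - x.1 i) with hA
  have huA : ∀ s i, HasDerivAt (fun s => u s i) (A s i) s := by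
    intro s i
    have h1 := ((hβd.differentiable one_ne_zero) s).hasDerivAt
    have h2 : HasDerivAt (fun s => x.1 i + s * (y.1 i - x.1 i)) (y.1 i - x.1 i) s := by
      simpa using ((hasDerivAt_id s).mul_const (y.1 i - x.1 i)).const_add (x.1 i)
    exact h1.mul h2
  have huA0 : ∀ s, ∑ i, u s i * A s i = 0 := by
    intro s
    have h1 : HasDerivAt (fun s => ∑ i, u s i ^ 2) (∑ i, 2 * (u s i * A s i)) s := by
      refine HasDerivAt.fun_sum fun i _ => ?_
      have := (huA s i).pow 2
      exact this.congr_deriv (by push_cast; ring)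
    simp only [hus] at h1
    have := h1.unique (hasDerivAt_const s (1:ℝ))
    rw [← Finset.mul_sum] at this
    linarith
  have hM : ∀ s i j, |A s i * u s j - u s i * A s j| ≤ (q s)⁻¹ * (2 * ‖x.1 - y.1‖) := by
    intro s i j
    have e : A s i * u s j - u s i * A s j = β s ^ 2 * ((y.1 i - x.1 i) * x.1 j - x.1 i * (y.1 j - x.1 j)) := by
      simp only [hA, hu]; ring
    rw [e, hβ2, abs_mul, abs_of_pos (inv_pos.2 (hqpos s))]
    refine mul_le_mul_of_nonneg_left ?_ (inv_pos.2 (hqpos s)).le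
    have b : ∀ i, |y.1 i - x.1 i| ≤ ‖x.1 - y.1‖ := by
      intro i
      have := PiLp.norm_apply_le (x.1 - y.1) i
      rwa [PiLp.sub_apply, Real.norm_eq_abs, abs_sub_comm] at this
    calc _ ≤ |(y.1 i - x.1 i) * x.1 j| + |x.1 i * (y.1 j - x.1 j)| := abs_sub _ _
      _ ≤ ‖x.1 - y.1‖ * 1 + 1 * ‖x.1 - y.1‖ := by
        rw [abs_mul, abs_mul]
        gcongr
        · exact b i
        · exact Sp.abs_coord_le x j
        · exact Sp.abs_coord_le x i
        · exact b j
      _ = _ := by ring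
  set G : ℝ → ℝ := fun s => eval (u s) P with hG
  have hGd : ContDiff ℝ 1 G := by
    have : ∀ R : MvPolynomial ι ℝ, ContDiff ℝ 1 fun s => eval (u s) R := by
      intro R
      induction R using MvPolynomial.induction_on with
      | C c => simpa using contDiff_const
      | add P Q hP hQ => simp only [map_add]; exact hP.add hQ
      | mul_X P k hP => simp only [map_mul, eval_X]; exact hP.mul (hud k)
    exact this P
  have hG' : ∀ s, |deriv G s| ≤ (q s)⁻¹ * ‖x.1 - y.1‖ * Hsum P (gam (x,(y,s))) := by
    intro s
    rw [(eval_deriv P u (A s) s (huA s)).deriv, tang_id (u s) (A s) _ (hus s) (huA0 s), sum_pr _ (by intro i; ring),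
      abs_mul, abs_of_pos (by norm_num : (0:ℝ) < 1/2), Hsum_apply]
    calc _ ≤ 1/2 * ∑ a : Pr ι, (q s)⁻¹ * (2 * ‖x.1 - y.1‖) * |toC (Dp a P) (gam (x,(y,s)))| := by
          gcongr
          refine (Finset.abs_sum_le_sum_abs _ _).trans (Finset.sum_le_sum fun a _ => ?_)
          rw [abs_mul, toC_apply, hgam, Dp_apply, map_sub, map_mul, map_mul, eval_X, eval_X]
          exact mul_le_mul_of_nonneg_right (hM s _ _) (abs_nonneg _)
      _ = _ := by rw [← Finset.mul_sum]; ring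
  have key := enorm_sub_le_lintegral_deriv_of_contDiffOn_Icc hGd.contDiffOn (zero_le_one (α := ℝ))
  have hG0 : G 0 = toC P x := by
    rw [toC_apply]; simp only [hG, hu, hβ, hq]; congr 2; funext i; simp
  have hG1 : G 1 = toC P y := by
    rw [toC_apply]; simp only [hG, hu, hβ, hq]; congr 2; funext i; simp
  rw [hG0, hG1] at key
  rw [enorm_sub_rev]
  calc _ ≤ ENNReal.ofReal (1/2 * (1 + ip x y)) * ∫⁻ s in Set.Icc (0:ℝ) 1, ‖deriv G s‖ₑ := by gcongr
    _ = ∫⁻ s in Set.Icc (0:ℝ) 1, ENNReal.ofReal (1/2 * (1 + ip x y)) * ‖deriv G s‖ₑ :=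
        (lintegral_const_mul' _ _ ENNReal.ofReal_ne_top).symm
    _ ≤ ∫⁻ s in Set.Icc (0:ℝ) 1, ENNReal.ofReal ‖x.1 - y.1‖ * ‖Hsum P (gam (x, (y, s)))‖ₑ := by
        refine lintegral_mono fun s => ?_
        have hH : 0 ≤ Hsum P (gam (x,(y,s))) := by
          rw [Hsum_apply]; exact Finset.sum_nonneg fun _ _ => abs_nonneg _
        rw [Real.enorm_eq_ofReal_abs, Real.enorm_eq_ofReal_abs, ← ENNReal.ofReal_mul (by linarith),
          ← ENNReal.ofReal_mul (norm_nonneg _), abs_of_nonneg hH]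
        refine ENNReal.ofReal_le_ofReal ?_
        calc _ ≤ q s * ((q s)⁻¹ * ‖x.1 - y.1‖ * Hsum P (gam (x,(y,s)))) :=
              mul_le_mul (hqlow s) (hG' s) (abs_nonneg _) (hqpos s).le
          _ = _ := by have := (hqpos s).ne'; field_simp
    _ = _ := lintegral_const_mul' _ _ ENNReal.ofReal_ne_top

variable (σ : Measure (Sp ι)) [IsProbabilityMeasure σ] [σ.IsOpenPosMeasure] [RotInv σ] (p : ℝ≥0∞) [hp : Fact (1 ≤ p)]
  [Nontrivial ι]

def kap : Measure ℝ := volume.restrict (Set.Icc (0:ℝ) 1)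
instance : IsProbabilityMeasure kap := ⟨by simp [kap]⟩

def wk (k : ℕ) (q : Sp ι × (Sp ι × ℝ)) : ℝ≥0∞ := ENNReal.ofReal (‖q.1.1 - q.2.1.1‖ * |K0 σ k q.1 q.2.1|)

lemma wk_meas (k : ℕ) : Measurable (wk σ k) := by
  have h0 : Continuous fun q : Sp ι × (Sp ι × ℝ) => (q.1, q.2.1) := by fun_prop
  have hKc := (K0_cont σ k).comp h0
  simp only [Function.comp_def] at hKc
  have : Continuous fun q : Sp ι × (Sp ι × ℝ) => ‖q.1.1 - q.2.1.1‖ * |K0 σ k q.1 q.2.1| :=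
      (by fun_prop : Continuous fun q : Sp ι × (Sp ι × ℝ) => ‖q.1.1 - q.2.1.1‖).mul hKc.abs
  exact this.measurable.ennreal_ofReal

lemma wk_act (k : ℕ) (h : Eu ι ≃ₗᵢ[ℝ] Eu ι) (x y : Sp ι) (s : ℝ) :
    wk σ k (act h x, (act h y, s)) = wk σ k (x, (y, s)) := by
  simp only [wk, K0_act, act_coe, ← map_sub, LinearIsometryEquiv.norm_map]

lemma wk_int {C : ℝ} {k : ℕ} {x : Sp ι} (hb : ∫ y, ‖x.1 - y.1‖ * |K0 σ k x y| ∂σ ≤ C) :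
    ∫⁻ y, wk σ k (x,y) ∂(σ.prod kap) ≤ ENNReal.ofReal C := by
  have hm : Measurable fun y => wk σ k (x, y) := (wk_meas σ k).comp measurable_prodMk_left
  have hc : Continuous fun y : Sp ι => ‖x.1 - y.1‖ * |K0 σ k x y| := by fun_prop
  rw [lintegral_prod _ hm.aemeasurable]
  simp only [wk, lintegral_const, measure_univ, mul_one]
  rw [← ofReal_integral_eq_lintegral_ofReal (integrable_cont σ hc) (Filter.Eventually.of_forall fun y => by positivity)]
  exact ENNReal.ofReal_le_ofReal hb

lemma jack_pt (k : ℕ) (P : MvPolynomial ι ℝ) (x : Sp ι) :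
    ‖(toC P - V σ k (toC P)) x‖ₑ ≤ ∫⁻ y, wk σ k (x,y) * ‖Hsum P (gam (x,y))‖ₑ ∂(σ.prod kap) := by
  have hone : ∫ y, KK σ k x y ∂σ = 1 := by
    have := congrArg (fun f : C(Sp ι, ℝ) => f x) (V_rep σ (one_mem_Pol (ι := ι) k))
    simpa [V_apply] using this
  have e : (toC P - V σ k (toC P)) x = ∫ y, KK σ k x y * (toC P x - toC P y) ∂σ := by
    simp only [mul_sub]
    rw [integral_sub (integrable_cont σ (by fun_prop)) (integrable_cont σ (by fun_prop)),
      integral_mul_const, hone, one_mul, ContinuousMap.sub_apply, V_apply]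
  have hm : Measurable fun y => wk σ k (x, y) * ‖Hsum P (gam (x, y))‖ₑ :=
    ((wk_meas σ k).mul ((Hsum P).continuous.measurable.comp gam_meas).enorm).comp measurable_prodMk_left
  rw [e, lintegral_prod _ hm.aemeasurable]
  refine (enorm_integral_le_lintegral_enorm _).trans (lintegral_mono fun y => ?_)
  have hk : ∀ s, wk σ k (x, (y, s)) = ENNReal.ofReal |K0 σ k x y| * ENNReal.ofReal ‖x.1 - y.1‖ := by
    intro s; simp only [wk]; rw [mul_comm, ENNReal.ofReal_mul (abs_nonneg _)]
  simp only [hk]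
  rw [lintegral_const_mul' _ _ (ENNReal.mul_ne_top ENNReal.ofReal_ne_top ENNReal.ofReal_ne_top), mul_assoc]
  calc ‖KK σ k x y * (toC P x - toC P y)‖ₑ
      = ENNReal.ofReal |K0 σ k x y| * (ENNReal.ofReal (1/2 * (1 + ip x y)) * ‖toC P x - toC P y‖ₑ) := by
        have := le_ip x y
        rw [enorm_mul, KK_apply, enorm_mul, Real.enorm_eq_ofReal_abs, Real.enorm_eq_ofReal_abs (1/2 * _),
          abs_of_nonneg (by linarith : 0 ≤ 1/2 * (1 + ip x y)), mul_assoc]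
    _ ≤ _ := by
        exact mul_le_mul' le_rfl (diff_bound P x y)

lemma jackson : ∃ C : ℝ, 1 ≤ C ∧ ∀ (k : ℕ) (P : MvPolynomial ι ℝ),
    nrm σ p (toC P - V σ k (toC P)) ≤ C / (LL k + 1) * ∑ a : Pr ι, nrm σ p (toC (Dp a P)) := by
  obtain ⟨C, hC, hb⟩ := kernel_bounds σ
  refine ⟨C, hC, fun k P => ?_⟩
  have hC' : 0 ≤ C / (LL k + 1) := by positivity
  have h1 : ∀ x, ∫⁻ y, wk σ k (x,y) ∂(σ.prod kap) ≤ ENNReal.ofReal (C / (LL k + 1)) := fun x =>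
    wk_int σ (hb k x).2
  have h2 := schur_inv σ kap (wk σ k) (wk_meas σ k) gam gam_meas _ ENNReal.ofReal_ne_top h1
    (wk_act σ k) gam_act
  have hsc := nrm_schur σ p (σ.prod kap) (wk σ k) (wk_meas σ k) gam gam_meas _ hC' h1 h2 _ _ (jack_pt σ k P)
  refine hsc.trans (mul_le_mul_of_nonneg_left ?_ hC')
  refine (nrm_sum σ p _ _).trans (le_of_eq (Finset.sum_congr rfl fun a _ => ?_))
  exact nrm_abs σ p _

end P4c
end BallApprox
namespace BallApprox
set_option linter.unusedSectionVars false
section P5a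
open Complex

def ee (n : ℤ) (t : ℝ) : ℂ := exp (n * I * t)

lemma ee_add (n m : ℤ) (t : ℝ) : ee n t * ee m t = ee (n + m) t := by
  rw [ee, ee, ee, ← Complex.exp_add]; congr 1; push_cast; ring

lemma ee_cont (n : ℤ) : Continuous (ee n) := by unfold ee; fun_prop

lemma ee_int (n : ℤ) : ∫ s in (0:ℝ)..(2*π), ee n s = if n = 0 then (2 * π : ℂ) else 0 := by
  unfold ee
  split_ifs with h
  · simp [h]
  · rw [integral_exp_mul_complex (by simp [h])]
    have : (n : ℂ) * I * ((2 * π : ℝ) : ℂ) = n * (2 * π * I) := by push_cast; ring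
    rw [this, Complex.exp_int_mul_two_pi_mul_I]; simp

/-- the Dirichlet-type square -/
def dk (k : ℕ) (s : ℝ) : ℂ := ∑ j ∈ range k, ee j s
def gk (k : ℕ) (s : ℝ) : ℝ := 2 * Real.sin (k * s) * Complex.normSq (dk k s)

lemma dk_cont (k : ℕ) : Continuous (dk k) := by
  unfold dk; exact continuous_finsetSum _ fun j _ => ee_cont _
lemma gk_cont (k : ℕ) : Continuous (gk k) := by
  unfold gk; exact (by fun_prop : Continuous fun s : ℝ => 2 * Real.sin (k * s)).mul (Complex.continuous_normSq.comp (dk_cont k))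

lemma normSq_dk (k : ℕ) (s : ℝ) : (Complex.normSq (dk k s) : ℂ) = ∑ l ∈ range k, ∑ j ∈ range k, ee ((j:ℤ) - l) s := by
  rw [Complex.normSq_eq_conj_mul_self, dk, map_sum, Finset.sum_mul_sum]
  refine Finset.sum_congr rfl fun l _ => Finset.sum_congr rfl fun j _ => ?_
  have : (starRingEnd ℂ) (ee l s) = ee (-l) s := by
    rw [ee, ee, ← Complex.exp_conj]; congr 1; simp
  rw [this, ee_add]; congr 1; ring

lemma two_sin (k : ℕ) (s : ℝ) : ((2 * Real.sin (k * s) : ℝ) : ℂ) = -I * (ee k s - ee (-k) s) := by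
  push_cast
  rw [Complex.sin, ee, ee]
  have h1 : ((-k : ℤ) : ℂ) * I * s = -(k * s) * I := by push_cast; ring
  have h2 : ((k : ℤ) : ℂ) * I * s = (k * s) * I := by push_cast; ring
  rw [h1, h2]; ring

lemma ee_gk (k : ℕ) (n : ℤ) (s : ℝ) : ee n s * gk k s = ∑ l ∈ range k, ∑ j ∈ range k,
    (-I * (ee (n + k + j - l) s - ee (n - k + j - l) s)) := by
  rw [gk, Complex.ofReal_mul, normSq_dk, two_sin, Finset.mul_sum, Finset.mul_sum]
  refine Finset.sum_congr rfl fun l _ => ?_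
  rw [Finset.mul_sum, Finset.mul_sum]
  refine Finset.sum_congr rfl fun j _ => ?_
  have h1 : ee (n + k + j - l) s = ee n s * (ee k s * ee (j - l) s) := by
    rw [ee_add, ee_add]; congr 1; ring
  have h2 : ee (n - k + j - l) s = ee n s * (ee (-k) s * ee (j - l) s) := by
    rw [ee_add, ee_add]; congr 1; ring
  rw [h1, h2]; ring

lemma cnt (k n : ℕ) (h : n ≤ k) : ∑ l ∈ range k, ∑ j ∈ range k, (if j + n = l + k then (1:ℂ) else 0) = n := by
  have : ∀ l ∈ range k, ∑ j ∈ range k, (if j + n = l + k then (1:ℂ) else 0) = if l < n then 1 else 0 := by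
    intro l hl
    rw [Finset.mem_range] at hl
    split_ifs with h1
    · rw [Finset.sum_eq_single (l + k - n)]
      · rw [if_pos (by omega)]
      · intro b _ hb; rw [if_neg (by omega)]
      · intro hh; rw [Finset.mem_range] at hh; omega
    · refine Finset.sum_eq_zero fun j hj => ?_
      rw [Finset.mem_range] at hj
      rw [if_neg (by omega)]
  rw [Finset.sum_congr rfl this, ← Finset.sum_filter]
  have : (range k).filter (· < n) = range n := by ext; simp; omega
  rw [this]; simp

lemma gk_rep (k : ℕ) (n : ℤ) (hn : |n| ≤ k) : ∫ s in (0:ℝ)..(2*π), ee n s * gk k s = 2 * π * (n * I) := by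
  simp only [ee_gk]
  have hi : ∀ n, IntervalIntegrable (ee n) volume 0 (2*π) := fun n => (ee_cont n).intervalIntegrable _ _
  have e : ∀ l j : ℕ, ∫ s in (0:ℝ)..(2*π), (-I * (ee (n + k + j - l) s - ee (n - k + j - l) s)) =
      2 * π * (-I * ((if n + k + j - l = 0 then (1:ℂ) else 0) - (if n - k + j - l = 0 then 1 else 0))) := by
    intro l j
    rw [intervalIntegral.integral_const_mul, intervalIntegral.integral_sub (hi _) (hi _), ee_int, ee_int]
    split_ifs <;> simp
    all_goals ring
  rw [intervalIntegral.integral_finsetSum]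
  · have e2 : ∀ l ∈ range k, ∫ s in (0:ℝ)..(2*π), ∑ j ∈ range k, (-I * (ee (n + k + j - l) s - ee (n - k + j - l) s)) =
        ∑ j ∈ range k, 2 * π * (-I * ((if n + k + j - l = 0 then (1:ℂ) else 0) - (if n - k + j - l = 0 then 1 else 0))) := by
      intro l _
      rw [intervalIntegral.integral_finsetSum]
      · exact Finset.sum_congr rfl fun j _ => e l j
      · intro j _; exact ((hi _).sub (hi _)).const_mul _
    rw [Finset.sum_congr rfl e2]
    simp only [← Finset.mul_sum, Finset.sum_sub_distrib]
    have hkey : ∑ l ∈ range k, ∑ j ∈ range k, (if n + k + j - l = 0 then (1:ℂ) else 0) -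
      ∑ l ∈ range k, ∑ j ∈ range k, (if n - k + j - l = 0 then (1:ℂ) else 0) = -n := by
      rw [abs_le] at hn
      rcases le_total 0 n with h0 | h0
      · obtain ⟨m, rfl⟩ := Int.eq_ofNat_of_zero_le h0
        have h1 : ∑ l ∈ range k, ∑ j ∈ range k, (if (m:ℤ) + k + j - l = 0 then (1:ℂ) else 0) = 0 := by
          refine Finset.sum_eq_zero fun l hl => Finset.sum_eq_zero fun j hj => ?_
          rw [Finset.mem_range] at hl
          rw [if_neg (by omega)]
        rw [h1, Int.cast_natCast, ← cnt k m (by omega), zero_sub]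
        congr 1
        refine Finset.sum_congr rfl fun l _ => Finset.sum_congr rfl fun j _ => ?_
        congr 1; rw [eq_iff_iff]; omega
      · obtain ⟨m, hm⟩ := Int.eq_ofNat_of_zero_le (neg_nonneg.2 h0)
        have : n = -(m:ℤ) := by omega
        subst this
        have h1 : ∑ l ∈ range k, ∑ j ∈ range k, (if -(m:ℤ) - k + j - l = 0 then (1:ℂ) else 0) = 0 := by
          refine Finset.sum_eq_zero fun l hl => Finset.sum_eq_zero fun j hj => ?_
          rw [Finset.mem_range] at hj
          rw [if_neg (by omega)]
        rw [h1, sub_zero, Int.cast_neg, neg_neg, Int.cast_natCast, ← cnt k m (by omega), Finset.sum_comm]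
        refine Finset.sum_congr rfl fun l _ => Finset.sum_congr rfl fun j _ => ?_
        congr 1; rw [eq_iff_iff]; omega
    rw [hkey]; ring
  · intro l _
    exact (continuous_finsetSum _ fun j _ => continuous_const.mul ((ee_cont _).sub (ee_cont _))).intervalIntegrable _ _

lemma gk_norm (k : ℕ) : ∫ s in (0:ℝ)..(2*π), |gk k s| ≤ 2 * π * (2 * k) := by
  have h1 : ∫ s in (0:ℝ)..(2*π), Complex.normSq (dk k s) = 2 * π * k := by
    have : ((∫ s in (0:ℝ)..(2*π), Complex.normSq (dk k s) : ℝ) : ℂ) = ((2 * π * k : ℝ) : ℂ) := by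
      rw [← intervalIntegral.integral_ofReal]
      simp only [normSq_dk]
      rw [intervalIntegral.integral_finsetSum]
      · have : ∀ l ∈ range k, ∫ s in (0:ℝ)..(2*π), ∑ j ∈ range k, ee ((j:ℤ) - l) s = 2 * π := by
          intro l hl
          rw [intervalIntegral.integral_finsetSum (fun j _ => (ee_cont _).intervalIntegrable _ _)]
          simp only [ee_int]
          rw [Finset.sum_eq_single l]
          · simp
          · intro b _ hb; rw [if_neg (by omega)]
          · intro h; exact absurd hl h
        rw [Finset.sum_congr rfl this]; simp; ring
      · intro l _
        exact (continuous_finsetSum _ fun j _ => ee_cont _).intervalIntegrable _ _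
    exact_mod_cast this
  have hc : Continuous fun s => Complex.normSq (dk k s) := Complex.continuous_normSq.comp (dk_cont k)
  calc ∫ s in (0:ℝ)..(2*π), |gk k s| ≤ ∫ s in (0:ℝ)..(2*π), 2 * Complex.normSq (dk k s) := by
        refine intervalIntegral.integral_mono_on (by positivity) ((gk_cont k).abs.intervalIntegrable _ _)
          ((hc.const_mul 2).intervalIntegrable _ _) fun s _ => ?_
        rw [gk, abs_mul, abs_mul, abs_two, abs_of_nonneg (Complex.normSq_nonneg _)]
        have := Real.abs_sin_le_one (k * s)
        have := Complex.normSq_nonneg (dk k s)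
        nlinarith
    _ = _ := by rw [intervalIntegral.integral_const_mul, h1]; ring

/-- trigonometric polynomials -/
def TP (k : ℕ) : Submodule ℂ (ℝ → ℂ) := Submodule.span ℂ {f | ∃ n : ℤ, |n| ≤ k ∧ f = ee n}

lemma ee_mem {k : ℕ} {n : ℤ} (h : |n| ≤ k) : ee n ∈ TP k := Submodule.subset_span ⟨n, h, rfl⟩

lemma TP_mono {j k : ℕ} (h : j ≤ k) : TP j ≤ TP k :=
  Submodule.span_mono fun f ⟨n, hn, e⟩ => ⟨n, hn.trans (by exact_mod_cast h), e⟩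

lemma TP_mul {j k : ℕ} {f g : ℝ → ℂ} (hf : f ∈ TP j) (hg : g ∈ TP k) : f * g ∈ TP (j + k) := by
  refine Submodule.span_induction (p := fun f _ => f * g ∈ TP (j+k)) ?_ ?_ ?_ ?_ hf
  · rintro f ⟨n, hn, rfl⟩
    refine Submodule.span_induction (p := fun g _ => ee n * g ∈ TP (j+k)) ?_ ?_ ?_ ?_ hg
    · rintro f ⟨m, hm, rfl⟩
      have : ee n * ee m = ee (n + m) := by funext t; exact ee_add n m t
      rw [this]
      exact ee_mem ((abs_add_le n m).trans (by push_cast; linarith))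
    · simp
    · intro f g _ _ h1 h2; rw [mul_add]; exact Submodule.add_mem _ h1 h2
    · intro c f _ h; rw [mul_smul_comm]; exact Submodule.smul_mem _ _ h
  · simp
  · intro f g _ _ h1 h2; rw [add_mul]; exact Submodule.add_mem _ h1 h2
  · intro c f _ h; rw [smul_mul_assoc]; exact Submodule.smul_mem _ _ h

lemma TP_const (k : ℕ) (c : ℂ) : (fun _ => c) ∈ TP k := by
  have : (fun _ => c) = c • ee 0 := by funext t; simp [ee]
  rw [this]; exact Submodule.smul_mem _ _ (ee_mem (by simp))

lemma TP_cos : (fun t : ℝ => (Real.cos t : ℂ)) ∈ TP 1 := by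
  have : (fun t : ℝ => (Real.cos t : ℂ)) = (1/2 : ℂ) • ee 1 + (1/2 : ℂ) • ee (-1) := by
    funext t; simp [ee, Complex.cos]; ring_nf
  rw [this]; exact Submodule.add_mem _ (Submodule.smul_mem _ _ (ee_mem (by simp))) (Submodule.smul_mem _ _ (ee_mem (by simp)))

lemma TP_sin : (fun t : ℝ => (Real.sin t : ℂ)) ∈ TP 1 := by
  have : (fun t : ℝ => (Real.sin t : ℂ)) = (-I/2 : ℂ) • ee 1 + (I/2 : ℂ) • ee (-1) := by
    funext t; simp [ee, Complex.sin]; ring_nf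
  rw [this]; exact Submodule.add_mem _ (Submodule.smul_mem _ _ (ee_mem (by simp))) (Submodule.smul_mem _ _ (ee_mem (by simp)))

lemma TP_deriv {k : ℕ} {T : ℝ → ℂ} (hT : T ∈ TP k) : Continuous T ∧
    HasDerivAt T ((2 * π : ℂ)⁻¹ * ∫ s in (0:ℝ)..(2*π), T s * gk k s) 0 := by
  have hg : Continuous fun s => (gk k s : ℂ) := Complex.continuous_ofReal.comp (gk_cont k)
  refine Submodule.span_induction (p := fun (T : ℝ → ℂ) _ => Continuous T ∧
    HasDerivAt T ((2 * π : ℂ)⁻¹ * ∫ s in (0:ℝ)..(2*π), T s * gk k s) 0) ?_ ?_ ?_ ?_ hT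
  · rintro f ⟨n, hn, rfl⟩
    refine ⟨ee_cont n, ?_⟩
    rw [gk_rep k n hn, inv_mul_cancel_left₀ (by simp [Real.pi_ne_zero])]
    have h1 : HasDerivAt (fun t : ℝ => (n : ℂ) * I * (t : ℂ)) (n * I) 0 := by
      simpa using (Complex.ofRealCLM.hasDerivAt (x := (0:ℝ))).const_mul ((n : ℂ) * I)
    have := h1.cexp
    simp only [Complex.ofReal_zero, mul_zero, Complex.exp_zero, one_mul] at this
    exact this
  · exact ⟨continuous_zero, by simpa using hasDerivAt_const (0:ℝ) (0:ℂ)⟩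
  · rintro f g _ _ ⟨h1, h1'⟩ ⟨h2, h2'⟩
    refine ⟨h1.add h2, (h1'.add h2').congr_deriv ?_⟩
    simp only [Pi.add_apply, add_mul]
    have i1 : IntervalIntegrable (fun s => f s * (gk k s : ℂ)) volume 0 (2*π) := (h1.mul hg).intervalIntegrable _ _
    have i2 : IntervalIntegrable (fun s => g s * (gk k s : ℂ)) volume 0 (2*π) := (h2.mul hg).intervalIntegrable _ _
    rw [intervalIntegral.integral_add i1 i2, mul_add]
  · rintro c f _ ⟨h1, h1'⟩
    refine ⟨h1.const_smul c, (h1'.const_smul c).congr_deriv ?_⟩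
    simp only [Pi.smul_apply, smul_eq_mul, mul_assoc]
    rw [intervalIntegral.integral_const_mul]; ring

end P5a

section P5b
variable {ι : Type} [Fintype ι] [DecidableEq ι]

lemma TP_flow_coord (a : Pr ι) (x : Sp ι) (i : ι) : (fun t : ℝ => (((fl a t x).1 i : ℝ) : ℂ)) ∈ TP 1 := by
  simp only [fl_coe]
  by_cases h1 : i = a.1.1
  · subst h1
    simp only [rotFun_fst]
    have : (fun t : ℝ => ((Real.cos t * x.1 a.1.1 + Real.sin t * x.1 a.1.2 : ℝ) : ℂ)) =
      (x.1 a.1.1 : ℂ) • (fun t : ℝ => (Real.cos t : ℂ)) + (x.1 a.1.2 : ℂ) • (fun t : ℝ => (Real.sin t : ℂ)) := by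
      funext t; simp [mul_comm]
    rw [this]
    exact Submodule.add_mem _ (Submodule.smul_mem _ _ TP_cos) (Submodule.smul_mem _ _ TP_sin)
  · by_cases h2 : i = a.1.2
    · subst h2
      simp only [rotFun_snd]
      have : (fun t : ℝ => ((Real.cos t * x.1 a.1.2 - Real.sin t * x.1 a.1.1 : ℝ) : ℂ)) =
        (x.1 a.1.2 : ℂ) • (fun t : ℝ => (Real.cos t : ℂ)) - (x.1 a.1.1 : ℂ) • (fun t : ℝ => (Real.sin t : ℂ)) := by
        funext t; simp [mul_comm]
      rw [this]
      exact Submodule.sub_mem _ (Submodule.smul_mem _ _ TP_cos) (Submodule.smul_mem _ _ TP_sin)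
    · simp only [rotFun_other a _ _ h1 h2]
      exact TP_const _ _

open MvPolynomial in
lemma TP_flow (a : Pr ι) (x : Sp ι) {P : MvPolynomial ι ℝ} {k : ℕ} (hP : P.totalDegree ≤ k) :
    (fun t : ℝ => ((toC P (fl a t x) : ℝ) : ℂ)) ∈ TP k := by
  have hpow : ∀ (i : ι) (e : ℕ), (fun t : ℝ => (((fl a t x).1 i : ℝ) : ℂ) ^ e) ∈ TP e := by
    intro i e
    induction e with
    | zero => simpa using TP_const 0 1
    | succ e ih =>
      have := TP_mul ih (TP_flow_coord a x i)
      exact this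
  have hprod : ∀ (s : ι →₀ ℕ) (S : Finset ι),
      (fun t : ℝ => ∏ i ∈ S, (((fl a t x).1 i : ℝ) : ℂ) ^ s i) ∈ TP (∑ i ∈ S, s i) := by
    intro s S
    induction S using Finset.induction_on with
    | empty => simpa using TP_const 0 1
    | insert i S hi ih =>
      simp only [Finset.prod_insert hi, Finset.sum_insert hi]
      exact TP_mul (hpow i (s i)) ih
  have e : (fun t : ℝ => ((toC P (fl a t x) : ℝ) : ℂ)) =
      ∑ s ∈ P.support, ((coeff s P : ℝ) : ℂ) • fun t : ℝ => ∏ i ∈ s.support, (((fl a t x).1 i : ℝ) : ℂ) ^ s i := by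
    funext t
    rw [toC_apply, MvPolynomial.eval_eq]
    simp [Finset.sum_apply]
  rw [e]
  refine Submodule.sum_mem _ fun s hs => Submodule.smul_mem _ _ (TP_mono ?_ (hprod s _))
  exact (le_totalDegree hs).trans hP

lemma bern_rep (a : Pr ι) (x : Sp ι) {P : MvPolynomial ι ℝ} {k : ℕ} (hP : P.totalDegree ≤ k) :
    toC (Dp a P) x = (2 * π)⁻¹ * ∫ s in (0:ℝ)..(2*π), toC P (fl a s x) * gk k s := by
  have h1 := (TP_deriv (TP_flow a x hP)).2
  have h2 := (flow_toC a P x 0)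
  rw [fl_zero] at h2
  have h3 := h1.unique h2.ofReal_comp
  have : (((2 * π)⁻¹ * ∫ s in (0:ℝ)..(2*π), toC P (fl a s x) * gk k s : ℝ) : ℂ) = ((toC (Dp a P) x : ℝ) : ℂ) := by
    rw [← h3]
    push_cast
    rw [← intervalIntegral.integral_ofReal]
    push_cast
    rfl
  exact_mod_cast this.symm

variable (σ : Measure (Sp ι)) [IsProbabilityMeasure σ] [σ.IsOpenPosMeasure] [RotInv σ] (p : ℝ≥0∞) [hp : Fact (1 ≤ p)]

lemma nrm_flow (a : Pr ι) (ν : Measure ℝ) [SFinite ν] (w : ℝ → ℝ≥0∞) (hw : Measurable w) (C : ℝ) (hC : 0 ≤ C)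
    (h1 : ∫⁻ s, w s ∂ν ≤ ENNReal.ofReal C) (F G : C(Sp ι, ℝ))
    (hFG : ∀ x, ‖F x‖ₑ ≤ ∫⁻ s, w s * ‖G (fl a s x)‖ₑ ∂ν) : nrm σ p F ≤ C * nrm σ p G := by
  have hγ0 : Measurable (fun q : ℝ × Sp ι => fl a q.1 q.2) := (fl_cont a).measurable
  have hγ : Measurable (fun q : Sp ι × ℝ => fl a q.2 q.1) := hγ0.comp measurable_swap
  refine nrm_schur σ p ν (fun q => w q.2) (hw.comp measurable_snd) (fun q => fl a q.2 q.1) hγ C hC (fun _ => h1) ?_ F G hFG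
  intro H hH
  have hm : Measurable fun q : Sp ι × ℝ => w q.2 * H (fl a q.2 q.1) := (hw.comp measurable_snd).mul (hH.comp hγ)
  rw [lintegral_lintegral_swap hm.aemeasurable]
  have e : ∀ s, ∫⁻ x, w s * H (fl a s x) ∂σ = w s * ∫⁻ x, H x ∂σ := by
    intro s
    have hf : Measurable fun x => H (fl a s x) := hH.comp (fl a s).continuous.measurable
    rw [lintegral_const_mul _ hf]
    congr 1
    exact (fl_mp σ a s).lintegral_comp hH
  simp only [e]
  rw [lintegral_mul_const _ hw]
  gcongr

lemma bernstein (a : Pr ι) {P : MvPolynomial ι ℝ} {k : ℕ} (hP : P.totalDegree ≤ k) :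
    nrm σ p (toC (Dp a P)) ≤ 2 * k * nrm σ p (toC P) := by
  have hpi : (0:ℝ) ≤ 2 * π := by positivity
  have hpi' : (0:ℝ) ≤ (2 * π)⁻¹ := by positivity
  refine nrm_flow σ p a (volume.restrict (Set.Ioc 0 (2*π))) (fun s => ENNReal.ofReal ((2*π)⁻¹ * |gk k s|)) ?_ _
    (by positivity) ?_ _ _ ?_
  · exact ((gk_cont k).abs.const_mul _).measurable.ennreal_ofReal
  · rw [← ofReal_integral_eq_lintegral_ofReal]
    · refine ENNReal.ofReal_le_ofReal ?_
      rw [← intervalIntegral.integral_of_le hpi, intervalIntegral.integral_const_mul]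
      calc _ ≤ (2 * π)⁻¹ * (2 * π * (2 * k)) := mul_le_mul_of_nonneg_left (gk_norm k) hpi'
        _ = _ := by have := Real.pi_ne_zero; field_simp
    · exact (((gk_cont k).abs.const_mul _).intervalIntegrable 0 (2*π)).1
    · exact Filter.Eventually.of_forall fun s => by positivity
  · intro x
    rw [bern_rep a x hP, intervalIntegral.integral_of_le hpi, ← integral_const_mul]
    refine (enorm_integral_le_lintegral_enorm _).trans (le_of_eq (lintegral_congr fun s => ?_))
    rw [enorm_mul, enorm_mul, Real.enorm_of_nonneg hpi', ENNReal.ofReal_mul hpi', ← Real.enorm_eq_ofReal_abs]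
    ring

lemma poincare {a : Pr ι} {F F' F'' : C(Sp ι, ℝ)} (h : FlowD a F F') (h' : FlowD a F' F'') :
    nrm σ p F' ≤ 2 * π * nrm σ p F'' := by
  have hpi : (0:ℝ) < 2 * π := by positivity
  refine nrm_flow σ p a (volume.restrict (Set.Icc 0 (2*π))) (fun s => 1) measurable_const _ hpi.le ?_ _ _ ?_
  · simp
  · intro x
    have hfc : Continuous fun t => fl a t x := by
      have h0 : Continuous fun t : ℝ => (t, x) := by fun_prop
      exact (fl_cont a).comp h0
    obtain ⟨s, hs, hs0⟩ := exists_hasDerivAt_eq_zero (f := fun t => F (fl a t x)) (f' := fun t => F' (fl a t x))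
      hpi (F.continuous.comp hfc).continuousOn (by
        have := fl_two_pi a 0 x
        simp only [zero_add] at this
        rw [this]) (fun t _ => h x t)
    have hd : ContDiff ℝ 1 fun t => F' (fl a t x) := by
      rw [contDiff_one_iff_deriv]
      refine ⟨fun t => (h' x t).differentiableAt, ?_⟩
      have : deriv (fun t => F' (fl a t x)) = fun t => F'' (fl a t x) := funext fun t => (h' x t).deriv
      rw [this]; exact F''.continuous.comp hfc
    have key := enorm_sub_le_lintegral_deriv_of_contDiffOn_Icc hd.contDiffOn hs.1.le
    rw [hs0, fl_zero, zero_sub, enorm_neg] at key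
    refine key.trans ?_
    simp only [(h' x _).deriv, one_mul]
    exact lintegral_mono_set (Set.Icc_subset_Icc_right hs.2.le)

end P5b
end BallApprox
namespace BallApprox
set_option linter.unusedSectionVars false
section P6a
variable {ι : Type} [Fintype ι] [DecidableEq ι]

open MvPolynomial in
def Eij (i j : ι) : Derivation ℝ (MvPolynomial ι ℝ) (MvPolynomial ι ℝ) :=
  (X j : MvPolynomial ι ℝ) • pderiv i - (X i : MvPolynomial ι ℝ) • pderiv j

lemma Dp_eq (a : Pr ι) : Dp a = Eij a.1.1 a.1.2 := rfl

def kd (i j : ι) : ℝ := if i = j then 1 else 0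
lemma kd_comm (i j : ι) : kd i j = kd j i := by simp [kd, eq_comm]
lemma kd_abs (i j : ι) : |kd i j| ≤ 1 := by unfold kd; split_ifs <;> simp

open MvPolynomial in
lemma Eij_X (i j m : ι) : Eij i j (X m) = kd i m • X j - kd j m • (X i : MvPolynomial ι ℝ) := by
  have : Eij i j (X m) = X j * pderiv i (X m) - X i * pderiv j (X m) := rfl
  rw [this, pderiv_X, pderiv_X, Pi.single_apply, Pi.single_apply, kd, kd]
  simp only [eq_comm (a := m)]
  split_ifs <;> simp

open MvPolynomial in
lemma Eij_comm (i j k l : ι) (P : MvPolynomial ι ℝ) : Eij i j (Eij k l P) - Eij k l (Eij i j P) =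
    kd i l • Eij k j P - kd j l • Eij k i P - kd i k • Eij l j P + kd j k • Eij l i P := by
  have h : ⁅Eij i j, Eij k l⁆ = kd i l • Eij k j - kd j l • Eij k i
      - kd i k • Eij l j + kd j k • Eij (ι := ι) l i := by
    refine MvPolynomial.derivation_ext fun m => ?_
    rw [Derivation.commutator_apply]
    simp only [Derivation.add_apply, Derivation.sub_apply, Derivation.smul_apply, Eij_X, map_sub, Derivation.map_smul]
    rw [kd_comm k j, kd_comm l j, kd_comm k i, kd_comm l i]
    module
  have := congrArg (fun D : Derivation ℝ (MvPolynomial ι ℝ) (MvPolynomial ι ℝ) => D P) h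
  simp only [Derivation.commutator_apply, Derivation.add_apply, Derivation.sub_apply, Derivation.smul_apply] at this
  exact this

/-- iterated operators along a word -/
def DW : List (Pr ι) → MvPolynomial ι ℝ → MvPolynomial ι ℝ
  | [], P => P
  | a :: w, P => Dp a (DW w P)

lemma DW_append (u v : List (Pr ι)) (P : MvPolynomial ι ℝ) : DW (u ++ v) P = DW u (DW v P) := by
  induction u with
  | nil => rfl
  | cons a u ih => simp only [List.cons_append, DW, ih]

lemma DW_replicate (a : Pr ι) (r : ℕ) (P : MvPolynomial ι ℝ) : DW (List.replicate r a) P = (Dp a)^[r] P := by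
  induction r with
  | zero => rfl
  | succ r ih => rw [List.replicate_succ, DW, ih, Function.iterate_succ_apply']

lemma DW_deg (w : List (Pr ι)) (P : MvPolynomial ι ℝ) : (DW w P).totalDegree ≤ P.totalDegree := by
  induction w with
  | nil => rfl
  | cons a w ih => exact (Dp_deg _ _).trans ih

variable (σ : Measure (Sp ι)) [IsProbabilityMeasure σ] [σ.IsOpenPosMeasure] [RotInv σ] (p : ℝ≥0∞) [hp : Fact (1 ≤ p)]

lemma DW_bern (w : List (Pr ι)) {P : MvPolynomial ι ℝ} {K : ℕ} (hP : P.totalDegree ≤ K) :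
    nrm σ p (toC (DW w P)) ≤ (2 * K) ^ w.length * nrm σ p (toC P) := by
  induction w with
  | nil => simp [DW]
  | cons a w ih =>
    refine (bernstein σ p a ((DW_deg w P).trans hP)).trans ?_
    rw [List.length_cons, pow_succ', mul_assoc (2 * (K:ℝ)) (_ ^ _)]
    exact mul_le_mul_of_nonneg_left ih (by positivity)

lemma Eij_bern (i j : ι) {P : MvPolynomial ι ℝ} {K : ℕ} (hP : P.totalDegree ≤ K) :
    nrm σ p (toC (Eij i j P)) ≤ 2 * K * nrm σ p (toC P) := by
  by_cases h : i = j
  · subst h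
    have : Eij i i P = 0 := by simp [Eij]
    rw [this, map_zero, nrm_zero]
    exact mul_nonneg (by positivity) (nrm_nonneg σ p _)
  · exact bernstein σ p (⟨(i, j), h⟩ : Pr ι) hP

lemma comm_bern (a b : Pr ι) {P : MvPolynomial ι ℝ} {K : ℕ} (hP : P.totalDegree ≤ K) :
    nrm σ p (toC (Dp a (Dp b P)) - toC (Dp b (Dp a P))) ≤ 4 * (2 * K * nrm σ p (toC P)) := by
  rw [← map_sub, Dp_eq, Dp_eq, Eij_comm]
  have hb : ∀ (i j k l : ι), nrm σ p (toC (kd i j • Eij k l P)) ≤ 2 * K * nrm σ p (toC P) := by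
    intro i j k l
    rw [map_smul, nrm_smul]
    have := Eij_bern σ p k l hP
    have h0 := nrm_nonneg σ p (toC (Eij k l P))
    have h1 := kd_abs i j
    nlinarith
  rw [map_add, map_sub, map_sub]
  refine (nrm_add σ p _ _).trans ?_
  have h1 := nrm_sub σ p (toC (kd a.1.1 b.1.2 • Eij b.1.1 a.1.2 P) - toC (kd a.1.2 b.1.2 • Eij b.1.1 a.1.1 P))
    (toC (kd a.1.1 b.1.1 • Eij b.1.2 a.1.2 P))
  have h2 := nrm_sub σ p (toC (kd a.1.1 b.1.2 • Eij b.1.1 a.1.2 P)) (toC (kd a.1.2 b.1.2 • Eij b.1.1 a.1.1 P))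
  have := hb a.1.1 b.1.2 b.1.1 a.1.2
  have := hb a.1.2 b.1.2 b.1.1 a.1.1
  have := hb a.1.1 b.1.1 b.1.2 a.1.2
  have := hb a.1.2 b.1.1 b.1.2 a.1.1
  linarith

lemma perm_bern {w w' : List (Pr ι)} (h : w.Perm w') : ∃ C : ℝ, 0 ≤ C ∧ ∀ (K : ℕ) (P : MvPolynomial ι ℝ), P.totalDegree ≤ K →
    2 * K * nrm σ p (toC (DW w P) - toC (DW w' P)) ≤ C * ((2 * K) ^ w.length * nrm σ p (toC P)) := by
  induction h with
  | nil => exact ⟨0, le_rfl, fun K P _ => by simp [nrm_zero]⟩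
  | @cons x l₁ l₂ _ ih =>
    obtain ⟨C, hC, h⟩ := ih
    refine ⟨C, hC, fun K P hP => ?_⟩
    have h1 := h K P hP
    have h2 := bernstein σ p x (P := DW l₁ P - DW l₂ P) (k := K)
      ((MvPolynomial.totalDegree_sub _ _).trans (max_le ((DW_deg _ _).trans hP) ((DW_deg _ _).trans hP)))
    simp only [map_sub] at h2
    simp only [DW, List.length_cons]
    have hK : (0:ℝ) ≤ 2 * K := by positivity
    calc _ ≤ 2 * K * (2 * K * nrm σ p (toC (DW l₁ P) - toC (DW l₂ P))) := by gcongr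
      _ ≤ 2 * K * (C * ((2 * K) ^ l₁.length * nrm σ p (toC P))) := by gcongr
      _ = _ := by rw [pow_succ]; ring
  | swap x y l =>
    refine ⟨4, by norm_num, fun K P hP => ?_⟩
    have h1 := comm_bern σ p y x (P := DW l P) ((DW_deg _ _).trans hP)
    have h2 := DW_bern σ p l hP
    simp only [DW, List.length_cons]
    calc _ ≤ 2 * K * (4 * (2 * K * nrm σ p (toC (DW l P)))) := by gcongr
      _ ≤ 2 * K * (4 * (2 * K * ((2 * K) ^ l.length * nrm σ p (toC P)))) := by gcongr
      _ = _ := by rw [pow_succ, pow_succ]; ring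
  | @trans l₁ l₂ l₃ h₁ _ ih₁ ih₂ =>
    obtain ⟨C₁, hC₁, h1⟩ := ih₁
    obtain ⟨C₂, hC₂, h2⟩ := ih₂
    refine ⟨C₁ + C₂, add_nonneg hC₁ hC₂, fun K P hP => ?_⟩
    have a1 := h1 K P hP
    have a2 := h2 K P hP
    rw [← h₁.length_eq] at a2
    have h3 := nrm_add σ p (toC (DW l₁ P) - toC (DW l₂ P)) (toC (DW l₂ P) - toC (DW l₃ P))
    rw [sub_add_sub_cancel] at h3
    have hK : (0:ℝ) ≤ 2 * K := by positivity
    nlinarith [mul_le_mul_of_nonneg_left h3 hK]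

lemma word_bound (S r : ℕ) : ∃ C : ℝ, 0 ≤ C ∧ ∀ (w : List (Pr ι)) (a : Pr ι), w.length = S → r ≤ w.count a →
    ∀ (K : ℕ) (P : MvPolynomial ι ℝ), P.totalDegree ≤ K →
    2 * K * nrm σ p (toC (DW w P)) ≤ C * ((2 * K) ^ S * nrm σ p (toC P)) +
      2 * K * ((2*K)^(S - r) * nrm σ p (toC ((Dp a)^[r] P))) := by
  have hperm : ∀ (w : List (Pr ι)) (a : Pr ι), w.Perm (w.filter (fun b => !(b == a)) ++ List.replicate (w.count a) a) := by
    intro w a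
    refine ((List.filter_append_perm (fun b => b == a) w).symm.trans List.perm_append_comm).trans ?_
    rw [List.filter_beq]
  choose C hC hb using fun q : List (Pr ι) × Pr ι => perm_bern σ p (hperm q.1 q.2)
  have hfin : Set.Finite ((({w : List (Pr ι) | w.length = S} : Set (List (Pr ι))) ×ˢ (Set.univ : Set (Pr ι)))) :=
    (List.finite_length_eq _ S).prod Set.finite_univ
  obtain ⟨M, hM⟩ := (hfin.image C).bddAbove
  refine ⟨max M 0, le_max_right _ _, fun w a hw hr K P hP => ?_⟩
  have h1 := hb (w, a) K P hP
  have h2 : C (w, a) ≤ max M 0 := (hM ⟨(w, a), ⟨hw, trivial⟩, rfl⟩).trans (le_max_left _ _)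
  set w' := w.filter (fun b => !(b == a)) ++ List.replicate (w.count a) a with hw'
  have e : w' = (w.filter (fun b => !(b == a)) ++ List.replicate (w.count a - r) a) ++ List.replicate r a := by
    rw [hw', List.append_assoc, List.replicate_append_replicate, Nat.sub_add_cancel hr]
  have hl : (w.filter (fun b => !(b == a)) ++ List.replicate (w.count a - r) a).length = S - r := by
    have h3 := (hperm w a).length_eq
    rw [← hw', e, List.length_append, hw, List.length_replicate] at h3
    omega
  have h4 : nrm σ p (toC (DW w' P)) ≤ (2*K)^(S-r) * nrm σ p (toC ((Dp a)^[r] P)) := by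
    rw [e, DW_append, DW_replicate, ← hl]
    refine DW_bern σ p _ ?_
    rw [← DW_replicate]; exact (DW_deg _ _).trans hP
  have h5 := nrm_add σ p (toC (DW w P) - toC (DW w' P)) (toC (DW w' P))
  rw [sub_add_cancel] at h5
  have hK : (0:ℝ) ≤ 2 * K := by positivity
  have h6 : 2 * K * nrm σ p (toC (DW w P) - toC (DW w' P)) ≤ max M 0 * ((2 * K) ^ S * nrm σ p (toC P)) := by
    rw [hw] at h1
    refine h1.trans (mul_le_mul_of_nonneg_right h2 (mul_nonneg (by positivity) (nrm_nonneg σ p _)))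
  nlinarith [mul_le_mul_of_nonneg_left h5 hK, mul_le_mul_of_nonneg_left h4 hK]

lemma pigeon (w : List (Pr ι)) (r : ℕ) (hr : 1 ≤ r) [Nonempty (Pr ι)] (hw : w.length = Fintype.card (Pr ι) * r) :
    ∃ a, r ≤ w.count a := by
  by_contra! h
  have h1 := Multiset.sum_count_eq_card (s := Finset.univ) (m := (w : Multiset (Pr ι))) (by simp)
  simp only [Multiset.coe_count, Multiset.coe_card] at h1
  have h2 : ∑ a : Pr ι, w.count a < ∑ a : Pr ι, r := Finset.sum_lt_sum_of_nonempty Finset.univ_nonempty fun a _ => h a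
  have h3 : ∑ a : Pr ι, w.count a = w.length := by
    rw [← h1]; refine Finset.sum_congr rfl fun a _ => ?_; congr!
  rw [h3, hw] at h2
  simp at h2

end P6a
end BallApprox
namespace BallApprox
set_option linter.unusedSectionVars false
section P6b
variable {ι : Type} [Fintype ι] [DecidableEq ι]
variable (σ : Measure (Sp ι)) [IsProbabilityMeasure σ] [σ.IsOpenPosMeasure] [RotInv σ] (p : ℝ≥0∞) [hp : Fact (1 ≤ p)]
variable [Nontrivial ι]

instance : Nonempty (Pr ι) := by
  obtain ⟨a, b, h⟩ := exists_pair_ne ι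
  exact ⟨⟨(a, b), h⟩⟩

lemma V_Dp {k : ℕ} {P : MvPolynomial ι ℝ} (h : V σ k (toC P) = 0) (a : Pr ι) : V σ k (toC (Dp a P)) = 0 := by
  have h1 := (flow_toC a P).V σ k
  have h2 := ((flow_toC a (0 : MvPolynomial ι ℝ)))
  rw [h] at h1
  simp only [map_zero] at h2
  exact h1.unique h2

lemma jackson' : ∃ A : ℝ, 1 ≤ A ∧ ∀ (k : ℕ) (P : MvPolynomial ι ℝ), V σ k (toC P) = 0 → ∀ B : ℝ,
    (∀ a, nrm σ p (toC (Dp a P)) ≤ B) → nrm σ p (toC P) ≤ A / (k + 1) * B := by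
  obtain ⟨C, hC, hJ⟩ := jackson (ι := ι) σ p
  have hcard : (1:ℝ) ≤ Fintype.card (Pr ι) := by exact_mod_cast Fintype.card_pos
  refine ⟨6 * C * Fintype.card (Pr ι), by nlinarith, fun k P hV B hB => ?_⟩
  have h1 := hJ k P
  rw [hV, sub_zero] at h1
  have hB0 : 0 ≤ B := (nrm_nonneg σ p _).trans (hB (Classical.arbitrary _))
  have hL : ((k:ℝ) + 1) ≤ 6 * (LL k + 1) := by
    have : k + 1 ≤ 6 * (LL k + 1) := by unfold LL; omega
    exact_mod_cast this
  have h2 : ∑ a : Pr ι, nrm σ p (toC (Dp a P)) ≤ Fintype.card (Pr ι) * B := by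
    refine (Finset.sum_le_sum fun a _ => hB a).trans ?_
    simp
  have h3 : C / (LL k + 1) ≤ 6 * C / (k + 1) := by
    rw [div_le_div_iff₀ (by positivity) (by positivity)]
    nlinarith
  calc _ ≤ C / (LL k + 1) * ∑ a : Pr ι, nrm σ p (toC (Dp a P)) := h1
    _ ≤ 6 * C / (k + 1) * (Fintype.card (Pr ι) * B) := mul_le_mul h3 h2 (Finset.sum_nonneg fun a _ => nrm_nonneg σ p _) (by positivity)
    _ = _ := by ring

lemma poinc_iter (a : Pr ι) (P : MvPolynomial ι ℝ) (r : ℕ) :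
    nrm σ p (toC (Dp a P)) ≤ (2 * π) ^ r * nrm σ p (toC ((Dp a)^[r+1] P)) := by
  induction r with
  | zero => simp
  | succ r ih =>
    refine ih.trans ?_
    have h1 := flow_toC a ((Dp a)^[r] P)
    have h2 := flow_toC a (Dp a ((Dp a)^[r] P))
    have h3 := poincare σ p h1 h2
    rw [Function.iterate_succ_apply', Function.iterate_succ_apply', Function.iterate_succ_apply', pow_succ, mul_assoc ((2*π)^r)]
    exact mul_le_mul_of_nonneg_left h3 (by positivity)

lemma lemmaJ (C0 : ℕ) (hC0 : 1 ≤ C0) (r : ℕ) (hr : 1 ≤ r) : ∃ c : ℝ, 0 ≤ c ∧ ∀ (k : ℕ) (P : MvPolynomial ι ℝ),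
    P.totalDegree ≤ C0 * (k + 1) → V σ k (toC P) = 0 → ∀ B : ℝ,
    (∀ a, nrm σ p (toC ((Dp a)^[r] P)) ≤ B) → nrm σ p (toC P) * (k + 1) ^ r ≤ c * B := by
  obtain ⟨A, hA, hJ⟩ := jackson' (ι := ι) σ p
  set S := Fintype.card (Pr ι) * r with hS
  have hrS : r ≤ S := Nat.le_mul_of_pos_left r Fintype.card_pos
  obtain ⟨C, hC, hW⟩ := word_bound (ι := ι) σ p S r
  have iter : ∀ (k s : ℕ) (P : MvPolynomial ι ℝ), V σ k (toC P) = 0 → ∀ B : ℝ,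
      (∀ w : List (Pr ι), w.length = s → nrm σ p (toC (DW w P)) ≤ B) → nrm σ p (toC P) ≤ (A / (k + 1)) ^ s * B := by
    intro k s
    induction s with
    | zero => intro P _ B hB; have := hB [] rfl; simpa [DW] using this
    | succ s ih =>
      intro P hV B hB
      rw [pow_succ', mul_assoc]
      refine hJ k P hV _ fun a => ih (Dp a P) (V_Dp σ hV a) B fun w hw => ?_
      have := hB (w ++ [a]) (by simp [hw])
      rwa [DW_append] at this
  set c3 : ℝ := A ^ S * (C * (2 * C0) ^ (S - 1)) with hc3
  set c2 : ℝ := A ^ S * (2 * C0) ^ (S - r) with hc2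
  have hc3' : 0 ≤ c3 := by positivity
  have hc2' : 0 ≤ c2 := by positivity
  refine ⟨2 * c2 + (2 * c3) ^ r * (A * (2 * π) ^ (r - 1)), by positivity, fun k P hdeg hV B hB => ?_⟩
  have hB0 : 0 ≤ B := (nrm_nonneg σ p _).trans (hB (Classical.arbitrary _))
  set T : ℝ := (k : ℝ) + 1 with hT
  have hT1 : 1 ≤ T := by rw [hT]; linarith [(Nat.cast_nonneg k : (0:ℝ) ≤ k)]
  set N := nrm σ p (toC P) with hN
  have hN0 : 0 ≤ N := nrm_nonneg σ p _
  rcases le_or_gt (2 * c3) T with h | h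
  · have key : N ≤ (A / T) ^ S * (C * (2 * C0 * T) ^ (S - 1) * N + (2 * C0 * T) ^ (S - r) * B) := by
      refine iter k S P hV _ fun w hw => ?_
      obtain ⟨a, ha⟩ := pigeon w r hr (hw.trans hS)
      have h1 := hW w a hw ha _ P hdeg
      have e : 2 * ((C0 * (k + 1) : ℕ) : ℝ) = 2 * C0 * T := by rw [hT]; push_cast; ring
      rw [e] at h1
      have hK : 0 < 2 * C0 * T := by positivity
      have e2 : (2 * C0 * T) ^ S = (2 * C0 * T) * (2 * C0 * T) ^ (S - 1) := by
        rw [← pow_succ', Nat.sub_add_cancel (hr.trans hrS)]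
      have h2 : (2 * C0 * T) ^ (S - r) * nrm σ p (toC ((Dp a)^[r] P)) ≤ (2 * C0 * T) ^ (S - r) * B :=
        mul_le_mul_of_nonneg_left (hB a) (by positivity)
      refine le_of_mul_le_mul_left ?_ hK
      calc _ ≤ _ := h1
        _ = 2 * C0 * T * (C * (2 * C0 * T) ^ (S - 1) * N + (2 * C0 * T) ^ (S - r) * nrm σ p (toC ((Dp a)^[r] P))) := by
          rw [e2]; ring
        _ ≤ _ := mul_le_mul_of_nonneg_left (by linarith) hK.le
    have hTS : T ^ S = T ^ (S - r) * T ^ r := by rw [← pow_add, Nat.sub_add_cancel hrS]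
    have hTS1 : T ^ S = T ^ (S - 1) * T := by rw [← pow_succ, Nat.sub_add_cancel (hr.trans hrS)]
    have e3 : (A / T) ^ S * (C * (2 * C0 * T) ^ (S - 1) * N + (2 * C0 * T) ^ (S - r) * B)
        = c3 / T * N + c2 * B / T ^ r := by
      have hT0 : T ≠ 0 := by positivity
      rw [hc3, hc2, mul_pow (2 * (C0:ℝ)) T, mul_pow (2 * (C0:ℝ)) T, div_pow, mul_add]
      congr 1
      · rw [hTS1]; field_simp
      · rw [hTS]; field_simp
    rw [e3] at key
    have h4 : c3 / T ≤ 1 / 2 := by rw [div_le_div_iff₀ (by positivity) (by norm_num)]; linarith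
    have h5 : N ≤ 2 * (c2 * B / T ^ r) := by nlinarith
    have hTr : 0 < T ^ r := by positivity
    calc N * T ^ r ≤ 2 * (c2 * B / T ^ r) * T ^ r := by gcongr
      _ = 2 * c2 * B := by field_simp
      _ ≤ _ := by
        refine mul_le_mul_of_nonneg_right ?_ hB0
        have : 0 ≤ (2 * c3) ^ r * (A * (2 * π) ^ (r - 1)) := by positivity
        linarith
  · have h1 : N ≤ A / T * ((2 * π) ^ (r - 1) * B) := by
      refine hJ k P hV _ fun a => ?_
      have := poinc_iter σ p a P (r - 1)
      rw [Nat.sub_add_cancel hr] at this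
      exact this.trans (mul_le_mul_of_nonneg_left (hB a) (by positivity))
    have h2 : A / T ≤ A := div_le_self (by linarith) hT1
    have h3 : T ^ r ≤ (2 * c3) ^ r := pow_le_pow_left₀ (by linarith) h.le r
    calc N * T ^ r ≤ (A * ((2 * π) ^ (r - 1) * B)) * (2 * c3) ^ r := by
          refine mul_le_mul (h1.trans (mul_le_mul_of_nonneg_right h2 (by positivity))) h3 (by positivity) (by positivity)
      _ = (2 * c3) ^ r * (A * (2 * π) ^ (r - 1)) * B := by ring
      _ ≤ _ := by
        refine mul_le_mul_of_nonneg_right ?_ hB0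
        linarith

lemma V_conv (F : C(Sp ι, ℝ)) (ε : ℝ) (hε : 0 < ε) : ∃ N0, ∀ N, N0 ≤ N → nrm σ p (F - V σ N F) ≤ ε := by
  obtain ⟨C, hC, hV⟩ := V_bound (ι := ι) σ p
  obtain ⟨Q, hQ⟩ := dense_poly F (ε / (1 + C)) (by positivity)
  refine ⟨Q.totalDegree, fun N hN => ?_⟩
  have h1 : nrm σ p (F - toC Q) ≤ ε / (1 + C) := nrm_le_sup σ p (by positivity) fun x => (hQ x).le
  have h2 : F - V σ N F = (F - toC Q) - V σ N (F - toC Q) := by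
    rw [map_sub, V_rep σ (toC_mem hN)]; abel
  rw [h2]
  refine (nrm_sub σ p _ _).trans ?_
  have h3 := hV N (F - toC Q)
  have h4 : (1 + C) * (ε / (1 + C)) = ε := by field_simp
  nlinarith

lemma flow_iter {a : Pr ι} {G : ℕ → C(Sp ι, ℝ)} {P : MvPolynomial ι ℝ} {r N N' : ℕ} (hG : ∀ j < r, FlowD a (G j) (G (j+1)))
    (h0 : toC P = V σ N' (G 0) - V σ N (G 0)) : ∀ j ≤ r, toC ((Dp a)^[j] P) = V σ N' (G j) - V σ N (G j) := by
  intro j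
  induction j with
  | zero => intro _; exact h0
  | succ j ih =>
    intro hj
    have h1 := flow_toC a ((Dp a)^[j] P)
    rw [ih (by omega)] at h1
    rw [Function.iterate_succ_apply']
    exact h1.unique (((hG j hj).V σ N').sub ((hG j hj).V σ N))

theorem sphere_main (r : ℕ) (hr : 1 ≤ r) : ∃ c : ℝ, 0 ≤ c ∧ ∀ (n : ℕ), 2 ≤ n → ∀ (F : C(Sp ι, ℝ)) (G : Pr ι → ℕ → C(Sp ι, ℝ)),
    (∀ a, G a 0 = F) → (∀ a, ∀ j < r, FlowD a (G a j) (G a (j+1))) → ∀ B : ℝ,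
    (∀ a, ∃ g ∈ Pol ι n, nrm σ p (G a r - g) ≤ B) → nrm σ p (F - V σ n F) * n ^ r ≤ c * B := by
  obtain ⟨C, hC, hV⟩ := V_bound (ι := ι) σ p
  obtain ⟨c, hc, hJ⟩ := lemmaJ (ι := ι) σ p 27 (by norm_num) r hr
  set D := 3 ^ r * (c * (2 * C)) with hD
  have hD0 : 0 ≤ D := by positivity
  refine ⟨2 * D, by positivity, fun n hn F G hG0 hG B hB => ?_⟩
  have hB0 : 0 ≤ B := by
    obtain ⟨g, _, h⟩ := hB (Classical.arbitrary _)
    exact (nrm_nonneg σ p _).trans h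
  have hn0 : (0:ℝ) < (n:ℝ) ^ r := by positivity
  have step : ∀ N, n ≤ N → nrm σ p (V σ (4 * N) F - V σ N F) * (N:ℝ) ^ r ≤ D * B := by
    intro N hN
    obtain ⟨P, hP, hPe⟩ := mem_Pol.1 ((Pol ι (9 * N)).sub_mem (Pol_mono (by omega) (V_mem' σ (n := 4 * N) F))
      (Pol_mono (by omega) (V_mem' σ (n := N) F)))
    have h1 := hJ (N / 2 - 1) P (by omega) (by
      rw [hPe, map_sub, V_comp σ (by omega), V_comp σ (by omega), sub_self]) (2 * C * B) (fun a => by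
        have h0 : toC P = V σ (4 * N) (G a 0) - V σ N (G a 0) := by rw [hG0, hPe]
        rw [flow_iter σ (hG a) h0 r le_rfl]
        obtain ⟨g, hg, hgB⟩ := hB a
        have e : V σ (4 * N) (G a r) - V σ N (G a r) = V σ (4 * N) (G a r - g) - V σ N (G a r - g) := by
          rw [map_sub, map_sub, V_rep σ (Pol_mono hN hg), V_rep σ (Pol_mono (by omega) hg)]; abel
        rw [e]
        refine (nrm_sub σ p _ _).trans ?_
        have := hV (4 * N) (G a r - g)
        have := hV N (G a r - g)
        nlinarith)
    rw [hPe] at h1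
    have h2 : (N:ℝ) ≤ 3 * (((N / 2 - 1 : ℕ) : ℝ) + 1) := by
      have : N ≤ 3 * ((N / 2 - 1) + 1) := by omega
      exact_mod_cast this
    have h3 : (N:ℝ) ^ r ≤ 3 ^ r * (((N / 2 - 1 : ℕ) : ℝ) + 1) ^ r := by
      rw [← mul_pow]; exact pow_le_pow_left₀ (by positivity) h2 r
    calc _ ≤ nrm σ p (V σ (4 * N) F - V σ N F) * (3 ^ r * (((N / 2 - 1 : ℕ) : ℝ) + 1) ^ r) :=
          mul_le_mul_of_nonneg_left h3 (nrm_nonneg σ p _)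
      _ = 3 ^ r * (nrm σ p (V σ (4 * N) F - V σ N F) * (((N / 2 - 1 : ℕ) : ℝ) + 1) ^ r) := by ring
      _ ≤ 3 ^ r * (c * (2 * C * B)) := by gcongr
      _ = _ := by rw [hD]; ring
  have tele : ∀ J : ℕ, nrm σ p (V σ (4 ^ J * n) F - V σ n F) * (n:ℝ) ^ r ≤ D * B * (2 - 2 * (1/4) ^ J) := by
    intro J
    induction J with
    | zero => simp [nrm_zero]
    | succ J ih =>
      have h1 := step (4 ^ J * n) (Nat.le_mul_of_pos_left n (by positivity))
      rw [← mul_assoc, ← pow_succ', Nat.cast_mul, mul_pow] at h1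
      have h2 : nrm σ p (V σ (4 ^ (J + 1) * n) F - V σ (4 ^ J * n) F) * (n:ℝ) ^ r ≤ D * B * (1/4) ^ J := by
        have h3 : (4:ℝ) ^ J ≤ ((4 ^ J : ℕ) : ℝ) ^ r := by
          push_cast
          exact le_self_pow₀ (one_le_pow₀ (by norm_num)) (by omega)
        have h4 : nrm σ p (V σ (4 ^ (J + 1) * n) F - V σ (4 ^ J * n) F) * (4 ^ J * (n:ℝ) ^ r) ≤ D * B :=
          le_trans (mul_le_mul_of_nonneg_left (mul_le_mul_of_nonneg_right h3 hn0.le) (nrm_nonneg σ p _)) h1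
        have h5 : (0:ℝ) < 4 ^ J := by positivity
        rw [one_div, inv_pow, ← div_eq_mul_inv, le_div_iff₀ h5]
        linarith
      have h6 := nrm_add σ p (V σ (4 ^ (J + 1) * n) F - V σ (4 ^ J * n) F) (V σ (4 ^ J * n) F - V σ n F)
      rw [sub_add_sub_cancel] at h6
      have h7 : (0:ℝ) ≤ D * B * (1/4) ^ J := by positivity
      have h8 := mul_le_mul_of_nonneg_right h6 hn0.le
      rw [pow_succ (1/4:ℝ)]
      nlinarith
  refine le_of_forall_pos_le_add fun ε hε => ?_
  obtain ⟨N0, hN0⟩ := V_conv σ p F (ε / (n:ℝ) ^ r) (by positivity)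
  have h1 := hN0 (4 ^ N0 * n) (by
    have : N0 < 4 ^ N0 := Nat.lt_pow_self (by norm_num)
    nlinarith)
  have h2 := nrm_add σ p (F - V σ (4 ^ N0 * n) F) (V σ (4 ^ N0 * n) F - V σ n F)
  rw [sub_add_sub_cancel] at h2
  have h3 := mul_le_mul_of_nonneg_right h2 hn0.le
  have h4 := mul_le_mul_of_nonneg_right h1 hn0.le
  rw [div_mul_cancel₀ _ hn0.ne'] at h4
  have h5 := tele N0
  have h6 : (0:ℝ) ≤ D * B * (1/4) ^ N0 := by positivity
  nlinarith
end P6b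
end BallApprox
namespace BallApprox
set_option linter.unusedSectionVars false
section P7a
open scoped Pointwise
variable {ι : Type} [Fintype ι]

def sT (ι : Type) [Fintype ι] : Measure (Sp ι) := (volume : Measure (Eu ι)).toSphere

lemma sT_mp (h : Eu ι ≃ₗᵢ[ℝ] Eu ι) : MeasurePreserving (act h) (sT ι) (sT ι) := by
  refine ⟨(act h).continuous.measurable, ?_⟩
  ext s hs
  rw [Measure.map_apply (act h).continuous.measurable hs, sT, Measure.toSphere_apply' _ hs,
    Measure.toSphere_apply' _ ((act h).continuous.measurable hs)]
  congr 1
  have e : Set.Ioo (0 : ℝ) 1 • (((↑) : Sp ι → Eu ι) '' (act h ⁻¹' s)) = h ⁻¹' (Set.Ioo (0 : ℝ) 1 • (((↑) : Sp ι → Eu ι) '' s)) := by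
    ext z
    simp only [Set.mem_smul, Set.mem_image, Set.mem_preimage]
    constructor
    · rintro ⟨r, hr, _, ⟨x, hx, rfl⟩, rfl⟩
      exact ⟨r, hr, _, ⟨act h x, hx, rfl⟩, by simp⟩
    · rintro ⟨r, hr, _, ⟨x, hx, rfl⟩, hz⟩
      refine ⟨r, hr, _, ⟨act h.symm x, by rwa [act_act_symm], rfl⟩, ?_⟩
      apply h.injective
      rw [← hz]; simp
  rw [e]
  exact h.measurePreserving.measure_preimage_equiv (f := h.toMeasurableEquiv) _

def sg (ι : Type) [Fintype ι] : Measure (Sp ι) := (sT ι Set.univ)⁻¹ • sT ι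

lemma sT_ne_zero [Nonempty ι] : sT ι Set.univ ≠ 0 := by
  have : sT ι ≠ 0 := Measure.toSphere_ne_zero _
  simpa using this
lemma sT_ne_top : sT ι Set.univ ≠ ∞ := by
  have : IsFiniteMeasure (sT ι) := by unfold sT; infer_instance
  exact measure_ne_top _ _

instance [Nonempty ι] : IsProbabilityMeasure (sg ι) :=
  ⟨by rw [sg, Measure.smul_apply, smul_eq_mul, ENNReal.inv_mul_cancel sT_ne_zero sT_ne_top]⟩
instance : (sg ι).IsOpenPosMeasure := by
  have : (sT ι).IsOpenPosMeasure := by unfold sT; infer_instance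
  exact Measure.isOpenPosMeasure_smul _ (ENNReal.inv_ne_zero.2 sT_ne_top)
instance : RotInv (sg ι) := ⟨fun h => (sT_mp h).smul_measure _⟩
end P7a

section P7b
variable {α β : Type} [Fintype α] [Fintype β]

def spl (u : Eu α) (v : Eu β) : Eu (α ⊕ β) := WithLp.toLp 2 (Sum.elim (fun i => u i) (fun i => v i))
def prj (z : Eu (α ⊕ β)) : Eu α := WithLp.toLp 2 (fun i => z (Sum.inl i))
def prk (z : Eu (α ⊕ β)) : Eu β := WithLp.toLp 2 (fun i => z (Sum.inr i))

@[simp] lemma prj_apply (z : Eu (α ⊕ β)) (i : α) : prj z i = z (Sum.inl i) := rfl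
@[simp] lemma prk_apply (z : Eu (α ⊕ β)) (i : β) : prk z i = z (Sum.inr i) := rfl
@[simp] lemma spl_inl (u : Eu α) (v : Eu β) (i : α) : spl u v (Sum.inl i) = u i := rfl
@[simp] lemma spl_inr (u : Eu α) (v : Eu β) (i : β) : spl u v (Sum.inr i) = v i := rfl
@[simp] lemma prj_spl (u : Eu α) (v : Eu β) : prj (spl u v) = u := rfl
@[simp] lemma prk_spl (u : Eu α) (v : Eu β) : prk (spl u v) = v := rfl
lemma spl_pr (z : Eu (α ⊕ β)) : spl (prj z) (prk z) = z := by
  ext i; cases i <;> rfl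

lemma norm_spl (u : Eu α) (v : Eu β) : ‖spl u v‖ ^ 2 = ‖u‖ ^ 2 + ‖v‖ ^ 2 := by
  simp [EuclideanSpace.norm_sq_eq, Fintype.sum_sum_type]

@[fun_prop] lemma prj_cont : Continuous (prj (α := α) (β := β)) := by unfold prj; fun_prop
@[fun_prop] lemma prk_cont : Continuous (prk (α := α) (β := β)) := by unfold prk; fun_prop
lemma spl_cont : Continuous (fun q : Eu α × Eu β => spl q.1 q.2) := by
  unfold spl
  apply (PiLp.continuous_toLp 2 _).comp
  apply continuous_pi
  intro i; cases i <;> simp <;> fun_prop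

lemma vol_split (H : Eu (α ⊕ β) → ℝ≥0∞) (hH : Measurable H) : ∫⁻ z, H z = ∫⁻ u, ∫⁻ v, H (spl u v) := by
  have h1 := (PiLp.volume_preserving_toLp (α ⊕ β)).lintegral_comp hH
  have h2 := (volume_measurePreserving_sumPiEquivProdPi_symm (fun _ : α ⊕ β => ℝ)).lintegral_comp
    (hH.comp (PiLp.volume_preserving_toLp (α ⊕ β)).measurable)
  have hm : Measurable fun q : Eu α × Eu β => H (spl q.1 q.2) := hH.comp spl_cont.measurable
  have h3 := ((PiLp.volume_preserving_toLp α).prod (PiLp.volume_preserving_toLp β)).lintegral_comp hm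
  rw [← h1]
  simp only [Function.comp_def] at h2
  rw [← h2, ← lintegral_prod _ hm.aemeasurable]
  refine Eq.trans ?_ h3
  refine lintegral_congr fun q => ?_
  congr 1

lemma radial [Nonempty β] (g : ℝ → ℝ≥0∞) (hg : Measurable g) : ∫⁻ v : Eu β, g ‖v‖ =
    sT β Set.univ * ∫⁻ ρ in Set.Ioi (0:ℝ), ENNReal.ofReal (ρ ^ (Fintype.card β - 1)) * g ρ := by
  have h1 := (volume : Measure (Eu β)).measurePreserving_homeomorphUnitSphereProd.lintegral_comp
    (f := fun q => g q.2.1) (by fun_prop)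
  have h2 : ∫⁻ v : Eu β, g ‖v‖ = ∫⁻ v : ({0}ᶜ : Set (Eu β)), g ‖v.1‖ ∂(volume.comap Subtype.val) := by
    rw [lintegral_subtype_comap (measurableSet_singleton _).compl fun x => g ‖x‖, restrict_compl_singleton]
  rw [h2]
  simp only [homeomorphUnitSphereProd_apply_snd_coe] at h1
  rw [h1, lintegral_prod _ (by fun_prop)]
  simp only [lintegral_const]
  rw [mul_comm, sT]
  congr 1
  rw [Measure.volumeIoiPow, lintegral_withDensity_eq_lintegral_mul _ (by fun_prop) (by fun_prop), finrank_euclideanSpace]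
  exact lintegral_subtype_comap measurableSet_Ioi (fun ρ => ENNReal.ofReal (ρ ^ (Fintype.card β - 1)) * g ρ)

lemma subst_sq (a : ℝ) (ha : 0 ≤ a) (M : ℕ) (hM : 1 ≤ M) (k : ℝ → ℝ≥0∞) :
    ∫⁻ ρ in Set.Ioi (0:ℝ), ENNReal.ofReal (ρ ^ (M - 1)) * k (√(a ^ 2 + ρ ^ 2)) =
    ∫⁻ s in Set.Ioi a, ENNReal.ofReal (s * (s ^ 2 - a ^ 2) ^ (((M:ℝ) - 2) / 2)) * k s := by
  have him : (fun s => √(s ^ 2 - a ^ 2)) '' Set.Ioi a = Set.Ioi (0:ℝ) := by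
    ext ρ
    simp only [Set.mem_image, Set.mem_Ioi]
    constructor
    · rintro ⟨s, hs, rfl⟩
      exact Real.sqrt_pos.2 (by nlinarith)
    · intro hρ
      refine ⟨√(a ^ 2 + ρ ^ 2), Real.lt_sqrt_of_sq_lt (by nlinarith), ?_⟩
      rw [Real.sq_sqrt (by positivity), add_sub_cancel_left, Real.sqrt_sq hρ.le]
  have hder : ∀ s ∈ Set.Ioi a, HasDerivWithinAt (fun s => √(s ^ 2 - a ^ 2)) (s / √(s ^ 2 - a ^ 2)) (Set.Ioi a) s := by
    intro s hs
    have hs' : a < s := hs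
    have h1 : HasDerivAt (fun s : ℝ => s ^ 2 - a ^ 2) (2 * s) s := by
      simpa using (hasDerivAt_pow 2 s).sub_const (a ^ 2)
    have := h1.sqrt (ne_of_gt (by nlinarith))
    rw [mul_div_mul_left _ _ two_ne_zero] at this
    exact this.hasDerivWithinAt
  have hinj : Set.InjOn (fun s => √(s ^ 2 - a ^ 2)) (Set.Ioi a) := by
    intro s hs t ht h
    have hs' : a < s := hs
    have ht' : a < t := ht
    have h2 : s ^ 2 - a ^ 2 = t ^ 2 - a ^ 2 := (Real.sqrt_inj (by nlinarith) (by nlinarith)).1 h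
    nlinarith
  rw [← him, lintegral_image_eq_lintegral_abs_deriv_mul measurableSet_Ioi hder hinj]
  refine setLIntegral_congr_fun measurableSet_Ioi fun s hs => ?_
  have hs' : a < s := hs
  have hs0 : 0 < s := ha.trans_lt hs'
  have hp : 0 < s ^ 2 - a ^ 2 := by nlinarith
  have hq : 0 < √(s ^ 2 - a ^ 2) := Real.sqrt_pos.2 hp
  rw [← mul_assoc, ← ENNReal.ofReal_mul (abs_nonneg _), Real.sq_sqrt hp.le, add_sub_cancel, Real.sqrt_sq hs0.le,
    abs_of_nonneg (by positivity)]
  congr 2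
  have e : (s ^ 2 - a ^ 2) ^ (((M:ℝ) - 2) / 2) = √(s ^ 2 - a ^ 2) ^ ((M:ℝ) - 2) := by
    rw [Real.sqrt_eq_rpow, ← Real.rpow_mul hp.le]; congr 1; ring
  have e2 : √(s ^ 2 - a ^ 2) ^ (M - 1) = √(s ^ 2 - a ^ 2) ^ ((M:ℝ) - 1) := by
    rw [← Real.rpow_natCast, Nat.cast_sub hM, Nat.cast_one]
  rw [e, e2, div_mul_eq_mul_div, mul_div_assoc]
  congr 1
  rw [← Real.rpow_sub_one hq.ne']; congr 1; ring

open scoped Pointwise in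
lemma cone_iff (A : Set (Eu α)) (z : Eu (α ⊕ β)) : z ∈ Set.Ioo (0 : ℝ) 1 • (((↑) : Sp (α ⊕ β) → Eu (α ⊕ β)) '' {x | prj x.1 ∈ A}) ↔
    (0 < ‖z‖ ∧ ‖z‖ < 1) ∧ ‖z‖⁻¹ • prj z ∈ A := by
  have hsm : ∀ (c : ℝ) (z : Eu (α ⊕ β)), prj (c • z) = c • prj z := fun c z => rfl
  simp only [Set.mem_smul, Set.mem_image]
  constructor
  · rintro ⟨r, hr, _, ⟨x, hx, rfl⟩, rfl⟩
    rw [norm_smul, Sp.norm_eq, mul_one, Real.norm_of_nonneg hr.1.le, hsm, inv_smul_smul₀ hr.1.ne']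
    exact ⟨hr, hx⟩
  · rintro ⟨h1, h2⟩
    refine ⟨‖z‖, h1, ‖z‖⁻¹ • z, ⟨⟨‖z‖⁻¹ • z, ?_⟩, ?_, rfl⟩, ?_⟩
    · simp [norm_smul, h1.1.ne']
    · exact h2
    · rw [smul_inv_smul₀ h1.1.ne']

/-- the integrand after splitting -/
def kfun (A : Set (Eu α)) (u : Eu α) (s : ℝ) : ℝ≥0∞ :=
  Set.indicator {q : Eu α × ℝ | (0 < q.2 ∧ q.2 < 1) ∧ q.2⁻¹ • q.1 ∈ A} 1 (u, s)

lemma kfun_meas {A : Set (Eu α)} (hA : MeasurableSet A) : Measurable fun q : Eu α × ℝ => kfun A q.1 q.2 := by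
  unfold kfun
  refine Measurable.indicator measurable_const ?_
  have h1 : MeasurableSet {q : Eu α × ℝ | 0 < q.2 ∧ q.2 < 1} :=
    (measurableSet_lt measurable_const measurable_snd).inter (measurableSet_lt measurable_snd measurable_const)
  have h2 : Measurable fun q : Eu α × ℝ => q.2⁻¹ • q.1 := by fun_prop
  exact h1.inter (h2 hA)

open scoped Pointwise in
lemma cone_vol [Nonempty β] {A : Set (Eu α)} (hA : MeasurableSet A) :
    sT (α ⊕ β) {x | prj x.1 ∈ A} = Fintype.card (α ⊕ β) * (sT β Set.univ * ∫⁻ u : Eu α, ∫⁻ s in Set.Ioi ‖u‖,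
      ENNReal.ofReal (s * (s ^ 2 - ‖u‖ ^ 2) ^ (((Fintype.card β:ℝ) - 2) / 2)) * kfun A u s) := by
  have hm : MeasurableSet {x : Sp (α ⊕ β) | prj x.1 ∈ A} := (prj_cont.comp continuous_subtype_val).measurable hA
  rw [sT, Measure.toSphere_apply' _ hm, finrank_euclideanSpace]
  congr 1
  have hk := kfun_meas hA
  have e : ∀ z : Eu (α ⊕ β), Set.indicator (Set.Ioo (0 : ℝ) 1 • (((↑) : Sp (α ⊕ β) → Eu (α ⊕ β)) '' {x | prj x.1 ∈ A})) 1 z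
      = kfun A (prj z) ‖z‖ := by
    intro z
    by_cases h : (0 < ‖z‖ ∧ ‖z‖ < 1) ∧ ‖z‖⁻¹ • prj z ∈ A
    · rw [Set.indicator_of_mem ((cone_iff A z).2 h), kfun, Set.indicator_of_mem (by exact h)]; rfl
    · rw [Set.indicator_of_notMem (fun h' => h ((cone_iff A z).1 h')), kfun, Set.indicator_of_notMem (by exact h)]
  have hmz : Measurable fun z : Eu (α ⊕ β) => kfun A (prj z) ‖z‖ := by
    have h0 : Measurable fun z : Eu (α ⊕ β) => (prj z, ‖z‖) := prj_cont.measurable.prodMk measurable_norm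
    exact hk.comp h0
  have hms : MeasurableSet (Set.Ioo (0 : ℝ) 1 • (((↑) : Sp (α ⊕ β) → Eu (α ⊕ β)) '' {x | prj x.1 ∈ A})) := by
    have : (Set.Ioo (0 : ℝ) 1 • (((↑) : Sp (α ⊕ β) → Eu (α ⊕ β)) '' {x | prj x.1 ∈ A})) = {z | kfun A (prj z) ‖z‖ = 1} := by
      ext z
      change _ ↔ kfun A (prj z) ‖z‖ = 1
      rw [← e z]
      generalize (Set.Ioo (0 : ℝ) 1 • (((↑) : Sp (α ⊕ β) → Eu (α ⊕ β)) '' {x | prj x.1 ∈ A})) = W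
      by_cases h : z ∈ W <;> simp [h]
    rw [this]
    exact hmz (measurableSet_singleton _)
  rw [← lintegral_indicator_one hms, lintegral_congr e, vol_split _ hmz]
  have hrad : ∀ u : Eu α, ∫⁻ v : Eu β, kfun A (prj (spl u v)) ‖spl u v‖ = sT β Set.univ * ∫⁻ s in Set.Ioi ‖u‖,
      ENNReal.ofReal (s * (s ^ 2 - ‖u‖ ^ 2) ^ (((Fintype.card β:ℝ) - 2) / 2)) * kfun A u s := by
    intro u
    have hku : Measurable (kfun A u) := hk.comp (by fun_prop : Measurable fun s : ℝ => (u, s))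
    rw [← subst_sq ‖u‖ (norm_nonneg _) _ Fintype.card_pos, ← radial (fun ρ => kfun A u (√(‖u‖ ^ 2 + ρ ^ 2))) (by fun_prop)]
    refine lintegral_congr fun v => ?_
    rw [← norm_spl, Real.sqrt_sq (norm_nonneg _), prj_spl]
  rw [lintegral_congr hrad, lintegral_const_mul' _ _ sT_ne_top]

/-- radial constant -/
def Qc (d M : ℕ) : ℝ≥0∞ := ∫⁻ s in Set.Ioo (0:ℝ) 1, ENNReal.ofReal (s ^ d * (s * (s ^ 2) ^ (((M:ℝ) - 2) / 2)))

lemma Qc_ne (d M : ℕ) (hM : 1 ≤ M) : Qc d M ≠ 0 ∧ Qc d M ≠ ∞ := by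
  have hpos : ∀ s ∈ Set.Ioo (0:ℝ) 1, 0 < s ^ d * (s * (s ^ 2) ^ (((M:ℝ) - 2) / 2)) := fun s hs => by
    have := hs.1; positivity
  have hm : Measurable fun s : ℝ => ENNReal.ofReal (s ^ d * (s * (s ^ 2) ^ (((M:ℝ) - 2) / 2))) := by fun_prop
  constructor
  · refine ne_of_gt ?_
    rw [Qc, setLIntegral_pos_iff hm]
    refine lt_of_lt_of_le ?_ (measure_mono (show Set.Ioo (0:ℝ) 1 ⊆ _ from fun s hs => ⟨?_, hs⟩))
    · simp
    · simpa using hpos s hs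
  · have : Qc d M ≤ ∫⁻ s in Set.Ioo (0:ℝ) 1, 1 := by
      refine setLIntegral_mono measurable_const fun s hs => ?_
      rw [ENNReal.ofReal_le_one]
      have h1 : s * (s ^ 2) ^ (((M:ℝ) - 2) / 2) = s ^ ((M:ℝ) - 1) := by
        rw [← Real.rpow_natCast s 2, ← Real.rpow_mul hs.1.le]
        nth_rewrite 1 [← Real.rpow_one s]
        rw [← Real.rpow_add hs.1]; congr 1; push_cast; ring
      rw [h1]
      have hM' : (1:ℝ) ≤ M := by exact_mod_cast hM
      exact mul_le_one₀ (pow_le_one₀ hs.1.le hs.2.le) (Real.rpow_nonneg hs.1.le _)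
        (Real.rpow_le_one hs.1.le hs.2.le (by linarith))
    refine ne_top_of_le_ne_top ?_ this
    simp

lemma lint_scale (G : Eu α → ℝ≥0∞) (hG : Measurable G) {s : ℝ} (hs : 0 < s) :
    ∫⁻ u, G u = ENNReal.ofReal (s ^ Fintype.card α) * ∫⁻ x, G (s • x) := by
  have h1 : ∫⁻ x, G (s • x) = ∫⁻ u, G u ∂(Measure.map (s • ·) (volume : Measure (Eu α))) :=
    (lintegral_map hG (by fun_prop)).symm
  rw [h1, Measure.map_addHaar_smul _ hs.ne', lintegral_smul_measure, finrank_euclideanSpace, smul_eq_mul, ← mul_assoc,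
    ← ENNReal.ofReal_mul (by positivity), abs_of_pos (by positivity), mul_inv_cancel₀ (by positivity), ENNReal.ofReal_one, one_mul]

lemma cone_vol' {A : Set (Eu α)} (hA : MeasurableSet A) (M : ℕ) :
    ∫⁻ u : Eu α, ∫⁻ s in Set.Ioi ‖u‖, ENNReal.ofReal (s * (s ^ 2 - ‖u‖ ^ 2) ^ (((M:ℝ) - 2) / 2)) * kfun A u s
    = Qc (Fintype.card α) M * ∫⁻ x in ball (0 : Eu α) 1, ENNReal.ofReal ((1 - ‖x‖ ^ 2) ^ (((M:ℝ) - 2) / 2)) * Set.indicator A 1 x := by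
  set γ := ((M:ℝ) - 2) / 2 with hγ
  have hk := kfun_meas hA
  have hset : MeasurableSet {q : Eu α × ℝ | ‖q.1‖ < q.2} := measurableSet_lt (by fun_prop) (by fun_prop)
  have hm : Measurable fun q : Eu α × ℝ => Set.indicator {q : Eu α × ℝ | ‖q.1‖ < q.2}
      (fun q => ENNReal.ofReal (q.2 * (q.2 ^ 2 - ‖q.1‖ ^ 2) ^ γ) * kfun A q.1 q.2) q := by
    refine Measurable.indicator ?_ hset
    exact Measurable.mul (by fun_prop) hk
  have e1 : ∀ u : Eu α, ∫⁻ s in Set.Ioi ‖u‖, ENNReal.ofReal (s * (s ^ 2 - ‖u‖ ^ 2) ^ γ) * kfun A u s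
      = ∫⁻ s, Set.indicator {q : Eu α × ℝ | ‖q.1‖ < q.2}
      (fun q => ENNReal.ofReal (q.2 * (q.2 ^ 2 - ‖q.1‖ ^ 2) ^ γ) * kfun A q.1 q.2) (u, s) := by
    intro u
    rw [← lintegral_indicator measurableSet_Ioi]
    rfl
  rw [lintegral_congr e1, lintegral_lintegral_swap hm.aemeasurable]
  set I := ∫⁻ x in ball (0 : Eu α) 1, ENNReal.ofReal ((1 - ‖x‖ ^ 2) ^ γ) * Set.indicator A 1 x with hI
  have e2 : ∀ s : ℝ, ∫⁻ u : Eu α, Set.indicator {q : Eu α × ℝ | ‖q.1‖ < q.2}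
      (fun q => ENNReal.ofReal (q.2 * (q.2 ^ 2 - ‖q.1‖ ^ 2) ^ γ) * kfun A q.1 q.2) (u, s)
      = Set.indicator (Set.Ioo (0:ℝ) 1) (fun s => ENNReal.ofReal (s ^ Fintype.card α * (s * (s ^ 2) ^ γ)) * I) s := by
    intro s
    by_cases hs : s ∈ Set.Ioo (0:ℝ) 1
    swap
    · rw [Set.indicator_of_notMem hs]
      refine (lintegral_congr fun u => ?_).trans lintegral_zero
      have : kfun A u s = 0 := Set.indicator_of_notMem (fun h => hs h.1) _
      simp [Set.indicator_apply, this]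
    · rw [Set.indicator_of_mem hs]
      have hs0 := hs.1
      have h2 : Measurable fun u : Eu α => (u, s) := by fun_prop
      refine (lint_scale _ (hm.comp h2) hs0).trans ?_
      rw [ENNReal.ofReal_mul (by positivity), mul_assoc, hI, ← lintegral_indicator measurableSet_ball,
        ← lintegral_const_mul' (ENNReal.ofReal (s * (s ^ 2) ^ γ)) _ ENNReal.ofReal_ne_top]
      congr 1
      refine lintegral_congr fun x => ?_
      have hn : ‖s • x‖ = s * ‖x‖ := by rw [norm_smul, Real.norm_of_nonneg hs0.le]
      have hx1 : ‖s • x‖ < s ↔ ‖x‖ < 1 := by rw [hn]; exact mul_lt_iff_lt_one_right hs0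
      by_cases hx : ‖x‖ < 1
      · have hk1 : kfun A (s • x) s = Set.indicator A 1 x := by
          by_cases hxA : x ∈ A
          · rw [Set.indicator_of_mem hxA, kfun, Set.indicator_of_mem]
            · rfl
            · exact ⟨hs, by rwa [inv_smul_smul₀ hs0.ne']⟩
          · rw [Set.indicator_of_notMem hxA, kfun, Set.indicator_of_notMem]
            rintro ⟨-, h⟩
            simp only [inv_smul_smul₀ hs0.ne'] at h
            exact hxA h
        rw [Function.comp_apply, Set.indicator_of_mem (by exact hx1.2 hx), Set.indicator_of_mem (by simpa using hx), hk1, ← mul_assoc,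
          ← ENNReal.ofReal_mul (by positivity)]
        congr 2
        rw [hn, mul_assoc, ← Real.mul_rpow (by positivity) (by nlinarith [norm_nonneg x])]
        congr 2; ring
      · rw [Function.comp_apply, Set.indicator_of_notMem (by exact fun h => hx (hx1.1 h)), Set.indicator_of_notMem (by simpa using hx),
          mul_zero]
  rw [lintegral_congr e2, lintegral_indicator measurableSet_Ioo, lintegral_mul_const _ (by fun_prop)]
  rfl
end P7b

section P7c
variable (d m : ℕ)
def prS (x : Sp (Fin d ⊕ Fin m)) : Eu (Fin d) := prj x.1
lemma prS_cont : Continuous (prS d m) := prj_cont.comp continuous_subtype_val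

lemma ball_ae : (closedBall (0 : Eu (Fin d)) 1 : Set (Eu (Fin d))) =ᵐ[volume] ball 0 1 := by
  rw [← ball_union_sphere]
  exact union_ae_eq_left_of_ae_eq_empty (ae_eq_empty.2 (Measure.addHaar_sphere_of_ne_zero _ _ one_ne_zero))

lemma map_prS (hm : 1 ≤ m) : ∃ C : ℝ≥0∞, C ≠ 0 ∧ C ≠ ∞ ∧
    Measure.map (prS d m) (sg (Fin d ⊕ Fin m)) = C • ballMeasure d (((m:ℝ) - 1) / 2) := by
  have : Nonempty (Fin m) := ⟨⟨0, hm⟩⟩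
  obtain ⟨hQ0, hQ1⟩ := Qc_ne d m hm
  refine ⟨(sT (Fin d ⊕ Fin m) Set.univ)⁻¹ * (Fintype.card (Fin d ⊕ Fin m) * (sT (Fin m) Set.univ * Qc d m)), ?_, ?_, ?_⟩
  · refine mul_ne_zero (ENNReal.inv_ne_zero.2 sT_ne_top) (mul_ne_zero ?_ (mul_ne_zero sT_ne_zero hQ0))
    simp; omega
  · exact ENNReal.mul_ne_top (ENNReal.inv_ne_top.2 sT_ne_zero) (ENNReal.mul_ne_top (ENNReal.natCast_ne_top _) (ENNReal.mul_ne_top sT_ne_top hQ1))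
  · ext A hA
    rw [Measure.map_apply (prS_cont d m).measurable hA, sg, Measure.smul_apply, Measure.smul_apply, smul_eq_mul, smul_eq_mul]
    have h1 := cone_vol (β := Fin m) hA
    rw [cone_vol' hA, Fintype.card_fin, Fintype.card_fin] at h1
    have h2 : ballMeasure d (((m:ℝ) - 1) / 2) A = ∫⁻ x in ball (0 : Eu (Fin d)) 1, ENNReal.ofReal ((1 - ‖x‖ ^ 2) ^ (((m:ℝ) - 2) / 2)) * Set.indicator A 1 x := by
      rw [ballMeasure, withDensity_apply _ hA, ← lintegral_indicator hA]
      rw [Measure.restrict_congr_set (ball_ae d)]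
      refine lintegral_congr fun x => ?_
      have e : ((m:ℝ) - 1) / 2 - 1 / 2 = ((m:ℝ) - 2) / 2 := by ring
      rw [e]
      by_cases hx : x ∈ A <;> simp [hx]
    have e3 : prS d m ⁻¹' A = {x | prj x.1 ∈ A} := rfl
    rw [e3, h1, h2]
    ring
end P7c
end BallApprox
namespace BallApprox
set_option linter.unusedSectionVars false
section P8a
open MvPolynomial
variable {d m : ℕ}

def cB (d : ℕ) : Set (Eu (Fin d)) := closedBall 0 1

lemma cB_uniq : UniqueDiffOn ℝ (cB d) :=
  uniqueDiffOn_convex (convex_closedBall _ _) ⟨0, by rw [cB, interior_closedBall _ one_ne_zero]; simp⟩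

def gW (i : Fin d) (f : Eu (Fin d) → ℝ) (x : Eu (Fin d)) : ℝ :=
  fderivWithin ℝ f (cB d) x (EuclideanSpace.single i 1)
def DijW (i j : Fin d) (f : Eu (Fin d) → ℝ) (x : Eu (Fin d)) : ℝ := x j * gW i f x - x i * gW j f x

lemma gW_cd {k : ℕ} {f : Eu (Fin d) → ℝ} (i : Fin d) (hf : ContDiffOn ℝ (k + 1 : ℕ) f (cB d)) :
    ContDiffOn ℝ k (gW i f) (cB d) := by
  have h := hf.fderivWithin cB_uniq (m := k) (by norm_cast)
  exact h.clm_apply contDiffOn_const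

lemma coord_cd {k : ℕ} (i : Fin d) : ContDiffOn ℝ k (fun x : Eu (Fin d) => x i) (cB d) :=
  ((EuclideanSpace.proj i : Eu (Fin d) →L[ℝ] ℝ).contDiff).contDiffOn

lemma DijW_cd {k : ℕ} {f : Eu (Fin d) → ℝ} (i j : Fin d) (hf : ContDiffOn ℝ (k + 1 : ℕ) f (cB d)) :
    ContDiffOn ℝ k (DijW i j f) (cB d) :=
  ((coord_cd j).mul (gW_cd i hf)).sub ((coord_cd i).mul (gW_cd j hf))

lemma iter_cd {T : (Eu (Fin d) → ℝ) → (Eu (Fin d) → ℝ)}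
    (hT : ∀ (k : ℕ) f, ContDiffOn ℝ (k + 1 : ℕ) f (cB d) → ContDiffOn ℝ k (T f) (cB d)) (j : ℕ) :
    ∀ (k : ℕ) f, ContDiffOn ℝ (k + j : ℕ) f (cB d) → ContDiffOn ℝ k (T^[j] f) (cB d) := by
  induction j with
  | zero => intro k f h; exact h
  | succ j ih =>
    intro k f h
    rw [Function.iterate_succ_apply']
    refine hT _ _ (ih _ _ ?_)
    convert h using 2
    omega

lemma iter_eq {T S : (Eu (Fin d) → ℝ) → (Eu (Fin d) → ℝ)}
    (h : ∀ f g, Set.EqOn f g (ball 0 1) → Set.EqOn (T f) (S g) (ball 0 1)) (f : Eu (Fin d) → ℝ) (j : ℕ) :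
    Set.EqOn (T^[j] f) (S^[j] f) (ball 0 1) := by
  induction j with
  | zero => exact fun x _ => rfl
  | succ j ih => rw [Function.iterate_succ_apply', Function.iterate_succ_apply']; exact h _ _ ih

lemma gW_eq (i : Fin d) (f g : Eu (Fin d) → ℝ) (h : Set.EqOn f g (ball 0 1)) :
    Set.EqOn (gW i f) (pder i g) (ball 0 1) := by
  intro x hx
  have h1 : cB d ∈ nhds x := Filter.mem_of_superset (isOpen_ball.mem_nhds hx) ball_subset_closedBall
  have h2 : f =ᶠ[nhds x] g := Filter.eventuallyEq_of_mem (isOpen_ball.mem_nhds hx) h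
  rw [gW, pder, fderivWithin_of_mem_nhds h1, h2.fderiv_eq]

lemma DijW_eq (i j : Fin d) (f g : Eu (Fin d) → ℝ) (h : Set.EqOn f g (ball 0 1)) :
    Set.EqOn (DijW i j f) (Dij i j g) (ball 0 1) := by
  intro x hx
  have h1 := gW_eq i f g h hx
  have h2 := gW_eq j f g h hx
  rw [DijW, Dij, h1, h2]; rfl

lemma prS_mem (x : Sp (Fin d ⊕ Fin m)) : prS d m x ∈ cB d := by
  have h := norm_spl (prj x.1) (prk x.1)
  rw [spl_pr, Sp.norm_eq] at h
  rw [cB, mem_closedBall_zero_iff, prS]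
  nlinarith [norm_nonneg (prj x.1), sq_nonneg ‖prk x.1‖]

open Classical in
def lft (d m : ℕ) (h : Eu (Fin d) → ℝ) : C(Sp (Fin d ⊕ Fin m), ℝ) :=
  if hc : ContinuousOn h (cB d) then
    ⟨fun x => h (prS d m x), hc.comp_continuous (prS_cont d m) prS_mem⟩ else 0

lemma lft_apply {h : Eu (Fin d) → ℝ} (hc : ContinuousOn h (cB d)) (x : Sp (Fin d ⊕ Fin m)) :
    lft d m h x = h (prS d m x) := by rw [lft, dif_pos hc]; rfl

lemma gW_c {f : Eu (Fin d) → ℝ} (i : Fin d) (hf : ContDiffOn ℝ (1 : ℕ) f (cB d)) :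
    ContinuousOn (gW i f) (cB d) := (gW_cd (k := 0) i (by simpa using hf)).continuousOn

lemma lft_flow (a : Pr (Fin d ⊕ Fin m)) {f : Eu (Fin d) → ℝ} (hf : ContDiffOn ℝ (1 : ℕ) f (cB d)) :
    FlowD a (lft d m f) (∑ i, lft d m (gW i f) * toC (Dp a (X (Sum.inl i)))) := by
  intro x t
  have e : (fun t => lft d m f (fl a t x)) = fun t => f (prS d m (fl a t x)) :=
    funext fun t => lft_apply hf.continuousOn _
  rw [e]
  have hd := (hf.differentiableOn (by simp) (prS d m (fl a t x)) (prS_mem _)).hasFDerivWithinAt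
  have hγ : HasDerivAt (fun t => prS d m (fl a t x))
      (∑ i, (toC (Dp a (X (Sum.inl i))) (fl a t x)) • (EuclideanSpace.single i (1:ℝ) : Eu (Fin d))) t := by
    rw [← hasDerivWithinAt_univ, hasDerivWithinAt_iff_hasFDerivWithinAt, hasFDerivWithinAt_euclidean]
    intro i
    have h := flow_coord a (Sum.inl i) x t
    refine (h.hasDerivWithinAt.hasFDerivWithinAt (s := Set.univ)).congr_fderiv ?_ |>.congr_of_eventuallyEq
      (Filter.Eventually.of_forall fun t => ?_) ?_
    · ext
      simp [PiLp.single_apply]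
    · simp [prS, toC_apply]
    · simp [prS, toC_apply]
  have h := hd.comp_hasDerivAt t hγ (Filter.Eventually.of_forall fun t => prS_mem _)
  refine HasDerivAt.congr_deriv h ?_
  simp only [map_sum, map_smul, ContinuousMap.coe_sum, Finset.sum_apply, ContinuousMap.mul_apply, smul_eq_mul]
  refine Finset.sum_congr rfl fun i _ => ?_
  rw [lft_apply (gW_c i hf), mul_comm]; rfl

lemma lft_flow_ll (i j : Fin d) (hij : i ≠ j) {f : Eu (Fin d) → ℝ} (hf : ContDiffOn ℝ (1 : ℕ) f (cB d)) :
    FlowD (⟨(Sum.inl i, Sum.inl j), by simpa using hij⟩ : Pr (Fin d ⊕ Fin m)) (lft d m f) (lft d m (DijW i j f)) := by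
  have h := lft_flow (m := m) ⟨(Sum.inl i, Sum.inl j), by simpa using hij⟩ hf
  convert h using 1
  ext x
  rw [lft_apply (DijW_cd (k := 0) i j (by simpa using hf)).continuousOn]
  simp only [ContinuousMap.coe_sum, Finset.sum_apply, ContinuousMap.mul_apply, Dp_eq, Eij_X, kd,
    toC_apply, lft_apply (gW_c _ hf)]
  simp [DijW, prS, mul_sub, Finset.sum_sub_distrib, ite_smul, apply_ite (eval _), mul_comm]

lemma lft_flow_lr (i : Fin d) (l : Fin m) {f : Eu (Fin d) → ℝ} (hf : ContDiffOn ℝ (1 : ℕ) f (cB d)) :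
    FlowD (⟨(Sum.inl i, Sum.inr l), by simp⟩ : Pr (Fin d ⊕ Fin m)) (lft d m f)
      (toC (X (Sum.inr l)) * lft d m (gW i f)) := by
  have h := lft_flow (m := m) ⟨(Sum.inl i, Sum.inr l), by simp⟩ hf
  convert h using 1
  ext x
  simp only [ContinuousMap.coe_sum, Finset.sum_apply, ContinuousMap.mul_apply, Dp_eq, Eij_X, kd,
    toC_apply, lft_apply (gW_c _ hf)]
  simp [ite_smul, apply_ite (eval _), mul_comm]

lemma lft_flow_rr (k l : Fin m) (hkl : k ≠ l) {f : Eu (Fin d) → ℝ} (hf : ContDiffOn ℝ (1 : ℕ) f (cB d)) :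
    FlowD (⟨(Sum.inr k, Sum.inr l), by simpa using hkl⟩ : Pr (Fin d ⊕ Fin m)) (lft d m f) 0 := by
  have h := lft_flow (m := m) ⟨(Sum.inr k, Sum.inr l), by simpa using hkl⟩ hf
  convert h using 1
  ext x
  simp [Dp_eq, Eij_X, kd]
end P8a
end BallApprox
namespace BallApprox
set_option linter.unusedSectionVars false
section P9a
open MvPolynomial
variable {ι : Type} [Fintype ι] [DecidableEq ι]

def sw (a : Pr ι) : Pr ι := ⟨(a.1.2, a.1.1), a.2.symm⟩

lemma fl_sw (a : Pr ι) (t : ℝ) (x : Sp ι) : fl (sw a) t x = fl a (-t) x := by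
  apply Subtype.ext
  rw [fl_coe, fl_coe]
  ext k
  by_cases h1 : k = a.1.1
  · have := rotFun_snd (sw a) t x.1
    simp only [sw] at this
    rw [h1, rotFun_fst, sw, this]; simp; ring
  · by_cases h2 : k = a.1.2
    · have := rotFun_fst (sw a) t x.1
      simp only [sw] at this
      rw [h2, rotFun_snd, sw, this]; simp
    · rw [rotFun_other a _ _ h1 h2, rotFun_other (sw a) _ _ (by simpa [sw] using h2) (by simpa [sw] using h1)]

lemma FlowD.sw {a : Pr ι} {F F' : C(Sp ι, ℝ)} (h : FlowD a F F') : FlowD (sw a) F (-F') := by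
  intro x t
  have h1 := (h x (-t)).scomp t (hasDerivAt_neg t)
  simp only [fl_sw]
  refine HasDerivAt.congr_deriv h1 ?_
  simp

lemma FlowD.smul {a : Pr ι} {F F' : C(Sp ι, ℝ)} (h : FlowD a F F') (c : ℝ) : FlowD a (c • F) (c • F') :=
  fun x t => (h x t).const_mul c

variable (σ : Measure (Sp ι)) [IsProbabilityMeasure σ] [σ.IsOpenPosMeasure] [RotInv σ] (p : ℝ≥0∞) [Fact (1 ≤ p)]

def Good (r n : ℕ) (F : C(Sp ι, ℝ)) (B : ℝ) (a : Pr ι) : Prop :=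
  ∃ G : ℕ → C(Sp ι, ℝ), G 0 = F ∧ (∀ j < r, FlowD a (G j) (G (j + 1))) ∧
    ∃ g ∈ Pol ι n, nrm σ p (G r - g) ≤ B

variable {σ p}
lemma Good.sw {r n : ℕ} {F : C(Sp ι, ℝ)} {B : ℝ} {a : Pr ι} (h : Good σ p r n F B a) :
    Good σ p r n F B (sw a) := by
  obtain ⟨G, h0, h1, g, hg, hB⟩ := h
  refine ⟨fun k => (-1 : ℝ) ^ k • G k, by simp [h0], fun j hj => ?_, (-1 : ℝ) ^ r • g,
    Submodule.smul_mem _ _ hg, ?_⟩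
  · have h := ((h1 j hj).sw).smul ((-1 : ℝ) ^ j)
    convert h using 1
    simp only [pow_succ]; simp
  · simp only
    rw [← smul_sub, nrm_smul]; simpa using hB

lemma Good.mono {r n : ℕ} {F : C(Sp ι, ℝ)} {B B' : ℝ} {a : Pr ι} (h : Good σ p r n F B a) (hB : B ≤ B') :
    Good σ p r n F B' a := by
  obtain ⟨G, h0, h1, g, hg, h2⟩ := h
  exact ⟨G, h0, h1, g, hg, h2.trans hB⟩

def qp (a : Pr ι) : ℕ → ℕ → MvPolynomial ι ℝ
  | 0, 0 => 1
  | 0, _ + 1 => 0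
  | k + 1, 0 => Dp a (qp a k 0)
  | k + 1, j + 1 => Dp a (qp a k (j + 1)) + X a.1.2 * qp a k j

lemma qp_gt (a : Pr ι) (k : ℕ) : ∀ j, k < j → qp a k j = 0 := by
  induction k with
  | zero => intro j hj; obtain ⟨j, rfl⟩ := Nat.exists_eq_succ_of_ne_zero hj.ne'; rw [qp]
  | succ k ih =>
    intro j hj
    obtain ⟨j, rfl⟩ := Nat.exists_eq_succ_of_ne_zero (by omega : j ≠ 0)
    rw [qp, ih _ (by omega), ih _ (by omega)]; simp

lemma qp_zero (a : Pr ι) (k : ℕ) : qp a (k + 1) 0 = 0 := by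
  induction k with
  | zero => rw [qp, qp]; simp
  | succ k ih => rw [qp, ih]; simp

lemma qp_deg (a : Pr ι) (k : ℕ) : ∀ j, (qp a k j).totalDegree ≤ k := by
  induction k with
  | zero => intro j; cases j <;> simp [qp]
  | succ k ih =>
    intro j
    cases j with
    | zero => rw [qp]; exact (Dp_deg _ _).trans ((ih 0).trans (by omega))
    | succ j =>
      rw [qp]
      refine (totalDegree_add _ _).trans (max_le ((Dp_deg _ _).trans ((ih _).trans (by omega))) ?_)
      refine (totalDegree_mul _ _).trans ?_
      have := ih j
      have h2 := totalDegree_X (R := ℝ) a.1.2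
      omega

lemma Dp_dvd (a : Pr ι) (e : ℕ) (P : MvPolynomial ι ℝ) (h : X a.1.2 ^ (e + 1) ∣ P) : X a.1.2 ^ e ∣ Dp a P := by
  obtain ⟨u, rfl⟩ := h
  rw [Derivation.leibniz, Derivation.leibniz_pow]
  refine dvd_add ?_ ?_
  · exact Dvd.intro _ (by simp only [smul_eq_mul]; rw [pow_succ]; ring : X a.1.2 ^ e * (X a.1.2 * Dp a u) = _)
  · refine Dvd.intro (u * ((e + 1 : ℕ) • Dp a (X a.1.2))) ?_
    simp only [smul_eq_mul, nsmul_eq_mul, Nat.add_sub_cancel]; ring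

lemma qp_dvd (a : Pr ι) (k : ℕ) : ∀ j, X a.1.2 ^ (2 * j - k) ∣ qp a k j := by
  induction k with
  | zero => intro j; cases j <;> simp [qp]
  | succ k ih =>
    intro j
    cases j with
    | zero => simp
    | succ j =>
      rw [qp]
      rcases Nat.lt_or_ge (2 * j) k with h | h
      · rw [show 2 * (j + 1) - (k + 1) = 0 by omega]; simp
      · refine dvd_add (Dp_dvd _ _ _ ?_) ?_
        · convert ih (j + 1) using 2; omega
        · rw [show 2 * (j + 1) - (k + 1) = (2 * j - k) + 1 by omega, pow_succ']
          exact mul_dvd_mul_left _ (ih j)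

/-- the chain -/
lemma qp_flow (a : Pr ι) (L : ℕ → C(Sp ι, ℝ)) (k : ℕ)
    (hL : ∀ j ≤ k, FlowD a (L j) (toC (X a.1.2) * L (j + 1))) :
    FlowD a (∑ j ∈ range (k + 1), toC (qp a k j) * L j) (∑ j ∈ range (k + 2), toC (qp a (k + 1) j) * L j) := by
  have h := FlowD.sum (range (k + 1)) fun j hj => (flow_toC a (qp a k j)).mul (hL j (by simp at hj; omega))
  convert h using 1
  rw [Finset.sum_add_distrib, Finset.sum_range_succ' _ (k + 1),
    Finset.sum_range_succ' (fun x => toC (Dp a (qp a k x)) * L x) k]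
  have e : ∀ j, toC (qp a (k + 1) (j + 1)) * L (j + 1) =
      toC (Dp a (qp a k (j + 1))) * L (j + 1) + toC (qp a k j) * (toC (X a.1.2) * L (j + 1)) := by
    intro j; rw [qp, map_add, map_mul]; ring
  rw [Finset.sum_congr rfl fun j _ => e j, Finset.sum_add_distrib,
    Finset.sum_range_succ (fun j => toC (Dp a (qp a k (j + 1))) * L (j + 1)), qp_gt a k (k + 1) (by omega)]
  simp only [map_zero, zero_mul, add_zero]
  rw [show qp a (k + 1) 0 = Dp a (qp a k 0) by rw [qp]]
  abel

lemma qp_bd (a : Pr ι) (r j : ℕ) : ∃ C : ℝ, 0 ≤ C ∧ ∀ H : C(Sp ι, ℝ),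
    nrm σ p (toC (qp a r j) * H) ≤ C * nrm σ p (toC (X a.1.2) ^ (2 * j - r) * H) := by
  obtain ⟨u, hu⟩ := qp_dvd a r j
  refine ⟨‖toC u‖, norm_nonneg _, fun H => ?_⟩
  have h := nrm_smul σ p ‖toC u‖ (toC (X a.1.2) ^ (2 * j - r) * H)
  rw [abs_of_nonneg (norm_nonneg _)] at h
  rw [← h, hu]
  refine nrm_mono σ p fun x => ?_
  simp only [map_mul, map_pow, ContinuousMap.mul_apply, ContinuousMap.smul_apply, smul_eq_mul, abs_mul, abs_norm]
  have := (toC u).norm_coe_le_norm x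
  rw [Real.norm_eq_abs] at this
  calc _ = |toC u x| * (|(toC (X a.1.2) ^ (2 * j - r)) x| * |H x|) := by ring
    _ ≤ _ := by gcongr

lemma Good_lr (a : Pr ι) (r : ℕ) (hr : 1 ≤ r) : ∃ C : ℝ, 0 ≤ C ∧ ∀ n, r ≤ n → ∀ (L W : ℕ → C(Sp ι, ℝ)) (b : ℝ),
    (∀ j < r, FlowD a (L j) (toC (X a.1.2) * L (j + 1))) → (∀ j, W j ∈ Pol ι (n - r)) →
    (∀ j, 1 ≤ j → j ≤ r → nrm σ p (toC (X a.1.2) ^ (2 * j - r) * (L j - W j)) ≤ b) →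
    Good σ p r n (L 0) (C * b) a := by
  choose C hC0 hC using fun j => qp_bd (σ := σ) (p := p) a r j
  refine ⟨∑ j ∈ range r, C (j + 1), Finset.sum_nonneg fun j _ => hC0 _, fun n hn L W b hL hW hb => ?_⟩
  refine ⟨fun k => ∑ j ∈ range (k + 1), toC (qp a k j) * L j, by simp [qp], fun k hk => ?_,
    ∑ j ∈ range (r + 1), toC (qp a r j) * W j, Submodule.sum_mem _ fun j _ => ?_, ?_⟩
  · exact qp_flow a L k fun j hj => hL j (by omega)
  · have := Pol_mul (toC_mem (qp_deg a r j)) (hW j)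
    rwa [show r + (n - r) = n by omega] at this
  · obtain ⟨r, rfl⟩ := Nat.exists_eq_succ_of_ne_zero (by omega : r ≠ 0)
    simp only
    rw [← Finset.sum_sub_distrib]
    simp only [← mul_sub]
    rw [Finset.sum_range_succ', qp_zero, map_zero, zero_mul, add_zero, Finset.sum_mul]
    refine (nrm_sum σ p _ _).trans (Finset.sum_le_sum fun j hj => (hC _ _).trans ?_)
    simp only [Finset.mem_range] at hj
    exact mul_le_mul_of_nonneg_left (hb _ (by omega) (by omega)) (hC0 _)
end P9a
end BallApprox
namespace BallApprox
set_option linter.unusedSectionVars false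
section P10a
variable {d m : ℕ}

lemma bM_ac (ν : ℝ) : ballMeasure d ν ≪ volume.restrict (cB d) := withDensity_absolutelyContinuous _ _

lemma bM_ball (ν : ℝ) : ∀ᵐ x ∂(ballMeasure d ν), x ∈ ball (0 : Eu (Fin d)) 1 := by
  refine (bM_ac ν).ae_le ?_
  rw [cB, Measure.restrict_congr_set (ball_ae d)]
  exact ae_restrict_mem measurableSet_ball

lemma cont_asm {g : Eu (Fin d) → ℝ} (hg : ContinuousOn g (cB d)) (ν : ℝ) : AEStronglyMeasurable g (ballMeasure d ν) :=
  (hg.aestronglyMeasurable isClosed_closedBall.measurableSet).mono_ac (bM_ac ν)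

lemma transfer (hm : 1 ≤ m) (p : ℝ≥0∞) : ∃ K : ℝ≥0∞, K ≠ 0 ∧ K ≠ ∞ ∧ ∀ g : Eu (Fin d) → ℝ, ContinuousOn g (cB d) →
    eLpNorm (fun x => g (prS d m x)) p (sg (Fin d ⊕ Fin m)) = K * eLpNorm g p (ballMeasure d (((m:ℝ)-1)/2)) := by
  obtain ⟨C, h0, h1, h⟩ := map_prS d m hm
  refine ⟨C ^ (1 / p).toReal, ?_, ?_, fun g hg => ?_⟩
  · simp [ENNReal.rpow_eq_zero_iff, h0, h1]
  · simp [ENNReal.rpow_eq_top_iff, h0, h1]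
  · have h2 := eLpNorm_map_measure (p := p) (μ := sg (Fin d ⊕ Fin m)) (f := prS d m) (g := g)
      (by rw [h]; exact (cont_asm hg _).smul_measure _) (prS_cont d m).measurable.aemeasurable
    have h3 : (fun x => g (prS d m x)) = g ∘ prS d m := rfl
    rw [h3, ← h2, h, eLpNorm_smul_measure_of_ne_zero h0]
    rfl

lemma phi_le (x : Eu (Fin d)) : phiB x ≤ 1 := by
  rw [phiB]; apply Real.sqrt_le_one.2; nlinarith [sq_nonneg ‖x‖]

lemma lint_bM (ν : ℝ) (H : Eu (Fin d) → ℝ≥0∞) : ∫⁻ x, H x ∂(ballMeasure d ν) =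
    ∫⁻ x in ball (0 : Eu (Fin d)) 1, ENNReal.ofReal ((1 - ‖x‖ ^ 2) ^ (ν - 1 / 2)) * H x := by
  rw [ballMeasure, lintegral_withDensity_eq_lintegral_mul_non_measurable, Measure.restrict_congr_set (ball_ae d)]
  · rfl
  · fun_prop
  · simp

lemma weight (p : ℝ≥0∞) (hp : 1 ≤ p) (ν : ℝ) (e : ℕ) (h : Eu (Fin d) → ℝ) :
    eLpNorm (fun x => phiB x ^ e * h x) p (ballMeasure d ν) ≤
      eLpNorm h p (ballMeasure d (ν + (e / 2 : ℝ) * p.toReal)) := by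
  by_cases hpt : p = ∞
  · subst hpt
    simp only [ENNReal.toReal_top, mul_zero, add_zero]
    refine eLpNorm_mono fun x => ?_
    rw [norm_mul, norm_pow]
    have h0 : ‖phiB x‖ ≤ 1 := by
      rw [Real.norm_eq_abs, abs_of_nonneg (by unfold phiB; positivity)]; exact phi_le x
    exact mul_le_of_le_one_left (norm_nonneg _) (pow_le_one₀ (norm_nonneg _) h0)
  · have hp0 : p ≠ 0 := by rintro rfl; simp at hp
    rw [eLpNorm_eq_lintegral_rpow_enorm_toReal hp0 hpt, eLpNorm_eq_lintegral_rpow_enorm_toReal hp0 hpt, lint_bM, lint_bM]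
    refine ENNReal.rpow_le_rpow (le_of_eq ?_) (by positivity)
    refine setLIntegral_congr_fun measurableSet_ball fun x hx => ?_
    have ht : 0 < 1 - ‖x‖ ^ 2 := by
      rw [mem_ball_zero_iff] at hx; nlinarith [norm_nonneg x]
    have e1 : ‖phiB x ^ e * h x‖ₑ ^ p.toReal = ENNReal.ofReal ((1 - ‖x‖ ^ 2) ^ ((e / 2 : ℝ) * p.toReal)) * ‖h x‖ₑ ^ p.toReal := by
      rw [enorm_mul, ENNReal.mul_rpow_of_nonneg _ _ ENNReal.toReal_nonneg]
      congr 1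
      have e2 : phiB x ^ e = (1 - ‖x‖ ^ 2) ^ (e / 2 : ℝ) := by
        rw [phiB, Real.sqrt_eq_rpow, ← Real.rpow_natCast, ← Real.rpow_mul ht.le]; congr 1; ring
      rw [e2, Real.enorm_eq_ofReal (by positivity), ENNReal.ofReal_rpow_of_nonneg (by positivity) ENNReal.toReal_nonneg,
        ← Real.rpow_mul ht.le]
    simp only [e1]
    rw [← mul_assoc, ← ENNReal.ofReal_mul (by positivity), ← Real.rpow_add ht]
    congr 3; ring

end P10a
section P10b
open MvPolynomial
variable {d m : ℕ}

def evf (w : MvPolynomial (Fin d) ℝ) (x : Eu (Fin d)) : ℝ := eval (fun i => x i) w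

lemma evf_cont (w : MvPolynomial (Fin d) ℝ) : Continuous (evf w) := by
  have h := MvPolynomial.continuous_eval w
  have h0 : Continuous fun x : Eu (Fin d) => (fun i => x i) := by fun_prop
  exact h.comp h0

lemma lft_evf (w : MvPolynomial (Fin d) ℝ) : lft d m (evf w) = toC (rename Sum.inl w) := by
  ext x
  rw [lft_apply (evf_cont w).continuousOn, toC_apply, eval_rename]
  rfl

lemma lft_evf_mem {w : MvPolynomial (Fin d) ℝ} {n : ℕ} (h : w.totalDegree ≤ n) :
    lft d m (evf w) ∈ Pol (Fin d ⊕ Fin m) n := by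
  rw [lft_evf]; exact toC_mem ((totalDegree_rename_le _ _).trans h)

lemma lft_sub {f g : Eu (Fin d) → ℝ} (hf : ContinuousOn f (cB d)) (hg : ContinuousOn g (cB d)) :
    lft d m f - lft d m g = lft d m (fun x => f x - g x) := by
  ext x
  have h : ContinuousOn (fun x => f x - g x) (cB d) := hf.sub hg
  rw [ContinuousMap.sub_apply, lft_apply hf, lft_apply hg, lft_apply h]

lemma lft_eLp (p : ℝ≥0∞) {f : Eu (Fin d) → ℝ} (hf : ContinuousOn f (cB d)) (σ : Measure (Sp (Fin d ⊕ Fin m))) :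
    eLpNorm (lft d m f) p σ = eLpNorm (fun x => f (prS d m x)) p σ := by
  congr 1; ext x; exact lft_apply hf x

lemma y_le_phi (x : Sp (Fin d ⊕ Fin m)) (l : Fin m) : |x.1 (Sum.inr l)| ≤ phiB (prS d m x) := by
  rw [phiB, ← Real.sqrt_sq_eq_abs]
  apply Real.sqrt_le_sqrt
  have h := norm_spl (prj x.1) (prk x.1)
  rw [spl_pr, Sp.norm_eq] at h
  have h2 : (prk x.1 l) ^ 2 ≤ ‖prk x.1‖ ^ 2 := by
    rw [EuclideanSpace.norm_sq_eq]
    have := Finset.single_le_sum (f := fun i => ‖prk x.1 i‖ ^ 2) (fun i _ => sq_nonneg _) (Finset.mem_univ l)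
    simpa using this
  rw [prk_apply] at h2
  rw [prS]; linarith

/-- `V F` for lifted F only depends on prS -/
lemma V_dep [Nonempty (Fin d ⊕ Fin m)] {f : Eu (Fin d) → ℝ} (hf : ContinuousOn f (cB d)) (n : ℕ) (z z' : Sp (Fin d ⊕ Fin m)) (h : prS d m z = prS d m z') :
    V (sg (Fin d ⊕ Fin m)) n (lft d m f) z = V (sg (Fin d ⊕ Fin m)) n (lft d m f) z' := by
  have hR := Submodule.reflection_sub (v := z.1) (w := z'.1) (by rw [Sp.norm_eq, Sp.norm_eq])
  set R := (Submodule.span ℝ {z.1 - z'.1})ᗮ.reflection with hRd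
  have hprj : ∀ w, prj (R w) = prj w := by
    intro w
    have h1 : ∃ c : ℝ, R w = w - c • (z.1 - z'.1) := by
      refine ⟨2 * (inner ℝ (z.1 - z'.1) w / ‖z.1 - z'.1‖ ^ 2), ?_⟩
      rw [hRd, Submodule.reflection_orthogonal_apply, Submodule.reflection_singleton_apply]
      simp [mul_smul, two_smul]
    obtain ⟨c, hc⟩ := h1
    rw [hc]
    ext i
    have h2 : prS d m z i = prS d m z' i := by rw [h]
    simp only [prS, prj_apply] at h2
    simp [h2]
  have hinv : (lft d m f).comp (act R) = lft d m f := by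
    ext x
    rw [ContinuousMap.comp_apply, lft_apply hf, lft_apply hf, prS, prS, act_coe, hprj]
  have hz : act R z = z' := Subtype.ext hR
  have := V_act (sg (Fin d ⊕ Fin m)) n R (lft d m f)
  rw [hinv] at this
  rw [← hz]
  nth_rewrite 1 [this]
  rfl
end P10b
end BallApprox
namespace BallApprox
set_option linter.unusedSectionVars false
section P11a
open MvPolynomial
variable {d m : ℕ}

/-- the point `(x, s e)` -/
def pt (l0 : Fin m) (x : Fin d → ℝ) (s : ℝ) : Fin d ⊕ Fin m → ℝ := Sum.elim x (fun l => if l = l0 then s else 0)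

lemma par (l0 : Fin m) (β : Fin m → ℕ) : (∀ s : ℝ, ∏ l, (if l = l0 then s else 0) ^ β l + ∏ l, (if l = l0 then -s else 0) ^ β l = 0) ∨
    ∃ k, 2 * k ≤ ∑ l, β l ∧ ∀ s : ℝ, ∏ l, (if l = l0 then s else 0) ^ β l + ∏ l, (if l = l0 then -s else 0) ^ β l = 2 * (s ^ 2) ^ k := by
  by_cases h : ∃ l, l ≠ l0 ∧ β l ≠ 0
  · obtain ⟨l, hl, hb⟩ := h
    left; intro s
    rw [Finset.prod_eq_zero (Finset.mem_univ l), Finset.prod_eq_zero (Finset.mem_univ l)] <;> simp [hl, hb]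
  · push Not at h
    have e : ∀ s : ℝ, ∏ l, (if l = l0 then s else 0) ^ β l = s ^ β l0 := by
      intro s
      rw [Finset.prod_eq_single l0] <;> simp +contextual [h]
    rcases Nat.even_or_odd (β l0) with ⟨k, hk⟩ | ho
    · right
      refine ⟨k, ?_, fun s => ?_⟩
      · have := Finset.single_le_sum (f := β) (fun i _ => Nat.zero_le _) (Finset.mem_univ l0)
        omega
      · rw [e, e, hk, ← two_mul, pow_mul, pow_mul]; ring
    · left; intro s
      rw [e, e, ho.neg_pow]; ring

lemma mono_red (l0 : Fin m) (α : Fin d ⊕ Fin m →₀ ℕ) : ∃ a : MvPolynomial (Fin d) ℝ, a.totalDegree ≤ α.sum (fun _ e => e) ∧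
    ∀ (x : Fin d → ℝ) (s : ℝ), s ^ 2 = 1 - ∑ i, x i ^ 2 →
      ∏ i, pt l0 x s i ^ α i + ∏ i, pt l0 x (-s) i ^ α i = 2 * eval x a := by
  have hs : α.sum (fun _ e => e) = ∑ i, α (Sum.inl i) + ∑ l, α (Sum.inr l) := by
    rw [Finsupp.sum_fintype _ _ (by simp), Fintype.sum_sum_type]
  rw [hs]
  simp only [Fintype.prod_sum_type, pt, Sum.elim_inl, Sum.elim_inr]
  rcases par l0 (fun l => α (Sum.inr l)) with h | ⟨k, hk, h⟩
  · refine ⟨0, by simp, fun x s _ => ?_⟩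
    rw [← mul_add, h]; simp
  · refine ⟨(∏ i, X i ^ α (Sum.inl i)) * (1 - ∑ i, X i ^ 2) ^ k, ?_, fun x s hs => ?_⟩
    · refine (totalDegree_mul _ _).trans (add_le_add ?_ (le_trans ?_ hk))
      · refine (totalDegree_finsetProd _ _).trans (Finset.sum_le_sum fun i _ => ?_)
        rw [totalDegree_X_pow]
      · refine (totalDegree_pow _ _).trans ?_
        rw [mul_comm]
        refine Nat.mul_le_mul_right _ ?_
        refine (totalDegree_sub _ _).trans (max_le (by simp) ?_)
        exact (totalDegree_finsetSum _ _).trans (Finset.sup_le fun i _ => by rw [totalDegree_X_pow])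
    · rw [← mul_add, h, hs]; simp; ring

lemma poly_red (l0 : Fin m) (P : MvPolynomial (Fin d ⊕ Fin m) ℝ) : ∃ a : MvPolynomial (Fin d) ℝ, a.totalDegree ≤ P.totalDegree ∧
    ∀ (x : Fin d → ℝ) (s : ℝ), s ^ 2 = 1 - ∑ i, x i ^ 2 → eval (pt l0 x s) P + eval (pt l0 x (-s)) P = 2 * eval x a := by
  choose A hA hE using mono_red (d := d) l0
  refine ⟨∑ α ∈ P.support, P.coeff α • A α, ?_, fun x s hs => ?_⟩
  · refine (totalDegree_finsetSum _ _).trans (Finset.sup_le fun α hα => ?_)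
    exact (totalDegree_smul_le _ _).trans ((hA α).trans (le_totalDegree hα))
  · rw [eval_eq', eval_eq', ← Finset.sum_add_distrib, map_sum, Finset.mul_sum]
    refine Finset.sum_congr rfl fun α _ => ?_
    rw [← mul_add, hE α x s hs, smul_eval]; ring

lemma V_poly [Nonempty (Fin d ⊕ Fin m)] (hm : 1 ≤ m) {f : Eu (Fin d) → ℝ} (hf : ContinuousOn f (cB d)) {n : ℕ} (hn : 2 ≤ n) :
    ∃ a : MvPolynomial (Fin d) ℝ, a.totalDegree ≤ 2 * n ∧
      V (sg (Fin d ⊕ Fin m)) n (lft d m f) = lft d m (evf a) := by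
  obtain ⟨P, hP, hV⟩ := mem_Pol.1 (V_mem'' (sg (Fin d ⊕ Fin m)) hn (lft d m f))
  obtain ⟨a, ha, hE⟩ := poly_red (d := d) (⟨0, hm⟩ : Fin m) P
  refine ⟨a, ha.trans hP, ?_⟩
  ext z
  rw [lft_apply (evf_cont a).continuousOn]
  set x := prS d m z with hx
  have hx1 : ‖x‖ ^ 2 ≤ 1 := by
    have := prS_mem z
    rw [← hx, cB, mem_closedBall_zero_iff] at this
    nlinarith [norm_nonneg x]
  set s := √(1 - ‖x‖ ^ 2) with hs
  have hs2 : s ^ 2 = 1 - ‖x‖ ^ 2 := Real.sq_sqrt (by linarith)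
  have key : ∀ s : ℝ, s ^ 2 = 1 - ‖x‖ ^ 2 → V (sg (Fin d ⊕ Fin m)) n (lft d m f) z = eval (pt ⟨0, hm⟩ (fun i => x i) s) P := by
    intro s hs
    have hz : spl x (EuclideanSpace.single (⟨0, hm⟩ : Fin m) s) ∈ sphere (0 : Eu (Fin d ⊕ Fin m)) 1 := by
      rw [mem_sphere_zero_iff_norm, ← sq_eq_sq₀ (norm_nonneg _) zero_le_one, norm_spl, PiLp.norm_single]
      simp [hs]
    rw [V_dep hf n z ⟨_, hz⟩ rfl, ← hV, toC_apply]
    congr 2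
    ext i
    cases i <;> simp [pt, PiLp.single_apply]
  have h1 := key s hs2
  have h2 := key (-s) (by rw [neg_sq, hs2])
  have h3 := hE (fun i => x i) s (by rw [hs2, EuclideanSpace.norm_sq_eq]; simp)
  rw [← h1, ← h2] at h3
  rw [evf]; linarith
end P11a
end BallApprox
namespace BallApprox
set_option linter.unusedSectionVars false
section P12a
open MvPolynomial
variable {d m : ℕ}

lemma eLp_swap {u v : Eu (Fin d) → ℝ} (h : Set.EqOn u v (ball 0 1)) (w : Eu (Fin d) → ℝ) (p : ℝ≥0∞) (ν : ℝ) :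
    eLpNorm (fun x => u x - w x) p (ballMeasure d ν) = eLpNorm (fun x => v x - w x) p (ballMeasure d ν) :=
  eLpNorm_congr_ae ((bM_ball ν).mono fun x hx => by simp only; rw [h hx])

lemma ex_poly {ν : ℝ} {p : ℝ≥0∞} {n : ℕ} {u v : Eu (Fin d) → ℝ} {A : ℝ≥0∞} (h : ballEn d ν p n v < A)
    (huv : Set.EqOn u v (ball 0 1)) : ∃ w : MvPolynomial (Fin d) ℝ, w.totalDegree ≤ n ∧
      eLpNorm (fun x => u x - evf w x) p (ballMeasure d ν) ≤ A := by
  obtain ⟨g, hg⟩ := iInf_lt_iff.1 h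
  refine ⟨g.1, g.2, ?_⟩
  rw [eLp_swap huv]
  exact hg.le

lemma core (hd : 1 ≤ d) (r : ℕ) (hr : 1 ≤ r) (p : ℝ≥0∞) [Fact (1 ≤ p)] (hm : 1 ≤ m) :
    ∃ c : ℝ, 0 ≤ c ∧ ∀ f : Eu (Fin d) → ℝ, ContDiffOn ℝ r f (cB d) → ∀ n : ℕ, r < n → ∀ A : ℝ≥0∞, A ≠ ∞ →
      (∀ i j : Fin d, i < j → ballEn d (((m:ℝ)-1)/2) p n ((Dij i j)^[r] f) < A) →
      (∀ (i : Fin d) (j : ℕ), 1 ≤ j → j ≤ r →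
        ballEn d (((m:ℝ)-1)/2 + (((2 * j - r : ℕ) : ℝ) / 2) * p.toReal) p (n - r) ((pder i)^[j] f) < A) →
      ballEn d (((m:ℝ)-1)/2) p (2 * n) f ≤ ENNReal.ofReal c * ((n : ℝ≥0∞)⁻¹) ^ r * A := by
  have hp : 1 ≤ p := Fact.out
  have : Nontrivial (Fin d ⊕ Fin m) := ⟨Sum.inl ⟨0, hd⟩, Sum.inr ⟨0, hm⟩, by simp⟩
  obtain ⟨K, hK0, hKt, hK⟩ := transfer (d := d) hm p
  obtain ⟨c0, hc0, hmain⟩ := sphere_main (sg (Fin d ⊕ Fin m)) p r hr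
  choose C hC0 hC using fun (i : Fin d) (l : Fin m) => Good_lr (σ := sg (Fin d ⊕ Fin m)) (p := p)
    ⟨(Sum.inl i, Sum.inr l), by simp⟩ r hr
  set C1 : ℝ := 1 + ∑ i, ∑ l, C i l with hC1
  have hCl : ∀ i l, C i l ≤ C1 := by
    intro i l
    have h1 := Finset.single_le_sum (f := fun l => C i l) (fun l _ => hC0 i l) (Finset.mem_univ l)
    have h2 := Finset.single_le_sum (f := fun i => ∑ l, C i l) (fun i _ => Finset.sum_nonneg fun l _ => hC0 i l) (Finset.mem_univ i)
    linarith
  have hC11 : 1 ≤ C1 := by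
    have : 0 ≤ ∑ i, ∑ l, C i l := Finset.sum_nonneg fun i _ => Finset.sum_nonneg fun l _ => hC0 i l
    linarith
  refine ⟨c0 * C1, by positivity, fun f hf n hn A hA h1 h2 => ?_⟩
  set σ := sg (Fin d ⊕ Fin m) with hσ
  have hKA : K * A ≠ ∞ := ENNReal.mul_ne_top hKt hA
  set B0 : ℝ := (K * A).toReal with hB0
  have hB0' : ENNReal.ofReal B0 = K * A := ENNReal.ofReal_toReal hKA
  have hB0n : 0 ≤ B0 := ENNReal.toReal_nonneg
  have hf0 : ContinuousOn f (cB d) := hf.continuousOn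
  have hcdg : ∀ i, ∀ j ≤ r, ContinuousOn ((gW i)^[j] f) (cB d) := fun i j hj =>
    (iter_cd (fun k f h => gW_cd i h) j 0 f (hf.of_le (by norm_cast; omega))).continuousOn
  have hcdD : ∀ i j, ∀ k ≤ r, ContinuousOn ((DijW i j)^[k] f) (cB d) := fun i j k hk =>
    (iter_cd (fun k f h => DijW_cd i j h) k 0 f (hf.of_le (by norm_cast; omega))).continuousOn
  have good_ll : ∀ i j : Fin d, ∀ hij : i < j, Good σ p r n (lft d m f) (C1 * B0) ⟨(Sum.inl i, Sum.inl j), by simpa using hij.ne⟩ := by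
    intro i j hij
    obtain ⟨w, hw, hwA⟩ := ex_poly (h1 i j hij) (iter_eq (fun f g h => DijW_eq i j f g h) f r)
    refine ⟨fun k => lft d m ((DijW i j)^[k] f), rfl, fun k hk => ?_, lft d m (evf w), lft_evf_mem hw, ?_⟩
    · simp only [Function.iterate_succ_apply']
      exact lft_flow_ll i j hij.ne (iter_cd (fun k f h => DijW_cd i j h) k 1 f (hf.of_le (by norm_cast; omega)))
    · have hc : ContinuousOn (fun x => (DijW i j)^[r] f x - evf w x) (cB d) := (hcdD i j r le_rfl).sub (evf_cont w).continuousOn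
      have : nrm σ p (lft d m ((DijW i j)^[r] f) - lft d m (evf w)) ≤ B0 := by
        rw [lft_sub (hcdD i j r le_rfl) (evf_cont w).continuousOn]
        apply nrm_le_of σ p hB0n
        rw [lft_eLp p hc, hK _ hc, hB0']
        gcongr
      nlinarith
  have good_lr : ∀ (i : Fin d) (l : Fin m), Good σ p r n (lft d m f) (C1 * B0) ⟨(Sum.inl i, Sum.inr l), by simp⟩ := by
    intro i l
    have hex : ∀ j : ℕ, ∃ w : MvPolynomial (Fin d) ℝ, w.totalDegree ≤ n - r ∧ (1 ≤ j → j ≤ r →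
        eLpNorm (fun x => (gW i)^[j] f x - evf w x) p (ballMeasure d (((m:ℝ)-1)/2 + (((2 * j - r : ℕ) : ℝ) / 2) * p.toReal)) ≤ A) := by
      intro j
      by_cases hj : 1 ≤ j ∧ j ≤ r
      · obtain ⟨w, hw, hwA⟩ := ex_poly (h2 i j hj.1 hj.2) (iter_eq (fun f g h => gW_eq i f g h) f j)
        exact ⟨w, hw, fun _ _ => hwA⟩
      · exact ⟨0, by simp, fun h h' => absurd ⟨h, h'⟩ hj⟩
    choose w hw hwA using hex
    refine (hC i l n hn.le (fun j => lft d m ((gW i)^[j] f)) (fun j => lft d m (evf (w j))) B0 (fun j hj => ?_)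
      (fun j => lft_evf_mem (hw j)) (fun j hj hj' => ?_)).mono (mul_le_mul_of_nonneg_right (hCl i l) hB0n)
    · simp only [Function.iterate_succ_apply']
      exact lft_flow_lr i l (iter_cd (fun k f h => gW_cd i h) j 1 f (hf.of_le (by norm_cast; omega)))
    · have hc : ContinuousOn (fun x => (gW i)^[j] f x - evf (w j) x) (cB d) := (hcdg i j hj').sub (evf_cont (w j)).continuousOn
      have hφ : Continuous (phiB (d := d)) := by unfold phiB; fun_prop
      have hc2 : ContinuousOn (fun x => phiB x ^ (2 * j - r) * ((gW i)^[j] f x - evf (w j) x)) (cB d) :=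
        (hφ.pow _).continuousOn.mul hc
      simp only
      rw [lft_sub (hcdg i j hj') (evf_cont (w j)).continuousOn]
      apply nrm_le_of σ p hB0n
      have e1 : eLpNorm (toC (X (Sum.inr l)) ^ (2 * j - r) * lft d m (fun x => (gW i)^[j] f x - evf (w j) x) : C(Sp (Fin d ⊕ Fin m), ℝ)) p σ
          ≤ eLpNorm (fun z => (fun x => phiB x ^ (2 * j - r) * ((gW i)^[j] f x - evf (w j) x)) (prS d m z)) p σ := by
        refine eLpNorm_mono fun z => ?_
        rw [ContinuousMap.mul_apply, ContinuousMap.pow_apply, toC_apply, eval_X, lft_apply hc, norm_mul, norm_mul, norm_pow, norm_pow]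
        gcongr
        rw [Real.norm_eq_abs, Real.norm_eq_abs]
        exact (y_le_phi z l).trans (le_abs_self _)
      refine e1.trans ?_
      rw [hK _ hc2, hB0']
      gcongr
      exact (weight p hp _ _ _).trans (hwA j hj hj')
  have hB1 : 0 ≤ C1 * B0 := by positivity
  have good : ∀ a, Good σ p r n (lft d m f) (C1 * B0) a := by
    rintro ⟨⟨i | k, j | l⟩, ha⟩
    · rcases lt_trichotomy i j with h | h | h
      · exact good_ll i j h
      · exact absurd (by simp [h]) ha
      · exact (good_ll j i h).sw
    · exact good_lr i l
    · exact (good_lr j k).sw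
    · refine ⟨fun k => if k = 0 then lft d m f else 0, by simp, fun j hj => ?_, 0, Submodule.zero_mem _, ?_⟩
      · rcases Nat.eq_zero_or_pos j with rfl | h
        · simpa using lft_flow_rr k l (by simpa using ha) (hf.of_le (by norm_cast))
        · simp only [h.ne', if_false, Nat.succ_ne_zero]
          exact fun x t => hasDerivAt_const _ _
      · have hr0 : r ≠ 0 := by omega
        simp only [hr0, if_false, sub_zero, nrm_zero]; exact hB1
  choose G hG0 hG1 hG2 using good
  have hfin := hmain n (by omega) (lft d m f) G hG0 hG1 (C1 * B0) hG2
  obtain ⟨a, ha, hV⟩ := V_poly (m := m) hm hf0 (by omega : 2 ≤ n)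
  have hc : ContinuousOn (fun x => f x - evf a x) (cB d) := hf0.sub (evf_cont a).continuousOn
  rw [hV, lft_sub hf0 (evf_cont a).continuousOn] at hfin
  have hn0 : (0 : ℝ) < n := by exact_mod_cast (by omega : 0 < n)
  have hfin2 : nrm σ p (lft d m fun x => f x - evf a x) ≤ c0 * C1 * (n : ℝ)⁻¹ ^ r * B0 := by
    refine ((le_div_iff₀ (by positivity)).2 hfin).trans (le_of_eq ?_)
    rw [inv_pow, div_eq_mul_inv]; ring
  have hfin3 := ENNReal.ofReal_le_ofReal hfin2
  rw [ofReal_nrm, lft_eLp p hc, hK _ hc, ENNReal.ofReal_mul (by positivity), ENNReal.ofReal_mul (by positivity), hB0',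
    ENNReal.ofReal_pow (by positivity), ENNReal.ofReal_inv_of_pos hn0, ENNReal.ofReal_natCast, ← mul_assoc, mul_comm _ K, mul_assoc K,
    ENNReal.mul_le_mul_iff_right hK0 hKt] at hfin3
  exact (iInf_le _ (⟨a, ha⟩ : {g : MvPolynomial (Fin d) ℝ // g.totalDegree ≤ 2 * n})).trans hfin3
end P12a
end BallApprox
theorem stmt_17 (d : ℕ) (hd : 1 ≤ d) (r : ℕ) (hr : 1 ≤ r) (p : ℝ≥0∞) (hp : 1 ≤ p)
    (m : ℕ) (hm : 1 ≤ m) (μ : ℝ) (hμ : μ = ((m : ℝ) - 1) / 2) :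
    ∃ c : ℝ≥0, 0 < c ∧
      ∀ f : EuclideanSpace ℝ (Fin d) → ℝ,
        ContDiffOn ℝ r f (Metric.closedBall (0 : EuclideanSpace ℝ (Fin d)) 1) →
        ∀ n : ℕ, r < n →
          ballEn d μ p (2 * n) f ≤
            (c : ℝ≥0∞) * ((n : ℝ≥0∞)⁻¹) ^ r *
                (⨆ i : Fin d, ⨆ j : Fin d, ⨆ _ : i < j,
                  ballEn d μ p n ((Dij i j)^[r] f)) +
              (c : ℝ≥0∞) * ((n : ℝ≥0∞)⁻¹) ^ r *
                ⨆ i : Fin d,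
                  ((⨆ j : ℕ, ⨆ _ : 1 ≤ j ∧ (j : ℝ) < ((r : ℝ) + 1) / 2,
                      ballEn d μ p (n - r) ((pder i)^[j] f)) +
                    ⨆ j : ℕ, ⨆ _ : ((r : ℝ) + 1) / 2 ≤ (j : ℝ) ∧ j ≤ r,
                      ballEn d (μ + ((j : ℝ) - (r : ℝ) / 2) * p.toReal) p (n - r)
                        ((pder i)^[j] f)) := by
  have : Fact (1 ≤ p) := ⟨hp⟩
  obtain ⟨c, hc, H⟩ := BallApprox.core (m := m) hd r hr p hm
  rw [← hμ] at H
  refine ⟨c.toNNReal + 1, by positivity, fun f hf n hn => ?_⟩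
  rw [← mul_add]
  set A1 := ⨆ i : Fin d, ⨆ j : Fin d, ⨆ _ : i < j, ballEn d μ p n ((Dij i j)^[r] f) with hA1
  set A2 := ⨆ i : Fin d,
                  ((⨆ j : ℕ, ⨆ _ : 1 ≤ j ∧ (j : ℝ) < ((r : ℝ) + 1) / 2,
                      ballEn d μ p (n - r) ((pder i)^[j] f)) +
                    ⨆ j : ℕ, ⨆ _ : ((r : ℝ) + 1) / 2 ≤ (j : ℝ) ∧ j ≤ r,
                      ballEn d (μ + ((j : ℝ) - (r : ℝ) / 2) * p.toReal) p (n - r)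
                        ((pder i)^[j] f)) with hA2
  have hb1 : ∀ i j : Fin d, i < j → ballEn d μ p n ((Dij i j)^[r] f) ≤ A1 + A2 := by
    intro i j hij
    refine le_trans ?_ le_self_add
    exact le_iSup_of_le i (le_iSup_of_le j (le_iSup_of_le hij le_rfl))
  have hb2 : ∀ (i : Fin d) (j : ℕ), 1 ≤ j → j ≤ r →
      ballEn d (μ + (((2 * j - r : ℕ) : ℝ) / 2) * p.toReal) p (n - r) ((pder i)^[j] f) ≤ A1 + A2 := by
    intro i j h1 h2
    refine le_trans ?_ le_add_self
    refine le_iSup_of_le i ?_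
    by_cases h : 2 * j ≤ r
    · refine le_trans ?_ le_self_add
      have h3 : (j : ℝ) < ((r : ℝ) + 1) / 2 := by
        have : (2 * j : ℝ) ≤ r := by exact_mod_cast h
        linarith
      rw [show 2 * j - r = 0 by omega]
      refine le_iSup_of_le j (le_iSup_of_le ⟨h1, h3⟩ ?_)
      simp
    · refine le_trans ?_ le_add_self
      have h3 : ((r : ℝ) + 1) / 2 ≤ (j : ℝ) := by
        have : (r : ℝ) + 1 ≤ 2 * j := by exact_mod_cast (by omega : r + 1 ≤ 2 * j)
        linarith
      refine le_iSup_of_le j (le_iSup_of_le ⟨h3, h2⟩ ?_)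
      rw [Nat.cast_sub (by omega : r ≤ 2 * j), Nat.cast_mul]
      apply le_of_eq
      congr 2
      push_cast; ring
  clear_value A1 A2
  have hn0 : ((n : ℝ≥0∞)⁻¹) ^ r ≠ 0 := pow_ne_zero _ (ENNReal.inv_ne_zero.2 (ENNReal.natCast_ne_top n))
  have hnt : ((n : ℝ≥0∞)⁻¹) ^ r ≠ ∞ :=
    ENNReal.pow_ne_top (ENNReal.inv_ne_top.2 (by exact_mod_cast (by omega : n ≠ 0)))
  have hcc : ENNReal.ofReal c ≤ ((c.toNNReal + 1 : ℝ≥0) : ℝ≥0∞) := by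
    rw [ENNReal.ofReal]; exact_mod_cast le_self_add
  by_cases hA : A1 + A2 = ∞
  · rw [hA, ENNReal.mul_top]
    · exact le_top
    · refine mul_ne_zero ?_ hn0
      simp
  have hm0 : ENNReal.ofReal c * ((n : ℝ≥0∞)⁻¹) ^ r ≠ ∞ := ENNReal.mul_ne_top ENNReal.ofReal_ne_top hnt
  refine le_trans ?_ (mul_le_mul_left (mul_le_mul_left hcc _) _)
  have key : ∀ ε : ℝ≥0, 0 < ε → ballEn d μ p (2 * n) f ≤ ENNReal.ofReal c * ((n : ℝ≥0∞)⁻¹) ^ r * (A1 + A2 + ε) := by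
    intro ε hε
    have hlt : A1 + A2 < A1 + A2 + ε := ENNReal.lt_add_right hA (by exact_mod_cast hε.ne')
    exact H f hf n hn _ (ENNReal.add_ne_top.2 ⟨hA, ENNReal.coe_ne_top⟩)
      (fun i j hij => (hb1 i j hij).trans_lt hlt) (fun i j h1 h2 => (hb2 i j h1 h2).trans_lt hlt)
  have hlim : Filter.Tendsto (fun ε : ℝ≥0 => ENNReal.ofReal c * ((n : ℝ≥0∞)⁻¹) ^ r * (A1 + A2 + ε)) (nhdsWithin 0 (Set.Ioi 0))
      (nhds (ENNReal.ofReal c * ((n : ℝ≥0∞)⁻¹) ^ r * (A1 + A2 + (0 : ℝ≥0)))) := by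
    refine Filter.Tendsto.mono_left ?_ nhdsWithin_le_nhds
    refine ENNReal.Tendsto.const_mul ?_ (Or.inr hm0)
    exact tendsto_const_nhds.add (ENNReal.tendsto_coe.2 Filter.tendsto_id)
  have h := ge_of_tendsto hlim (Filter.eventually_of_mem self_mem_nhdsWithin fun ε hε => key ε hε)
  simpa using h
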